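/- Suppose |1−χ| = O(ε), Re < Re₀ and ε ≤ ε₂. Then for all t ∈ [0,T]: A₁(t) + A₂(t) ≤ C(A₁(0) + A₂(0) + ε⁻²A₀(0)), where C depends only on Re, Pr, μ′/μ and γ. -/

import Mathlib

noncomputable section

open MeasureTheory Real Filter Topology

namespace Couette

/-- The periodic cell of the horizontally periodic layer `Ω = 𝕊¹ × (0,1)`. -/
def Ω : Set (ℝ × ℝ) := {x : ℝ × ℝ | x.1 ∈ Set.Ioo 0 (2 * π) ∧ x.2 ∈ Set.Ioo 0 1}

variable {F : Type*} [NormedAddCommGroup F] [NormedSpace ℝ F]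

/-- Partial derivative in the horizontal direction `x₁`. -/
def d1 (f : ℝ × ℝ → F) (x : ℝ × ℝ) : F := fderiv ℝ f x (1, 0)

/-- Partial derivative in the vertical direction `x₂`. -/
def d2 (f : ℝ × ℝ → F) (x : ℝ × ℝ) : F := fderiv ℝ f x (0, 1)

/-- Time derivative of a time-dependent field. -/
def dt (f : ℝ → ℝ × ℝ → F) (t : ℝ) (x : ℝ × ℝ) : F := deriv (fun s => f s x) t

/-- Divergence of a (two-dimensional) vector field. -/
def divv (v : ℝ × ℝ → ℝ × ℝ) (x : ℝ × ℝ) : ℝ :=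
  d1 (fun y => (v y).1) x + d2 (fun y => (v y).2) x

/-- Gradient of a scalar field. -/
def grad (f : ℝ × ℝ → ℝ) (x : ℝ × ℝ) : ℝ × ℝ := (d1 f x, d2 f x)

/-- Laplacian. -/
def lap (f : ℝ × ℝ → F) (x : ℝ × ℝ) : F := d1 (d1 f) x + d2 (d2 f) x

/-- Euclidean inner product on `ℝ²`. -/
def dot (a b : ℝ × ℝ) : ℝ := a.1 * b.1 + a.2 * b.2

/-- The contraction `𝔇(v) : 𝔇(w)` of deformation tensors, where
`𝔇(v) = (∇v + (∇v)ᵀ)/2`. -/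
def defContract (v w : ℝ × ℝ → ℝ × ℝ) (x : ℝ × ℝ) : ℝ :=
  d1 (fun y => (v y).1) x * d1 (fun y => (w y).1) x
    + d2 (fun y => (v y).2) x * d2 (fun y => (w y).2) x
    + 2 * ((d1 (fun y => (v y).2) x + d2 (fun y => (v y).1) x) / 2)
        * ((d1 (fun y => (w y).2) x + d2 (fun y => (w y).1) x) / 2)

/-- Squared `L²(Ω)` norm of the `j`-th spatial derivative. -/
def dSq (j : ℕ) (f : ℝ × ℝ → F) : ℝ := ∫ x in Ω, ‖iteratedFDeriv ℝ j f x‖ ^ 2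

/-- Squared `L²(Ω)` norm. -/
def L2Sq (f : ℝ × ℝ → F) : ℝ := dSq 0 f

/-- Squared `Hᵏ(Ω)` norm. -/
def HSq (k : ℕ) (f : ℝ × ℝ → F) : ℝ := ∑ j ∈ Finset.range (k + 1), dSq j f

/-- `L∞(Ω)` (sup) norm. -/
def LinfSup (f : ℝ × ℝ → F) : ℝ := ⨆ x ∈ Ω, ‖f x‖

/-- Membership in the Sobolev space `Hᵏ(Ω)`. -/
def MemH (k : ℕ) (f : ℝ × ℝ → F) : Prop :=
  ∀ j ≤ k, IntegrableOn (fun x => ‖iteratedFDeriv ℝ j f x‖ ^ 2) Ω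

/-- Continuity in time, with values in `Hᵏ(Ω)`, on the time set `s`. -/
def ContInH (k : ℕ) (f : ℝ → ℝ × ℝ → F) (s : Set ℝ) : Prop :=
  (∀ t ∈ s, MemH k (f t)) ∧
    ∀ t₀ ∈ s, Tendsto (fun t => HSq k (fun x => f t x - f t₀ x)) (nhdsWithin t₀ s) (nhds 0)

/-- Square integrability in time, with values in `Hᵏ(Ω)`, on the time set `s`. -/
def L2InH (k : ℕ) (f : ℝ → ℝ × ℝ → F) (s : Set ℝ) : Prop :=
  IntegrableOn (fun t => HSq k (f t)) s

/-- Temperature `𝒯̃` of the non-dimensional plane Couette flow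
(here `C_p = γ/(γ-1)`, the gas constant being normalized to `R = 1`). -/
def tT (γ Pr ε χ : ℝ) (x : ℝ × ℝ) : ℝ :=
  χ + (1 - χ) * x.2 - ε ^ 2 * Pr / (2 * (γ / (γ - 1))) * (x.2 ^ 2 - x.2)

/-- Density `ρ̃ = 𝒯̃⁻¹` of the plane Couette flow. -/
def tρ (γ Pr ε χ : ℝ) (x : ℝ × ℝ) : ℝ := (tT γ Pr ε χ x)⁻¹

/-- Velocity `ũ = (x₂, 0)` of the plane Couette flow. -/
def tu (x : ℝ × ℝ) : ℝ × ℝ := (x.2, 0)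

/-- Total density `ρ = ρ̃ + φ`. -/
def pρ (γ Pr ε χ : ℝ) (φ : ℝ → ℝ × ℝ → ℝ) (t : ℝ) (x : ℝ × ℝ) : ℝ := tρ γ Pr ε χ x + φ t x

/-- Total temperature `𝒯 = 𝒯̃ + θ`. -/
def pT (γ Pr ε χ : ℝ) (θ : ℝ → ℝ × ℝ → ℝ) (t : ℝ) (x : ℝ × ℝ) : ℝ := tT γ Pr ε χ x + θ t x

/-- Total velocity `u = ũ + ψ`. -/
def pu (ψ : ℝ → ℝ × ℝ → ℝ × ℝ) (t : ℝ) (x : ℝ × ℝ) : ℝ × ℝ := tu x + ψ t x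

/-- A classical solution `(φ, ψ, θ) = (ρ - ρ̃, u - ũ, 𝒯 - 𝒯̃)` of the perturbation
system around the plane Couette flow on `Ω × [0,T]`, with non-slip and isothermal
boundary conditions and periodicity in `x₁`.  Here `μ = 1/Re`, `μ' = r·μ`
(`r = μ'/μ = ν'/ν`), and `κ = C_p/(Re·Pr)` with `C_p = γ/(γ-1)`. -/
structure PerturbSol (γ Pr r Re ε χ T : ℝ) where
  φ : ℝ → ℝ × ℝ → ℝ
  ψ : ℝ → ℝ × ℝ → ℝ × ℝ
  θ : ℝ → ℝ × ℝ → ℝ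
  mass_eq : ∀ t ∈ Set.Icc (0 : ℝ) T, ∀ x ∈ Ω,
    dt φ t x + dot (pu ψ t x) (grad (φ t) x) + pρ γ Pr ε χ φ t x * divv (ψ t) x
      + dot (ψ t x) (grad (tρ γ Pr ε χ) x) = 0
  mom_eq1 : ∀ t ∈ Set.Icc (0 : ℝ) T, ∀ x ∈ Ω,
    pρ γ Pr ε χ φ t x * ((dt ψ t x).1 + dot (pu ψ t x) (grad (fun y => (ψ t y).1) x)
        + dot (ψ t x) (grad (fun y => (tu y).1) x))
      + (ε ^ 2)⁻¹ * d1 (fun y => pρ γ Pr ε χ φ t y * pT γ Pr ε χ θ t y) x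
      - Re⁻¹ * lap (fun y => (ψ t y).1) x
      - (Re⁻¹ + r * Re⁻¹) * d1 (divv (ψ t)) x = 0
  mom_eq2 : ∀ t ∈ Set.Icc (0 : ℝ) T, ∀ x ∈ Ω,
    pρ γ Pr ε χ φ t x * ((dt ψ t x).2 + dot (pu ψ t x) (grad (fun y => (ψ t y).2) x)
        + dot (ψ t x) (grad (fun y => (tu y).2) x))
      + (ε ^ 2)⁻¹ * d2 (fun y => pρ γ Pr ε χ φ t y * pT γ Pr ε χ θ t y) x
      - Re⁻¹ * lap (fun y => (ψ t y).2) x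
      - (Re⁻¹ + r * Re⁻¹) * d2 (divv (ψ t)) x = 0
  energy_eq : ∀ t ∈ Set.Icc (0 : ℝ) T, ∀ x ∈ Ω,
    pρ γ Pr ε χ φ t x / (γ - 1) * (dt θ t x + dot (pu ψ t x) (grad (θ t) x)
        + dot (ψ t x) (grad (tT γ Pr ε χ) x))
      + pρ γ Pr ε χ φ t x * pT γ Pr ε χ θ t x * divv (ψ t) x
      - γ / (γ - 1) / (Re * Pr) * lap (θ t) x
      = ε ^ 2 * (2 * Re⁻¹ * defContract (ψ t) (ψ t) x
          + 4 * Re⁻¹ * defContract tu (ψ t) x + r * Re⁻¹ * (divv (ψ t) x) ^ 2)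
  bc_ψ : ∀ t ∈ Set.Icc (0 : ℝ) T, ∀ x : ℝ × ℝ, (x.2 = 0 ∨ x.2 = 1) → ψ t x = 0
  bc_θ : ∀ t ∈ Set.Icc (0 : ℝ) T, ∀ x : ℝ × ℝ, (x.2 = 0 ∨ x.2 = 1) → θ t x = 0
  periodic_φ : ∀ t x, φ t (x.1 + 2 * π, x.2) = φ t x
  periodic_ψ : ∀ t x, ψ t (x.1 + 2 * π, x.2) = ψ t x
  periodic_θ : ∀ t x, θ t (x.1 + 2 * π, x.2) = θ t x

/-- Smoothness (in time and space) of a solution of the perturbation system. -/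
def SmoothSol {γ Pr r Re ε χ T : ℝ} (S : PerturbSol γ Pr r Re ε χ T) : Prop :=
  ContDiff ℝ (⊤ : ℕ∞) (Function.uncurry S.φ) ∧ ContDiff ℝ (⊤ : ℕ∞) (Function.uncurry S.ψ) ∧
    ContDiff ℝ (⊤ : ℕ∞) (Function.uncurry S.θ)

/-- Standing hypotheses on a solution of the perturbation system: initial regularity
`(φ₀, ψ₀, θ₀) ∈ H³`, zero average of the initial density perturbation, and the
compatibility conditions `∂tψ(0) = ∂tθ(0) = 0` on `∂Ω`. -/
def StdHyp {γ Pr r Re ε χ T : ℝ} (S : PerturbSol γ Pr r Re ε χ T) : Prop :=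
  MemH 3 (S.φ 0) ∧ MemH 3 (S.ψ 0) ∧ MemH 3 (S.θ 0) ∧
    (∫ x in Ω, S.φ 0 x) = 0 ∧
    ∀ x : ℝ × ℝ, (x.2 = 0 ∨ x.2 = 1) → dt S.ψ 0 x = 0 ∧ dt S.θ 0 x = 0

/-- The energy functional `A₀`. -/
def A0 (ε : ℝ) (φ : ℝ → ℝ × ℝ → ℝ) (ψ : ℝ → ℝ × ℝ → ℝ × ℝ) (θ : ℝ → ℝ × ℝ → ℝ)
    (t : ℝ) : ℝ :=
  (⨆ s ∈ Set.Icc (0 : ℝ) t,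
      (L2Sq (ψ s) + (ε ^ 2)⁻¹ * L2Sq (φ s) + (ε ^ 2)⁻¹ * L2Sq (θ s)))
    + ∫ s in (0 : ℝ)..t, (HSq 1 (ψ s) + (ε ^ 2)⁻¹ * HSq 1 (θ s))

/-- The energy functional `A₁`. -/
def A1 (ε : ℝ) (φ : ℝ → ℝ × ℝ → ℝ) (ψ : ℝ → ℝ × ℝ → ℝ × ℝ) (θ : ℝ → ℝ × ℝ → ℝ)
    (t : ℝ) : ℝ :=
  (⨆ s ∈ Set.Icc (0 : ℝ) t, (dSq 1 (ψ s) + (ε ^ 2)⁻¹ * dSq 1 (θ s)))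
    + ∫ s in (0 : ℝ)..t, (L2Sq (dt ψ s) + (ε ^ 2)⁻¹ * L2Sq (dt θ s))

/-- The energy functional `A₂`. -/
def A2 (ε : ℝ) (φ : ℝ → ℝ × ℝ → ℝ) (ψ : ℝ → ℝ × ℝ → ℝ × ℝ) (θ : ℝ → ℝ × ℝ → ℝ)
    (t : ℝ) : ℝ :=
  (ε ^ 2)⁻¹ * (⨆ s ∈ Set.Icc (0 : ℝ) t, dSq 1 (φ s))
    + (∫ s in (0 : ℝ)..t, ((ε ^ 4)⁻¹ * HSq 1 (φ s) + (ε ^ 2)⁻¹ * L2Sq (dt φ s)))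
    + ∫ s in (0 : ℝ)..t, (HSq 2 (ψ s) + (ε ^ 2)⁻¹ * HSq 2 (θ s))

/-- The energy functional `A₃`. -/
def A3 (ε : ℝ) (φ : ℝ → ℝ × ℝ → ℝ) (ψ : ℝ → ℝ × ℝ → ℝ × ℝ) (θ : ℝ → ℝ × ℝ → ℝ)
    (t : ℝ) : ℝ :=
  (⨆ s ∈ Set.Icc (0 : ℝ) t,
      ((ε ^ 2)⁻¹ * L2Sq (dt φ s) + L2Sq (dt ψ s) + (ε ^ 2)⁻¹ * L2Sq (dt θ s)))
    + ∫ s in (0 : ℝ)..t, (dSq 1 (dt ψ s) + (ε ^ 2)⁻¹ * dSq 1 (dt θ s))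

/-- The energy functional `A₄`. -/
def A4 (ε : ℝ) (φ : ℝ → ℝ × ℝ → ℝ) (ψ : ℝ → ℝ × ℝ → ℝ × ℝ) (θ : ℝ → ℝ × ℝ → ℝ)
    (t : ℝ) : ℝ :=
  (⨆ s ∈ Set.Icc (0 : ℝ) t,
      ((ε ^ 2)⁻¹ * dSq 2 (φ s) + dSq 2 (ψ s) + (ε ^ 2)⁻¹ * dSq 2 (θ s)))
    + ∫ s in (0 : ℝ)..t, ((ε ^ 4)⁻¹ * HSq 2 (φ s) + HSq 3 (ψ s) + (ε ^ 2)⁻¹ * HSq 3 (θ s))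

/-- The energy functional `A₅`. -/
def A5 (ε : ℝ) (φ : ℝ → ℝ × ℝ → ℝ) (ψ : ℝ → ℝ × ℝ → ℝ × ℝ) (θ : ℝ → ℝ × ℝ → ℝ)
    (t : ℝ) : ℝ :=
  (⨆ s ∈ Set.Icc (0 : ℝ) t,
      ((ε ^ 2)⁻¹ * dSq 3 (φ s) + (dSq 3 (ψ s) + dSq 1 (dt ψ s))
        + (ε ^ 2)⁻¹ * (dSq 3 (θ s) + dSq 1 (dt θ s))))
    + ∫ s in (0 : ℝ)..t, (L2Sq (dt (dt ψ) s) + (ε ^ 2)⁻¹ * L2Sq (dt (dt θ) s))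

/-- The total weighted energy functional `N(t)`. -/
def Nfun (ε : ℝ) (φ : ℝ → ℝ × ℝ → ℝ) (ψ : ℝ → ℝ × ℝ → ℝ × ℝ) (θ : ℝ → ℝ × ℝ → ℝ)
    (t : ℝ) : ℝ :=
  (ε ^ 2)⁻¹ * A0 ε φ ψ θ t + A1 ε φ ψ θ t + A2 ε φ ψ θ t
    + ε ^ 2 * A3 ε φ ψ θ t + ε ^ 2 * A4 ε φ ψ θ t + ε ^ 4 * A5 ε φ ψ θ t

/-- The relative entropy
`η = (ε²ρ/𝒯̃)|ψ|² + (ρ/(γ-1))(𝒯/𝒯̃ - ln(𝒯/𝒯̃) - 1) + ρ(τ/τ̃ - ln(τ/τ̃) - 1)`,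
where `τ = 1/ρ`, `τ̃ = 1/ρ̃`. -/
def relEnt (γ Pr ε χ : ℝ) (φ θ : ℝ → ℝ × ℝ → ℝ) (ψ : ℝ → ℝ × ℝ → ℝ × ℝ)
    (t : ℝ) (x : ℝ × ℝ) : ℝ :=
  ε ^ 2 * pρ γ Pr ε χ φ t x / tT γ Pr ε χ x * ‖ψ t x‖ ^ 2
    + pρ γ Pr ε χ φ t x / (γ - 1) *
        (pT γ Pr ε χ θ t x / tT γ Pr ε χ x
          - Real.log (pT γ Pr ε χ θ t x / tT γ Pr ε χ x) - 1)
    + pρ γ Pr ε χ φ t x *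
        ((pρ γ Pr ε χ φ t x)⁻¹ / (tρ γ Pr ε χ x)⁻¹
          - Real.log ((pρ γ Pr ε χ φ t x)⁻¹ / (tρ γ Pr ε χ x)⁻¹) - 1)

/-- A classical solution `(ρ, u, 𝒯)` of the non-dimensional full compressible
Navier–Stokes system on `Ω × (0,∞)`, with non-slip and isothermal boundary
conditions and periodicity in `x₁`. -/
structure FullSol (γ Pr r Re ε χ : ℝ) where
  rho : ℝ → ℝ × ℝ → ℝ
  vel : ℝ → ℝ × ℝ → ℝ × ℝ
  temp : ℝ → ℝ × ℝ → ℝ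
  mass_eq : ∀ t ∈ Set.Ioi (0 : ℝ), ∀ x ∈ Ω,
    dt rho t x + divv (fun y => rho t y • vel t y) x = 0
  mom_eq1 : ∀ t ∈ Set.Ioi (0 : ℝ), ∀ x ∈ Ω,
    rho t x * ((dt vel t x).1 + dot (vel t x) (grad (fun y => (vel t y).1) x))
      + (ε ^ 2)⁻¹ * d1 (fun y => rho t y * temp t y) x
      = Re⁻¹ * lap (fun y => (vel t y).1) x + (Re⁻¹ + r * Re⁻¹) * d1 (divv (vel t)) x
  mom_eq2 : ∀ t ∈ Set.Ioi (0 : ℝ), ∀ x ∈ Ω,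
    rho t x * ((dt vel t x).2 + dot (vel t x) (grad (fun y => (vel t y).2) x))
      + (ε ^ 2)⁻¹ * d2 (fun y => rho t y * temp t y) x
      = Re⁻¹ * lap (fun y => (vel t y).2) x + (Re⁻¹ + r * Re⁻¹) * d2 (divv (vel t)) x
  energy_eq : ∀ t ∈ Set.Ioi (0 : ℝ), ∀ x ∈ Ω,
    rho t x / (γ - 1) * (dt temp t x + dot (vel t x) (grad (temp t) x))
      + rho t x * temp t x * divv (vel t) x
      = γ / (γ - 1) / (Re * Pr) * lap (temp t) x
        + ε ^ 2 * (2 * Re⁻¹ * defContract (vel t) (vel t) x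
            + r * Re⁻¹ * (divv (vel t) x) ^ 2)
  bc_top : ∀ t ∈ Set.Ioi (0 : ℝ), ∀ x : ℝ × ℝ, x.2 = 1 →
    vel t x = (1, 0) ∧ temp t x = 1
  bc_bot : ∀ t ∈ Set.Ioi (0 : ℝ), ∀ x : ℝ × ℝ, x.2 = 0 →
    vel t x = 0 ∧ temp t x = χ
  periodic_rho : ∀ t x, rho t (x.1 + 2 * π, x.2) = rho t x
  periodic_vel : ∀ t x, vel t (x.1 + 2 * π, x.2) = vel t x
  periodic_temp : ∀ t x, temp t (x.1 + 2 * π, x.2) = temp t x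

/-- `∂tφ(0)`, defined from the initial data by taking `t = 0` in the mass equation
of the perturbation system. -/
def dtφ0 (γ Pr ε χ : ℝ) (φ₀ : ℝ × ℝ → ℝ) (ψ₀ : ℝ × ℝ → ℝ × ℝ) (x : ℝ × ℝ) : ℝ :=
  -(dot (tu x + ψ₀ x) (grad φ₀ x) + (tρ γ Pr ε χ x + φ₀ x) * divv ψ₀ x
      + dot (ψ₀ x) (grad (tρ γ Pr ε χ) x))

/-- `∂tψ(0)`, defined from the initial data by taking `t = 0` in the momentum
equation of the perturbation system. -/
def dtψ0 (γ Pr r Re ε χ : ℝ) (φ₀ θ₀ : ℝ × ℝ → ℝ) (ψ₀ : ℝ × ℝ → ℝ × ℝ)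
    (x : ℝ × ℝ) : ℝ × ℝ :=
  ((tρ γ Pr ε χ x + φ₀ x)⁻¹ *
      (Re⁻¹ * lap (fun y => (ψ₀ y).1) x + (Re⁻¹ + r * Re⁻¹) * d1 (divv ψ₀) x
        - (ε ^ 2)⁻¹ * d1 (fun y => (tρ γ Pr ε χ y + φ₀ y) * (tT γ Pr ε χ y + θ₀ y)) x)
      - dot (tu x + ψ₀ x) (grad (fun y => (ψ₀ y).1) x)
      - dot (ψ₀ x) (grad (fun y => (tu y).1) x),
   (tρ γ Pr ε χ x + φ₀ x)⁻¹ *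
      (Re⁻¹ * lap (fun y => (ψ₀ y).2) x + (Re⁻¹ + r * Re⁻¹) * d2 (divv ψ₀) x
        - (ε ^ 2)⁻¹ * d2 (fun y => (tρ γ Pr ε χ y + φ₀ y) * (tT γ Pr ε χ y + θ₀ y)) x)
      - dot (tu x + ψ₀ x) (grad (fun y => (ψ₀ y).2) x)
      - dot (ψ₀ x) (grad (fun y => (tu y).2) x))

/-- `∂tθ(0)`, defined from the initial data by taking `t = 0` in the temperature
equation of the perturbation system. -/
def dtθ0 (γ Pr r Re ε χ : ℝ) (φ₀ θ₀ : ℝ × ℝ → ℝ) (ψ₀ : ℝ × ℝ → ℝ × ℝ)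
    (x : ℝ × ℝ) : ℝ :=
  (γ - 1) * (tρ γ Pr ε χ x + φ₀ x)⁻¹ *
      (γ / (γ - 1) / (Re * Pr) * lap θ₀ x
        - (tρ γ Pr ε χ x + φ₀ x) * (tT γ Pr ε χ x + θ₀ x) * divv ψ₀ x
        + ε ^ 2 * (2 * Re⁻¹ * defContract ψ₀ ψ₀ x + 4 * Re⁻¹ * defContract tu ψ₀ x
            + r * Re⁻¹ * (divv ψ₀ x) ^ 2))
    - dot (tu x + ψ₀ x) (grad θ₀ x) - dot (ψ₀ x) (grad (tT γ Pr ε χ) x)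
set_option linter.unusedSimpArgs false
set_option linter.unusedVariables false
set_option linter.style.whitespace false

/-- Scalar space-time fields. -/
abbrev Fld := ℝ → ℝ × ℝ → ℝ

/-- Smooth scalar fields. -/
def Sm (f : Fld) : Prop := ContDiff ℝ (⊤ : ℕ∞) (Function.uncurry f)

def D1 (f : Fld) : Fld := fun t x => d1 (f t) x
def D2 (f : Fld) : Fld := fun t x => d2 (f t) x
def Dt (f : Fld) : Fld := fun t x => dt f t x

/-- space-time directional derivative -/
def dd (e : ℝ × ℝ × ℝ) (f : Fld) : Fld := fun t x => fderiv ℝ (Function.uncurry f) (t, x) e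

theorem Sm.diff {f : Fld} (hf : Sm f) : Differentiable ℝ (Function.uncurry f) :=
  ContDiff.differentiable hf (by simp)

theorem Sm.slice {f : Fld} (hf : Sm f) (t : ℝ) : ContDiff ℝ (⊤ : ℕ∞) (f t) := by
  have : f t = Function.uncurry f ∘ (fun x => (t, x)) := by ext x; rfl
  rw [this]
  exact ContDiff.comp hf (by fun_prop)

theorem fderiv_slice {f : Fld} (hf : Sm f) (t : ℝ) (x v : ℝ × ℝ) :
    fderiv ℝ (f t) x v = fderiv ℝ (Function.uncurry f) (t, x) (0, v) := by
  have h1 := (hf.diff (t, x)).hasFDerivAt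
  have h2 : HasFDerivAt (fun y : ℝ × ℝ => ((t, y) : ℝ × ℝ × ℝ))
      (ContinuousLinearMap.inr ℝ ℝ (ℝ × ℝ)) x := hasFDerivAt_prodMk_right t x
  have h3 := HasFDerivAt.comp x h1 h2
  have h4 : (Function.uncurry f ∘ fun y : ℝ × ℝ => ((t, y) : ℝ × ℝ × ℝ)) = f t := by
    ext y; rfl
  rw [h4] at h3
  rw [h3.fderiv]
  simp

theorem D1_eq {f : Fld} (hf : Sm f) : D1 f = dd (0, (1, 0)) f := by
  ext t x; exact fderiv_slice hf t x _

theorem D2_eq {f : Fld} (hf : Sm f) : D2 f = dd (0, (0, 1)) f := by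
  ext t x; exact fderiv_slice hf t x _

theorem Dt_eq {f : Fld} (hf : Sm f) : Dt f = dd (1, (0, 0)) f := by
  ext t x
  have h1 := (hf.diff (t, x)).hasFDerivAt
  have h2 : HasDerivAt (fun s : ℝ => ((s, x) : ℝ × ℝ × ℝ)) (1, 0) t :=
    (hasDerivAt_id t).prodMk (hasDerivAt_const t x)
  exact (HasFDerivAt.comp_hasDerivAt t h1 h2).deriv

theorem Sm.dd {f : Fld} (hf : Sm f) (e : ℝ × ℝ × ℝ) : Sm (dd e f) := by
  have h : ContDiff ℝ (⊤ : ℕ∞) (fun z => fderiv ℝ (Function.uncurry f) z e) :=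
    (ContDiff.fderiv_right hf (m := (⊤ : ℕ∞)) (by simp)).clm_apply contDiff_const
  exact h

theorem dd_comm {f : Fld} (hf : Sm f) (e e' : ℝ × ℝ × ℝ) :
    dd e (dd e' f) = dd e' (dd e f) := by
  ext t x
  have hs : IsSymmSndFDerivAt ℝ (Function.uncurry f) (t, x) :=
    (ContDiff.contDiffAt hf).isSymmSndFDerivAt (by simp; exact WithTop.coe_le_coe.2 (le_top : (2 : ℕ∞) ≤ ⊤))
  have hd : Differentiable ℝ (fderiv ℝ (Function.uncurry f)) :=
    (ContDiff.fderiv_right hf (m := (⊤ : ℕ∞)) (by simp)).differentiable (by simp)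
  have key : ∀ a b : ℝ × ℝ × ℝ, Couette.dd a (Couette.dd b f) t x
      = fderiv ℝ (fderiv ℝ (Function.uncurry f)) (t, x) a b := by
    intro a b
    have : Function.uncurry (Couette.dd b f) = fun z => fderiv ℝ (Function.uncurry f) z b := by
      ext z; rfl
    unfold Couette.dd at this ⊢
    rw [this, fderiv_clm_apply (hd _) (differentiableAt_const _)]
    simp
  rw [key, key]
  exact hs e e'

theorem Sm.D1 {f : Fld} (hf : Sm f) : Sm (D1 f) := by rw [D1_eq hf]; exact hf.dd _
theorem Sm.D2 {f : Fld} (hf : Sm f) : Sm (D2 f) := by rw [D2_eq hf]; exact hf.dd _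
theorem Sm.Dt {f : Fld} (hf : Sm f) : Sm (Dt f) := by rw [Dt_eq hf]; exact hf.dd _

theorem D21 {f : Fld} (hf : Sm f) : D2 (D1 f) = D1 (D2 f) := by
  rw [D2_eq hf.D1, D1_eq hf.D2, D1_eq hf, D2_eq hf, dd_comm hf]
theorem Dt1 {f : Fld} (hf : Sm f) : Dt (D1 f) = D1 (Dt f) := by
  rw [Dt_eq hf.D1, D1_eq hf.Dt, D1_eq hf, Dt_eq hf, dd_comm hf]
theorem Dt2 {f : Fld} (hf : Sm f) : Dt (D2 f) = D2 (Dt f) := by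
  rw [Dt_eq hf.D2, D2_eq hf.Dt, D2_eq hf, Dt_eq hf, dd_comm hf]

theorem Sm.add {f g : Fld} (hf : Sm f) (hg : Sm g) : Sm (f + g) := ContDiff.add hf hg
theorem Sm.sub {f g : Fld} (hf : Sm f) (hg : Sm g) : Sm (f - g) := ContDiff.sub hf hg
theorem Sm.mul {f g : Fld} (hf : Sm f) (hg : Sm g) : Sm (f * g) := ContDiff.mul hf hg
theorem Sm.neg {f : Fld} (hf : Sm f) : Sm (-f) := ContDiff.neg hf
theorem Sm.smul {f : Fld} (c : ℝ) (hf : Sm f) : Sm (c • f) := ContDiff.const_smul c hf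
theorem Sm.pow {f : Fld} (n : ℕ) (hf : Sm f) : Sm (f ^ n) := ContDiff.pow hf n

theorem dd_add {f g : Fld} (hf : Sm f) (hg : Sm g) (e) : dd e (f + g) = dd e f + dd e g := by
  ext t x
  have := fderiv_add (hf.diff (t, x)) (hg.diff (t, x))
  exact congrArg (fun L => L e) this
theorem dd_sub {f g : Fld} (hf : Sm f) (hg : Sm g) (e) : dd e (f - g) = dd e f - dd e g := by
  ext t x
  have := fderiv_sub (hf.diff (t, x)) (hg.diff (t, x))
  exact congrArg (fun L => L e) this
theorem dd_neg {f : Fld} (e) : dd e (-f) = - dd e f := by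
  ext t x
  have := fderiv_neg (𝕜 := ℝ) (f := Function.uncurry f) (x := (t, x))
  exact congrArg (fun L => L e) this
theorem dd_smul {f : Fld} (hf : Sm f) (c : ℝ) (e) : dd e (c • f) = c • dd e f := by
  ext t x
  have := fderiv_const_smul (hf.diff (t, x)) c
  exact congrArg (fun L => L e) this
theorem dd_mul {f g : Fld} (hf : Sm f) (hg : Sm g) (e) :
    dd e (f * g) = dd e f * g + f * dd e g := by
  ext t x
  have := fderiv_mul (hf.diff (t, x)) (hg.diff (t, x))
  have h2 := congrArg (fun L => L e) this
  have h3 : dd e (f * g) t x = f t x * dd e g t x + g t x * dd e f t x := h2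
  rw [h3]; simp only [Pi.add_apply, Pi.mul_apply]; ring

theorem D1_add {f g : Fld} (hf : Sm f) (hg : Sm g) : D1 (f + g) = D1 f + D1 g := by
  rw [D1_eq hf, D1_eq hg, D1_eq (hf.add hg), dd_add hf hg]
theorem D2_add {f g : Fld} (hf : Sm f) (hg : Sm g) : D2 (f + g) = D2 f + D2 g := by
  rw [D2_eq hf, D2_eq hg, D2_eq (hf.add hg), dd_add hf hg]
theorem Dt_add {f g : Fld} (hf : Sm f) (hg : Sm g) : Dt (f + g) = Dt f + Dt g := by
  rw [Dt_eq hf, Dt_eq hg, Dt_eq (hf.add hg), dd_add hf hg]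
theorem D1_sub {f g : Fld} (hf : Sm f) (hg : Sm g) : D1 (f - g) = D1 f - D1 g := by
  rw [D1_eq hf, D1_eq hg, D1_eq (hf.sub hg), dd_sub hf hg]
theorem D2_sub {f g : Fld} (hf : Sm f) (hg : Sm g) : D2 (f - g) = D2 f - D2 g := by
  rw [D2_eq hf, D2_eq hg, D2_eq (hf.sub hg), dd_sub hf hg]
theorem Dt_sub {f g : Fld} (hf : Sm f) (hg : Sm g) : Dt (f - g) = Dt f - Dt g := by
  rw [Dt_eq hf, Dt_eq hg, Dt_eq (hf.sub hg), dd_sub hf hg]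
theorem D1_neg {f : Fld} (hf : Sm f) : D1 (-f) = -D1 f := by
  rw [D1_eq hf, D1_eq hf.neg, dd_neg]
theorem D2_neg {f : Fld} (hf : Sm f) : D2 (-f) = -D2 f := by
  rw [D2_eq hf, D2_eq hf.neg, dd_neg]
theorem Dt_neg {f : Fld} (hf : Sm f) : Dt (-f) = -Dt f := by
  rw [Dt_eq hf, Dt_eq hf.neg, dd_neg]
theorem D1_smul {f : Fld} (c : ℝ) (hf : Sm f) : D1 (c • f) = c • D1 f := by
  rw [D1_eq hf, D1_eq (hf.smul c), dd_smul hf]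
theorem D2_smul {f : Fld} (c : ℝ) (hf : Sm f) : D2 (c • f) = c • D2 f := by
  rw [D2_eq hf, D2_eq (hf.smul c), dd_smul hf]
theorem Dt_smul {f : Fld} (c : ℝ) (hf : Sm f) : Dt (c • f) = c • Dt f := by
  rw [Dt_eq hf, Dt_eq (hf.smul c), dd_smul hf]
theorem D1_mul {f g : Fld} (hf : Sm f) (hg : Sm g) : D1 (f * g) = D1 f * g + f * D1 g := by
  rw [D1_eq hf, D1_eq hg, D1_eq (hf.mul hg), dd_mul hf hg]
theorem D2_mul {f g : Fld} (hf : Sm f) (hg : Sm g) : D2 (f * g) = D2 f * g + f * D2 g := by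
  rw [D2_eq hf, D2_eq hg, D2_eq (hf.mul hg), dd_mul hf hg]
theorem Dt_mul {f g : Fld} (hf : Sm f) (hg : Sm g) : Dt (f * g) = Dt f * g + f * Dt g := by
  rw [Dt_eq hf, Dt_eq hg, Dt_eq (hf.mul hg), dd_mul hf hg]

/-- the vertical coordinate as a field -/
def Yf : Fld := fun _ x => x.2
theorem Yf_sm : Sm Yf := by
  have : ContDiff ℝ (⊤ : ℕ∞) (fun z : ℝ × ℝ × ℝ => z.2.2) := by fun_prop
  exact this
theorem D1_Yf : D1 Yf = 0 := by
  ext t x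
  have h : HasFDerivAt (fun y : ℝ × ℝ => y.2) (ContinuousLinearMap.snd ℝ ℝ ℝ) x := hasFDerivAt_snd
  show fderiv ℝ (fun y : ℝ × ℝ => y.2) x (1, 0) = 0
  rw [h.fderiv]; simp
theorem D2_Yf : D2 Yf = 1 := by
  ext t x
  have h : HasFDerivAt (fun y : ℝ × ℝ => y.2) (ContinuousLinearMap.snd ℝ ℝ ℝ) x := hasFDerivAt_snd
  show fderiv ℝ (fun y : ℝ × ℝ => y.2) x (0, 1) = 1
  rw [h.fderiv]; simp

/-- fields periodic in `x₁` -/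
def Per (f : Fld) : Prop := ∀ t (x : ℝ × ℝ), f t (x.1 + 2 * π, x.2) = f t x

theorem Per.add {f g : Fld} (hf : Per f) (hg : Per g) : Per (f + g) := fun t x => by
  simp only [Pi.add_apply, hf t x, hg t x]
theorem Per.sub {f g : Fld} (hf : Per f) (hg : Per g) : Per (f - g) := fun t x => by
  simp only [Pi.sub_apply, hf t x, hg t x]
theorem Per.mul {f g : Fld} (hf : Per f) (hg : Per g) : Per (f * g) := fun t x => by
  simp only [Pi.mul_apply, hf t x, hg t x]
theorem Per.neg {f : Fld} (hf : Per f) : Per (-f) := fun t x => by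
  simp only [Pi.neg_apply, hf t x]
theorem Per.smul {f : Fld} (c : ℝ) (hf : Per f) : Per (c • f) := fun t x => by
  simp only [Pi.smul_apply, hf t x]
theorem Per_Yf : Per Yf := fun _ _ => rfl

theorem per_fderiv {g : ℝ × ℝ → ℝ} (h : ∀ x : ℝ × ℝ, g (x.1 + 2 * π, x.2) = g x) (x : ℝ × ℝ) :
    fderiv ℝ g (x.1 + 2 * π, x.2) = fderiv ℝ g x := by
  have h1 : (fun y : ℝ × ℝ => g (y + (2 * π, 0))) = g := by
    ext y; rw [← h y]; congr 1; ext <;> simp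
  have h2 := fderiv_comp_add_right (𝕜 := ℝ) (f := g) (x := x) ((2 * π, 0) : ℝ × ℝ)
  rw [h1] at h2
  rw [h2]; congr 1; ext <;> simp
theorem Per.D1 {f : Fld} (hf : Per f) : Per (D1 f) := fun t x => by
  simp only [Couette.D1, d1]; rw [per_fderiv (hf t)]
theorem Per.D2 {f : Fld} (hf : Per f) : Per (D2 f) := fun t x => by
  simp only [Couette.D2, d2]; rw [per_fderiv (hf t)]
theorem Per.Dt {f : Fld} (hf : Per f) : Per (Dt f) := fun t x => by
  simp only [Couette.Dt, dt]
  congr 1; ext s; exact hf s x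

theorem hasDerivAt_Dt {f : Fld} (hf : Sm f) (t x) : HasDerivAt (fun s => f s x) (Dt f t x) t := by
  have h1 := (hf.diff (t, x)).hasFDerivAt
  have h2 : HasDerivAt (fun s : ℝ => ((s, x) : ℝ × ℝ × ℝ)) (1, 0) t :=
    (hasDerivAt_id t).prodMk (hasDerivAt_const t x)
  have := (HasFDerivAt.comp_hasDerivAt t h1 h2).differentiableAt.hasDerivAt
  exact this

theorem Sm.cont {f : Fld} (hf : Sm f) : Continuous (Function.uncurry f) := ContDiff.continuous hf
theorem Sm.contx {f : Fld} (hf : Sm f) (t : ℝ) : Continuous (f t) := (hf.slice t).continuous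

theorem Ω_eq : Ω = Set.Ioo (0:ℝ) (2 * π) ×ˢ Set.Ioo (0:ℝ) 1 := by
  ext x; simp [Ω]
theorem Ω_open : IsOpen Ω := by rw [Ω_eq]; exact isOpen_Ioo.prod isOpen_Ioo
theorem Ω_meas : MeasurableSet Ω := Ω_open.measurableSet
theorem Ω_sub : Ω ⊆ Set.Icc (0:ℝ) (2 * π) ×ˢ Set.Icc (0:ℝ) 1 := by
  rw [Ω_eq]; exact Set.prod_mono Set.Ioo_subset_Icc_self Set.Ioo_subset_Icc_self
theorem K_compact : IsCompact (Set.Icc (0:ℝ) (2 * π) ×ˢ Set.Icc (0:ℝ) 1) :=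
  isCompact_Icc.prod isCompact_Icc
theorem Ω_fin : volume Ω < ⊤ := (measure_mono Ω_sub).trans_lt K_compact.measure_lt_top

theorem intOn {g : ℝ × ℝ → ℝ} (hg : Continuous g) : IntegrableOn g Ω :=
  (hg.continuousOn.integrableOn_compact K_compact).mono_set Ω_sub

/-- integral over the cell of a field at time `t` -/
def J (f : Fld) (t : ℝ) : ℝ := ∫ x in Ω, f t x

theorem J_add {f g : Fld} (hf : Sm f) (hg : Sm g) (t) : J (f + g) t = J f t + J g t :=
  integral_add (intOn (hf.contx t)) (intOn (hg.contx t))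
theorem J_sub {f g : Fld} (hf : Sm f) (hg : Sm g) (t) : J (f - g) t = J f t - J g t :=
  integral_sub (intOn (hf.contx t)) (intOn (hg.contx t))
theorem J_neg {f : Fld} (t) : J (-f) t = - J f t := integral_neg _
theorem J_smul {f : Fld} (c : ℝ) (t) : J (c • f) t = c * J f t := integral_const_mul c _
theorem J_mono {f g : Fld} (hf : Sm f) (hg : Sm g) {t : ℝ} (h : ∀ x ∈ Ω, f t x ≤ g t x) :
    J f t ≤ J g t :=
  setIntegral_mono_on (intOn (hf.contx t)) (intOn (hg.contx t)) Ω_meas h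
theorem J_congr {f g : Fld} {t : ℝ} (h : ∀ x ∈ Ω, f t x = g t x) : J f t = J g t :=
  setIntegral_congr_fun Ω_meas h
theorem J_nonneg {f : Fld} {t : ℝ} (h : ∀ x ∈ Ω, 0 ≤ f t x) : 0 ≤ J f t :=
  setIntegral_nonneg Ω_meas h

theorem J_hasDerivAt {f : Fld} (hf : Sm f) (t : ℝ) : HasDerivAt (J f) (J (Dt f) t) t := by
  have hc : Continuous (Function.uncurry (Dt f)) := hf.Dt.cont
  obtain ⟨C, hC⟩ := ((isCompact_Icc (a := t - 1) (b := t + 1)).prod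
    K_compact).exists_bound_of_continuousOn hc.continuousOn
  have := hasDerivAt_integral_of_dominated_loc_of_deriv_le (μ := volume.restrict Ω)
    (F := fun s x => f s x) (F' := fun s x => Dt f s x) (x₀ := t) (s := Metric.ball t 1)
    (bound := fun _ => C) (Metric.ball_mem_nhds t one_pos)
    (Eventually.of_forall fun s => (intOn (hf.contx s)).aestronglyMeasurable)
    (intOn (hf.contx t)) (intOn (hf.Dt.contx t)).aestronglyMeasurable
    ?_ ?_ ?_
  · exact this.2
  · rw [ae_restrict_iff' Ω_meas]
    refine Eventually.of_forall fun x hx s hs => ?_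
    rw [Metric.mem_ball, Real.dist_eq, abs_lt] at hs
    exact hC (s, x) ⟨⟨by linarith [hs.1], by linarith [hs.2]⟩, Ω_sub hx⟩
  · exact integrableOn_const (by exact Ω_fin.ne)
  · exact Eventually.of_forall fun x s _ => hasDerivAt_Dt hf s x

theorem J_cont {f : Fld} (hf : Sm f) : Continuous (J f) :=
  continuous_iff_continuousAt.2 fun t => (J_hasDerivAt hf t).continuousAt

theorem int_fubini {g : ℝ × ℝ → ℝ} (hg : Continuous g) :
    ∫ x in Ω, g x = ∫ x1 in (0:ℝ)..(2 * π), ∫ x2 in (0:ℝ)..1, g (x1, x2) := by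
  have h := setIntegral_prod (μ := volume) (ν := volume) g (s := Set.Ioo (0:ℝ) (2 * π))
    (t := Set.Ioo (0:ℝ) 1) (by rw [← Ω_eq]; exact intOn hg)
  rw [Ω_eq]
  rw [intervalIntegral.integral_of_le (by positivity), ← integral_Ioc_eq_integral_Ioo] at *
  erw [h]
  refine setIntegral_congr_fun measurableSet_Ioc fun x1 _ => ?_
  rw [intervalIntegral.integral_of_le (by norm_num), integral_Ioc_eq_integral_Ioo]

theorem int_fubini' {g : ℝ × ℝ → ℝ} (hg : Continuous g) :
    ∫ x in Ω, g x = ∫ x2 in (0:ℝ)..1, ∫ x1 in (0:ℝ)..(2 * π), g (x1, x2) := by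
  rw [int_fubini hg]
  rw [intervalIntegral.integral_of_le (by positivity), intervalIntegral.integral_of_le (by norm_num)]
  simp only [intervalIntegral.integral_of_le (zero_le_one' ℝ),
    intervalIntegral.integral_of_le (show (0:ℝ) ≤ 2 * π by positivity)]
  refine integral_integral_swap (f := fun a b => g (a, b)) ?_
  rw [Measure.prod_restrict]
  exact (hg.continuousOn.integrableOn_compact K_compact).mono_set
    (Set.prod_mono Set.Ioc_subset_Icc_self Set.Ioc_subset_Icc_self)
 
theorem slice1 {f : Fld} (hf : Sm f) (t x1 x2 : ℝ) :
    HasDerivAt (fun s => f t (s, x2)) (D1 f t (x1, x2)) x1 := by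
  have h1 := ((hf.slice t).differentiable (by simp) (x1, x2)).hasFDerivAt
  have h2 : HasDerivAt (fun s : ℝ => ((s, x2) : ℝ × ℝ)) (1, 0) x1 :=
    (hasDerivAt_id x1).prodMk (hasDerivAt_const x1 x2)
  exact HasFDerivAt.comp_hasDerivAt x1 h1 h2
theorem slice2 {f : Fld} (hf : Sm f) (t x1 x2 : ℝ) :
    HasDerivAt (fun s => f t (x1, s)) (D2 f t (x1, x2)) x2 := by
  have h1 := ((hf.slice t).differentiable (by simp) (x1, x2)).hasFDerivAt
  have h2 : HasDerivAt (fun s : ℝ => ((x1, s) : ℝ × ℝ)) (0, 1) x2 :=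
    (hasDerivAt_const x2 x1).prodMk (hasDerivAt_id x2)
  exact HasFDerivAt.comp_hasDerivAt x2 h1 h2

theorem J_D1 {f : Fld} (hf : Sm f) (hp : Per f) (t : ℝ) : J (D1 f) t = 0 := by
  unfold J
  rw [int_fubini' (hf.D1.contx t)]
  have : ∀ x2 : ℝ, ∫ x1 in (0:ℝ)..(2 * π), D1 f t (x1, x2) = 0 := by
    intro x2
    rw [intervalIntegral.integral_eq_sub_of_hasDerivAt (fun x _ => slice1 hf t x x2)]
    · have := hp t (0, x2); simp at this; simp [this]
    · exact ((hf.D1.contx t).comp (by fun_prop : Continuous fun s : ℝ => (s, x2))).intervalIntegrable _ _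
  simp [this]

theorem J_D2 {f : Fld} (hf : Sm f) {t : ℝ} (h0 : ∀ x : ℝ × ℝ, (x.2 = 0 ∨ x.2 = 1) → f t x = 0) :
    J (D2 f) t = 0 := by
  unfold J
  rw [int_fubini (hf.D2.contx t)]
  have : ∀ x1 : ℝ, ∫ x2 in (0:ℝ)..1, D2 f t (x1, x2) = 0 := by
    intro x1
    rw [intervalIntegral.integral_eq_sub_of_hasDerivAt (fun x _ => slice2 hf t x1 x)]
    · rw [h0 _ (Or.inr rfl), h0 _ (Or.inl rfl)]; simp
    · exact ((hf.D2.contx t).comp (by fun_prop : Continuous fun s : ℝ => (x1, s))).intervalIntegrable _ _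
  simp [this]

/-- one-dimensional sup bound -/
theorem sup1 {h h' : ℝ → ℝ} {L : ℝ} (hL : 1 ≤ L) (hd : ∀ s, HasDerivAt h (h' s) s)
    (hc : Continuous h') {y : ℝ} (hy : y ∈ Set.Icc 0 L) :
    |h y| ≤ ∫ s in (0:ℝ)..L, (|h s| + |h' s|) := by
  have hcont : Continuous h := continuous_iff_continuousAt.2 fun s => (hd s).continuousAt
  have hi : ∀ a b, IntervalIntegrable (fun s => |h' s|) volume a b := fun a b =>
    (hc.abs).intervalIntegrable a b
  have hi0 : ∀ a b, IntervalIntegrable (fun s => |h s|) volume a b := fun a b =>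
    (hcont.abs).intervalIntegrable a b
  set M := ∫ s in (0:ℝ)..L, |h' s|
  have key : ∀ z ∈ Set.Icc 0 L, |h y| ≤ |h z| + M := by
    intro z hz
    have h1 : ∫ s in z..y, h' s = h y - h z :=
      intervalIntegral.integral_eq_sub_of_hasDerivAt (fun x _ => hd x) (hc.intervalIntegrable _ _)
    have h2 : |h y - h z| ≤ M := by
      rw [← h1]
      rcases le_total z y with hzy | hzy
      · refine (intervalIntegral.abs_integral_le_integral_abs hzy).trans ?_
        exact intervalIntegral.integral_mono_interval hz.1 hzy hy.2
          (Eventually.of_forall fun s => abs_nonneg _) (hi _ _)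
      · rw [intervalIntegral.integral_symm, abs_neg]
        refine (intervalIntegral.abs_integral_le_integral_abs hzy).trans ?_
        exact intervalIntegral.integral_mono_interval hy.1 hzy hz.2
          (Eventually.of_forall fun s => abs_nonneg _) (hi _ _)
    have := abs_sub_abs_le_abs_sub (h y) (h z)
    linarith
  have hL0 : (0:ℝ) ≤ L := by linarith
  have h3 : ∫ z in (0:ℝ)..L, (|h y|) ≤ ∫ z in (0:ℝ)..L, (|h z| + M) :=
    intervalIntegral.integral_mono_on hL0 (by simp) ((hi0 _ _).add (by simp)) key
  rw [intervalIntegral.integral_add (hi0 _ _) (by simp)] at h3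
  simp only [intervalIntegral.integral_const, smul_eq_mul, sub_zero] at h3
  rw [intervalIntegral.integral_add (hi0 _ _) (hi _ _)]
  have hA : 0 ≤ ∫ z in (0:ℝ)..L, |h z| := intervalIntegral.integral_nonneg hL0 fun _ _ => abs_nonneg _
  have : L * |h y| ≤ L * ((∫ z in (0:ℝ)..L, |h z|) + M) := by nlinarith
  exact le_of_mul_le_mul_left this (by linarith)

theorem pi2 : (1:ℝ) ≤ 2 * π := by have := Real.pi_gt_three; linarith

theorem sup2 {f : Fld} (hf : Sm f) (t : ℝ) {x : ℝ × ℝ} (hx : x ∈ Ω) :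
    |f t x| ≤ ∫ y in Ω, (|f t y| + |D1 f t y| + (|D2 f t y| + |D1 (D2 f) t y|)) := by
  have c0 := hf.contx t
  have c1 := hf.D1.contx t
  have c2 := hf.D2.contx t
  have c12 := hf.D2.D1.contx t
  obtain ⟨x1, x2⟩ := x
  have hx' := Ω_sub hx
  rw [int_fubini' (by fun_prop)]
  have e1 := sup1 (h := fun s => f t (x1, s)) (h' := fun s => D2 f t (x1, s)) le_rfl
    (fun s => slice2 hf t x1 s) (by fun_prop) hx'.2
  refine e1.trans ?_
  refine intervalIntegral.integral_mono_on zero_le_one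
    (Continuous.intervalIntegrable (by fun_prop) _ _) ?_ ?_
  · apply Continuous.intervalIntegrable
    apply intervalIntegral.continuous_parametric_intervalIntegral_of_continuous'
    fun_prop
  · intro s _
    have a1 := sup1 (h := fun y => f t (y, s)) (h' := fun y => D1 f t (y, s)) pi2
      (fun y => slice1 hf t y s) (by fun_prop) hx'.1
    have a2 := sup1 (h := fun y => D2 f t (y, s)) (h' := fun y => D1 (D2 f) t (y, s)) pi2
      (fun y => slice1 hf.D2 t y s) (by fun_prop) hx'.1
    rw [intervalIntegral.integral_add (Continuous.intervalIntegrable (by fun_prop) _ _)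
      (Continuous.intervalIntegrable (by fun_prop) _ _)]
    exact add_le_add a1 a2

/-- scaled Agmon inequality -/
theorem agmon {f : Fld} (hf : Sm f) (t : ℝ) {x : ℝ × ℝ} (hx : x ∈ Ω) {ε : ℝ} (h0 : 0 < ε)
    (h1 : ε ≤ 1) :
    f t x ^ 2 ≤ 4 * ((ε⁻¹) ^ 2 * J (f * f) t + J (D1 f * D1 f) t + J (D2 f * D2 f) t
      + ε ^ 2 * J (D1 (D2 f) * D1 (D2 f)) t) := by
  have h := sup2 (hf.mul hf) t hx
  have hs := hf.mul hf
  rw [D1_mul hf hf, D2_mul hf hf, D1_add (hf.D2.mul hf) (hf.mul hf.D2), D1_mul hf.D2 hf,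
    D1_mul hf hf.D2] at h
  rw [← J_smul, ← J_smul, ← J_add ((hs).smul _) (hf.D1.mul hf.D1),
    ← J_add (((hs).smul _).add (hf.D1.mul hf.D1)) (hf.D2.mul hf.D2),
    ← J_add ((((hs).smul _).add (hf.D1.mul hf.D1)).add (hf.D2.mul hf.D2))
      ((hf.D2.D1.mul hf.D2.D1).smul _), ← J_smul]
  have e : |(f * f) t x| = f t x ^ 2 := by
    rw [Pi.mul_apply, Pi.mul_apply, abs_mul, abs_mul_abs_self, sq]
  rw [e] at h
  refine h.trans ?_
  have c0 := hf.contx t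
  have c1 := hf.D1.contx t
  have c2 := hf.D2.contx t
  have c12 := hf.D2.D1.contx t
  have cc : Continuous (f t * f t) := by fun_prop
  refine setIntegral_mono_on (intOn ?_) (intOn ?_) Ω_meas fun y _ => ?_
  · simp only [Pi.add_apply, Pi.mul_apply]; fun_prop
  · simp only [Pi.add_apply, Pi.mul_apply, Pi.smul_apply]; fun_prop
  · simp only [Pi.add_apply, Pi.mul_apply, Pi.smul_apply, smul_eq_mul]
    generalize f t y = p
    generalize D1 f t y = q
    generalize D2 f t y = r
    generalize D1 (D2 f) t y = s
    have hE : 1 ≤ ε⁻¹ := (one_le_inv₀ h0).2 h1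
    have hEe : ε⁻¹ * ε = 1 := inv_mul_cancel₀ h0.ne'
    set E := ε⁻¹
    have hp : p * p ≤ E ^ 2 * (p * p) := by
      have : (1:ℝ) ≤ E ^ 2 := by nlinarith
      nlinarith [mul_self_nonneg p]
    have b0 : |p * p| ≤ E ^ 2 * (p * p) := by
      rw [abs_mul_self]; exact hp
    have b1 : |q * p + p * q| ≤ E ^ 2 * (p * p) + q * q := by
      rw [abs_le]; constructor <;> nlinarith [sq_nonneg (p + q), sq_nonneg (p - q), hp]
    have b2 : |r * p + p * r| ≤ E ^ 2 * (p * p) + r * r := by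
      rw [abs_le]; constructor <;> nlinarith [sq_nonneg (p + r), sq_nonneg (p - r), hp]
    have b3 : |s * p + r * q + (q * r + p * s)| ≤ q * q + r * r + (E ^ 2 * (p * p) + ε ^ 2 * (s * s)) := by
      have e1 : (E * p + ε * s) ^ 2 = E ^ 2 * (p * p) + ε ^ 2 * (s * s) + 2 * p * s * (E * ε) := by ring
      have e2 : (E * p - ε * s) ^ 2 = E ^ 2 * (p * p) + ε ^ 2 * (s * s) - 2 * p * s * (E * ε) := by ring
      rw [hEe] at e1 e2
      rw [abs_le]; constructor <;>
      nlinarith [sq_nonneg (q + r), sq_nonneg (q - r), sq_nonneg (E * p + ε * s), sq_nonneg (E * p - ε * s)]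
    have := mul_self_nonneg q
    have := mul_self_nonneg r
    have : 0 ≤ ε ^ 2 * (s * s) := mul_nonneg (sq_nonneg _) (mul_self_nonneg s)
    linarith

/-! ### instance-driven calculus -/
class SM (f : Fld) : Prop where
  out : Sm f
class PER (f : Fld) : Prop where
  out : Per f

section
variable (f g : Fld) (c : ℝ)
instance [SM f] [SM g] : SM (f + g) := ⟨SM.out.add SM.out⟩
instance [SM f] [SM g] : SM (f - g) := ⟨SM.out.sub SM.out⟩
instance [SM f] [SM g] : SM (f * g) := ⟨SM.out.mul SM.out⟩
instance [SM f] : SM (-f) := ⟨SM.out.neg⟩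
instance [SM f] : SM (c • f) := ⟨SM.out.smul c⟩
instance [SM f] : SM (D1 f) := ⟨SM.out.D1⟩
instance [SM f] : SM (D2 f) := ⟨SM.out.D2⟩
instance [SM f] : SM (Dt f) := ⟨SM.out.Dt⟩
instance : SM Yf := ⟨Yf_sm⟩
instance [PER f] [PER g] : PER (f + g) := ⟨PER.out.add PER.out⟩
instance [PER f] [PER g] : PER (f - g) := ⟨PER.out.sub PER.out⟩
instance [PER f] [PER g] : PER (f * g) := ⟨PER.out.mul PER.out⟩
instance [PER f] : PER (-f) := ⟨PER.out.neg⟩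
instance [PER f] : PER (c • f) := ⟨PER.out.smul c⟩
instance [PER f] : PER (D1 f) := ⟨PER.out.D1⟩
instance [PER f] : PER (D2 f) := ⟨PER.out.D2⟩
instance [PER f] : PER (Dt f) := ⟨PER.out.Dt⟩
instance : PER Yf := ⟨Per_Yf⟩
end

section
variable {f g : Fld} {c : ℝ}
theorem d1_add [SM f] [SM g] : D1 (f + g) = D1 f + D1 g := D1_add SM.out SM.out
theorem d2_add [SM f] [SM g] : D2 (f + g) = D2 f + D2 g := D2_add SM.out SM.out
theorem dt_add [SM f] [SM g] : Dt (f + g) = Dt f + Dt g := Dt_add SM.out SM.out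
theorem d1_sub [SM f] [SM g] : D1 (f - g) = D1 f - D1 g := D1_sub SM.out SM.out
theorem d2_sub [SM f] [SM g] : D2 (f - g) = D2 f - D2 g := D2_sub SM.out SM.out
theorem dt_sub [SM f] [SM g] : Dt (f - g) = Dt f - Dt g := Dt_sub SM.out SM.out
theorem d1_mul [SM f] [SM g] : D1 (f * g) = D1 f * g + f * D1 g := D1_mul SM.out SM.out
theorem d2_mul [SM f] [SM g] : D2 (f * g) = D2 f * g + f * D2 g := D2_mul SM.out SM.out
theorem dt_mul [SM f] [SM g] : Dt (f * g) = Dt f * g + f * Dt g := Dt_mul SM.out SM.out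
theorem d1_neg [SM f] : D1 (-f) = -D1 f := D1_neg SM.out
theorem d2_neg [SM f] : D2 (-f) = -D2 f := D2_neg SM.out
theorem dt_neg [SM f] : Dt (-f) = -Dt f := Dt_neg SM.out
theorem d1_smul [SM f] : D1 (c • f) = c • D1 f := D1_smul c SM.out
theorem d2_smul [SM f] : D2 (c • f) = c • D2 f := D2_smul c SM.out
theorem dt_smul [SM f] : Dt (c • f) = c • Dt f := Dt_smul c SM.out
theorem d21 [SM f] : D2 (D1 f) = D1 (D2 f) := D21 SM.out
theorem dt1 [SM f] : Dt (D1 f) = D1 (Dt f) := Dt1 SM.out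
theorem dt2 [SM f] : Dt (D2 f) = D2 (Dt f) := Dt2 SM.out
theorem Dt_Yf : Dt Yf = 0 := by
  ext t x; simp [Dt, dt, Yf]
theorem D1_zero : D1 0 = 0 := by
  ext t x; show fderiv ℝ (fun _ => (0:ℝ)) x (1, 0) = 0; simp
theorem D2_zero : D2 0 = 0 := by
  ext t x; show fderiv ℝ (fun _ => (0:ℝ)) x (0, 1) = 0; simp
end

/-- energy inequality: integrate a pointwise inequality with divergence terms. -/
theorem J_div {e X Z B : Fld} [SM e] [SM X] [SM Z] [SM B] [PER X] {t : ℝ}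
    (hZ : ∀ x : ℝ × ℝ, (x.2 = 0 ∨ x.2 = 1) → Z t x = 0)
    (h : ∀ x ∈ Ω, e t x ≤ D1 X t x + D2 Z t x + B t x) : J e t ≤ J B t := by
  have h1 : J e t ≤ J (D1 X + D2 Z + B) t := J_mono SM.out SM.out h
  rw [J_add SM.out SM.out, J_add SM.out SM.out, J_D1 SM.out PER.out, J_D2 SM.out hZ] at h1
  linarith

theorem J_sub_eq {f g : Fld} [SM f] [SM g] {t : ℝ} : J (f - g) t = J f t - J g t :=
  J_sub SM.out SM.out t
theorem J_add_eq {f g : Fld} [SM f] [SM g] {t : ℝ} : J (f + g) t = J f t + J g t :=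
  J_add SM.out SM.out t
theorem J_smul_eq {f : Fld} {c t : ℝ} : J (c • f) t = c * J f t := J_smul c t

/-- squares -/
abbrev sq' (f : Fld) : Fld := f * f

theorem J_sq_nonneg (f : Fld) (t : ℝ) : 0 ≤ J (f * f) t := J_nonneg fun x _ => mul_self_nonneg _

theorem zero_on {f : Fld} {t : ℝ} (h : ∀ x ∈ Ω, f t x = 0) {x : ℝ × ℝ} (hx : x ∈ Ω) :
    D1 f t x = 0 ∧ D2 f t x = 0 := by
  have : f t =ᶠ[𝓝 x] fun _ => (0:ℝ) := by
    filter_upwards [Ω_open.mem_nhds hx] with y hy using h y hy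
  have h2 := this.fderiv_eq (𝕜 := ℝ)
  constructor
  · show fderiv ℝ (f t) x (1, 0) = 0
    rw [h2]; simp
  · show fderiv ℝ (f t) x (0, 1) = 0
    rw [h2]; simp

/-- Young's inequality. -/
theorem yg {c p q K δ S : ℝ} (hc : |c| ≤ K) (hδ : 0 < δ) (hq : q ^ 2 ≤ S) :
    c * p * q ≤ δ * p ^ 2 + K ^ 2 / (4 * δ) * S := by
  have h1 : c ^ 2 ≤ K ^ 2 := by
    rw [← sq_abs c]; exact pow_le_pow_left₀ (abs_nonneg c) hc 2
  have h2 : c * p * q ≤ δ * p ^ 2 + c ^ 2 / (4 * δ) * q ^ 2 := by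
    have : δ * p ^ 2 + c ^ 2 / (4 * δ) * q ^ 2 - c * p * q = (2 * δ * p - c * q) ^ 2 / (4 * δ) := by
      field_simp; ring
    have h3 : 0 ≤ (2 * δ * p - c * q) ^ 2 / (4 * δ) := by positivity
    linarith
  have h3 : c ^ 2 / (4 * δ) * q ^ 2 ≤ K ^ 2 / (4 * δ) * S := by
    have : 0 ≤ q ^ 2 := sq_nonneg q
    gcongr
  linarith

theorem bm {x y A B : ℝ} (hx : |x| ≤ A) (hy : |y| ≤ B) : |x * y| ≤ A * B := by
  rw [abs_mul]; exact mul_le_mul hx hy (abs_nonneg _) ((abs_nonneg _).trans hx)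
theorem ba {x y A B : ℝ} (hx : |x| ≤ A) (hy : |y| ≤ B) : |x + y| ≤ A + B :=
  (abs_add_le x y).trans (add_le_add hx hy)
theorem bs {x y A B : ℝ} (hx : |x| ≤ A) (hy : |y| ≤ B) : |x - y| ≤ A + B :=
  (abs_sub x y).trans (add_le_add hx hy)

/-- symmetric product bound -/
theorem pb {c p q K S : ℝ} (hc : |c| ≤ K) (hp : p ^ 2 ≤ S) (hq : q ^ 2 ≤ S) :
    c * p * q ≤ K * S := by
  have h0 : |p * q| ≤ S := by rw [abs_le]; constructor <;> nlinarith [sq_nonneg (p + q), sq_nonneg (p - q)]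
  have := bm hc h0
  have h2 := le_abs_self (c * (p * q))
  calc c * p * q = c * (p * q) := by ring
    _ ≤ _ := h2.trans this

/-- The rescaled system. -/
structure Sys (μ lam κ g1 r M ε T : ℝ) where
  a : Fld
  v : Fld
  w : Fld
  b : Fld
  Θ : Fld
  R : Fld
  sa : SM a
  sv : SM v
  sw : SM w
  sb : SM b
  sΘ : SM Θ
  sR : SM R
  pa : PER a
  pv : PER v
  pw : PER w
  pb : PER b
  pΘ : PER Θ
  pR : PER R
  Θt : Dt Θ = 0
  Θ1 : D1 Θ = 0
  Rt : Dt R = 0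
  R1 : D1 R = 0
  hRΘ : ∀ t, ∀ x ∈ Ω, R t x * Θ t x = 1
  hR2 : ∀ t, ∀ x ∈ Ω, D2 R t x = - (R t x ^ 2 * D2 Θ t x)
  bR : ∀ t, ∀ x ∈ Ω, |R t x - 1| ≤ M * ε
  bΘ : ∀ t, ∀ x ∈ Ω, |Θ t x - 1| ≤ M * ε
  bΘ2 : ∀ t, ∀ x ∈ Ω, |D2 Θ t x| ≤ M * ε
  bR2 : ∀ t, ∀ x ∈ Ω, |D2 R t x| ≤ M * ε
  bR22 : ∀ t, ∀ x ∈ Ω, |D2 (D2 R) t x| ≤ M * ε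
  ba : ∀ t ∈ Set.Icc 0 T, ∀ x ∈ Ω, |a t x| ≤ M
  bv : ∀ t ∈ Set.Icc 0 T, ∀ x ∈ Ω, |v t x| ≤ M
  bw : ∀ t ∈ Set.Icc 0 T, ∀ x ∈ Ω, |w t x| ≤ M
  bb : ∀ t ∈ Set.Icc 0 T, ∀ x ∈ Ω, |b t x| ≤ M
  bv1 : ∀ t ∈ Set.Icc 0 T, ∀ x ∈ Ω, |ε * D1 v t x| ≤ M
  bv2 : ∀ t ∈ Set.Icc 0 T, ∀ x ∈ Ω, |ε * D2 v t x| ≤ M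
  bw1 : ∀ t ∈ Set.Icc 0 T, ∀ x ∈ Ω, |ε * D1 w t x| ≤ M
  bw2 : ∀ t ∈ Set.Icc 0 T, ∀ x ∈ Ω, |ε * D2 w t x| ≤ M
  cv : ∀ t ∈ Set.Icc 0 T, ∀ x : ℝ × ℝ, (x.2 = 0 ∨ x.2 = 1) → v t x = 0
  cw : ∀ t ∈ Set.Icc 0 T, ∀ x : ℝ × ℝ, (x.2 = 0 ∨ x.2 = 1) → w t x = 0
  cb : ∀ t ∈ Set.Icc 0 T, ∀ x : ℝ × ℝ, (x.2 = 0 ∨ x.2 = 1) → b t x = 0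
  mean : J a 0 = 0
  mass : ∀ t ∈ Set.Icc 0 T, ∀ x ∈ Ω,
    (ε • (Dt a + (Yf + v) * D1 a + w * D2 a) + (R + ε • a) * (D1 v + D2 w) + w * D2 R) t x = 0
  mom1 : ∀ t ∈ Set.Icc 0 T, ∀ x ∈ Ω,
    ((R + ε • a) * (Dt v + (Yf + v) * D1 v + w * D2 v + w)
      + ε⁻¹ • D1 ((R + ε • a) * b + Θ * a) - μ • (D1 (D1 v) + D2 (D2 v))
      - lam • D1 (D1 v + D2 w)) t x = 0
  mom2 : ∀ t ∈ Set.Icc 0 T, ∀ x ∈ Ω,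
    ((R + ε • a) * (Dt w + (Yf + v) * D1 w + w * D2 w)
      + ε⁻¹ • D2 ((R + ε • a) * b + Θ * a) - μ • (D1 (D1 w) + D2 (D2 w))
      - lam • D2 (D1 v + D2 w)) t x = 0
  energy : ∀ t ∈ Set.Icc 0 T, ∀ x ∈ Ω,
    (g1 • ((R + ε • a) * (Dt b + (Yf + v) * D1 b + w * D2 b + ε⁻¹ • (w * D2 Θ)))
      + ε⁻¹ • ((R + ε • a) * (Θ + ε • b) * (D1 v + D2 w)) - κ • (D1 (D1 b) + D2 (D2 b))
      - ε • ((2 * μ) • (D1 v * D1 v + D2 w * D2 w + (1/2 : ℝ) • ((D1 w + D2 v) * (D1 w + D2 v)))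
        + (2 * μ) • (D1 w + D2 v) + (r * μ) • ((D1 v + D2 w) * (D1 v + D2 w)))) t x = 0

attribute [instance] Sys.sa Sys.sv Sys.sw Sys.sb Sys.sΘ Sys.sR Sys.pa Sys.pv Sys.pw Sys.pb Sys.pΘ Sys.pR

variable {μ lam κ g1 r M ε T : ℝ} (S : Sys μ lam κ g1 r M ε T)
namespace Sys
def ρ : Fld := S.R + ε • S.a
def d : Fld := D1 S.v + D2 S.w
def Q : Fld := S.ρ * S.b + S.Θ * S.a
instance : SM S.ρ := by unfold ρ; infer_instance
instance : SM S.d := by unfold d; infer_instance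
instance : SM S.Q := by unfold Q; infer_instance
instance : PER S.ρ := by unfold ρ; infer_instance
instance : PER S.d := by unfold d; infer_instance
instance : PER S.Q := by unfold Q; infer_instance

def e0 : Fld := (1/2:ℝ) • (S.ρ * S.R * (S.v * S.v + S.w * S.w)) + (1/2:ℝ) • (S.Θ * S.a * S.a)
  - (ε/6) • (S.Θ * S.Θ * S.a * S.a * S.a) + (g1/2) • (S.ρ * S.b * S.b)
def X0 : Fld := -((Yf + S.v) * S.e0) - ε⁻¹ • (S.Q * S.R * S.v)
  + μ • (S.R * (S.v * D1 S.v + S.w * D1 S.w)) + lam • (S.d * S.R * S.v) + κ • (S.b * D1 S.b)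
def Z0 : Fld := -(S.w * S.e0) - ε⁻¹ • (S.Q * S.R * S.w)
  + μ • (S.R * (S.v * D2 S.v + S.w * D2 S.w)) + lam • (S.d * S.R * S.w) + κ • (S.b * D2 S.b)
instance : SM S.e0 := by unfold e0; infer_instance
instance : SM S.X0 := by unfold X0; infer_instance
instance : SM S.Z0 := by unfold Z0; infer_instance
instance : PER S.e0 := by unfold e0; infer_instance
instance : PER S.X0 := by unfold X0; infer_instance

theorem L0_id (hε : ε ≠ 0) {t : ℝ} (ht : t ∈ Set.Icc 0 T) {x : ℝ × ℝ} (hx : x ∈ Ω)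
    {a v w b Θ R v1 v2 w1 w2 b1 b2 ρ Θ2 R2 d y: ℝ}
    (ea : S.a t x = a) (ev : S.v t x = v) (ew : S.w t x = w) (eb : S.b t x = b)
    (eΘ : S.Θ t x = Θ) (eR : S.R t x = R) (ey : Yf t x = y)
    (ev1 : D1 S.v t x = v1) (ev2 : D2 S.v t x = v2)
    (ew1 : D1 S.w t x = w1) (ew2 : D2 S.w t x = w2)
    (eb1 : D1 S.b t x = b1) (eb2 : D2 S.b t x = b2) (eΘ2 : D2 S.Θ t x = Θ2) (eR2 : D2 S.R t x = R2)
    (eρ : ρ = R + ε * a) (ed : d = v1 + w2) : 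
    Dt S.e0 t x = D1 S.X0 t x + D2 S.Z0 t x + (
      -μ*R*(v1^2+v2^2+w1^2+w2^2) - lam*R*d^2 - κ*(b1^2+b2^2) - μ*R2*(v*v2+w*w2)
      - lam*d*R2*w - ρ*R*v*w + 1/2*ρ*(v^2+w^2)*w*R2 
      + ε⁻¹*ρ*b*((R-(Θ+ε*b))*d+w*R2-g1*w*Θ2)+(ε/3)*Θ^3*a^3*(R*d+w*R2)
      + ε*b*(2*μ*(v1^2+w2^2+1/2*(w1+v2)^2)+2*μ*(w1+v2)+r*μ*d^2)) := by
  have hm := S.mass t ht x hx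
  have h1 := S.mom1 t ht x hx
  have h2 := S.mom2 t ht x hx
  have h3 := S.energy t ht x hx
  have hR := S.hRΘ t x hx
  have hR2 := S.hR2 t x hx
  simp only [d1_add, d2_add, dt_add, d1_sub, d2_sub, dt_sub, d1_mul, d2_mul, dt_mul, d1_neg, d2_neg,
    dt_neg, d1_smul, d2_smul, dt_smul, d21, dt1, dt2, D1_Yf, D2_Yf, Dt_Yf, S.Θt, S.Θ1, S.Rt, S.R1,
    e0, X0, Z0, Sys.ρ, Sys.d, Q] at *
  simp only [Pi.add_apply, Pi.mul_apply, Pi.sub_apply, Pi.neg_apply, Pi.smul_apply, smul_eq_mul,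
    Pi.zero_apply, ea, ev, ew, eb, eΘ, eR, ev1, ev2, ew1, ew2, eb1, eb2, eΘ2, eR2, ey] at *
  generalize D1 (D1 S.v) t x = v11 at *
  generalize D1 (D2 S.v) t x = v12 at *
  generalize D2 (D2 S.v) t x = v22 at *
  generalize D1 (D1 S.w) t x = w11 at *
  generalize D1 (D2 S.w) t x = w12 at *
  generalize D2 (D2 S.w) t x = w22 at *
  generalize D1 (D1 S.b) t x = b11 at *
  generalize D2 (D2 S.b) t x = b22 at *
  generalize D1 (S.a) t x = a1 at *
  generalize D2 (S.a) t x = a2 at *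
  generalize Dt (S.a) t x = at_ at *
  generalize Dt (S.v) t x = vt at *
  generalize Dt (S.w) t x = wt at *
  generalize Dt (S.b) t x = bt at *
  have hΘ : Θ ≠ 0 := by rintro rfl; simp at hR
  have hR' : R = Θ⁻¹ := eq_inv_of_mul_eq_one_left hR
  subst eρ ed hR2 hR'
  linear_combination (norm := (field_simp; ring)) (1/2*Θ⁻¹*(v^2+w^2)+ε⁻¹*Θ*a-1/2*Θ^2*a^2+1/2*g1*b^2)*hm + Θ⁻¹*v*h1+Θ⁻¹*w*h2+b*h3

/-- pointwise bounds -/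
theorem bnds (hM : 1 ≤ M) (h0 : 0 < ε) (hε : M * ε ≤ 1 / 16) {t : ℝ} (ht : t ∈ Set.Icc 0 T)
    {x : ℝ × ℝ} (hx : x ∈ Ω) :
    |ε * S.a t x| ≤ 1/16 ∧ |ε * S.b t x| ≤ 1/16 ∧ (3/4 ≤ S.R t x ∧ S.R t x ≤ 5/4) ∧
    (3/4 ≤ S.Θ t x ∧ S.Θ t x ≤ 5/4) ∧ (1/2 ≤ S.R t x + ε * S.a t x ∧ S.R t x + ε * S.a t x ≤ 3/2) ∧
    (1/2 ≤ S.Θ t x + ε * S.b t x ∧ S.Θ t x + ε * S.b t x ≤ 3/2) ∧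
    |ε⁻¹ * (S.R t x - (S.Θ t x + ε * S.b t x))| ≤ 3 * M ∧
    |ε⁻¹ * D2 S.R t x| ≤ M ∧ |ε⁻¹ * D2 S.Θ t x| ≤ M ∧ |ε⁻¹ * D2 (D2 S.R) t x| ≤ M := by
  have hR := S.bR t x hx
  have hΘ := S.bΘ t x hx
  have ha := S.ba t ht x hx
  have hb := S.bb t ht x hx
  have a1 : |ε * S.a t x| ≤ M * ε := by
    rw [abs_mul, abs_of_pos h0, mul_comm]; gcongr
  have b1 : |ε * S.b t x| ≤ M * ε := by
    rw [abs_mul, abs_of_pos h0, mul_comm]; gcongr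
  have sc : ∀ {z K : ℝ}, |z| ≤ K * ε → |ε⁻¹ * z| ≤ K := by
    intro z K hz
    rw [abs_mul, abs_inv, abs_of_pos h0, inv_mul_le_iff₀ h0]; linarith
  have hd : |S.R t x - (S.Θ t x + ε * S.b t x)| ≤ (3 * M) * ε := by
    have e : S.R t x - (S.Θ t x + ε * S.b t x) = (S.R t x - 1) - (S.Θ t x - 1) - ε * S.b t x := by ring
    rw [e]; refine (bs (bs hR hΘ) b1).trans (by linarith)
  refine ⟨a1.trans hε, b1.trans hε, ?_, ?_, ?_, ?_, sc hd, sc (S.bR2 t x hx), sc (S.bΘ2 t x hx),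
    sc (S.bR22 t x hx)⟩ <;> rw [abs_le] at * <;> constructor <;> linarith [hR.1, hR.2, hΘ.1, hΘ.2]

end Sys

set_option maxHeartbeats 4000000 in
/-- remainder bound at level zero -/
theorem L0_real {a v w b Θ R v1 v2 w1 w2 b1 b2 ρ Θ2 R2 d μ lam κ g1 r M ε : ℝ}
    (hM : 1 ≤ M) (h0 : 0 < ε) (hε : M * ε ≤ 1 / 16) (hμ : 0 < μ) (hr : 0 < 1 + r)
    (hlam : lam = (1 + r) * μ) (hg : 0 < g1)
    (ha : |a| ≤ M) (hw : |w| ≤ M) (hb : |ε * b| ≤ M * ε) (hR : 3/4 ≤ R ∧ R ≤ 5/4)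
    (hΘ : 3/4 ≤ Θ ∧ Θ ≤ 5/4) (hρ : 1/2 ≤ ρ ∧ ρ ≤ 3/2)
    (hd : d = v1 + w2) (hRτ : |ε⁻¹ * (R - (Θ + ε * b))| ≤ 3 * M)
    (hR2 : |R2| ≤ M * ε) (hR2' : |ε⁻¹ * R2| ≤ M) (hΘ2 : |ε⁻¹ * Θ2| ≤ M) :
    -μ*R*(v1^2+v2^2+w1^2+w2^2) - lam*R*d^2 - κ*(b1^2+b2^2) - μ*R2*(v*v2+w*w2)
      - lam*d*R2*w - ρ*R*v*w + 1/2*ρ*(v^2+w^2)*w*R2 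
      + ε⁻¹*ρ*b*((R-(Θ+ε*b))*d+w*R2-g1*w*Θ2)+(ε/3)*Θ^3*a^3*(R*d+w*R2)
      + ε*b*(2*μ*(v1^2+w2^2+1/2*(w1+v2)^2)+2*μ*(w1+v2)+r*μ*d^2) ≤
    -(3/4*μ) * (v1^2+v2^2+w1^2+w2^2) - κ * (b1^2+b2^2)
      + (10*(1+|r|) * (M*ε)*μ + (20+2*g1)*M) * ((v1^2+v2^2+w1^2+w2^2) + (v^2+w^2+b^2))
      + M^4 * ε^2 * a^2 := by
  set G := v1^2+v2^2+w1^2+w2^2 with hG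
  set s := v^2+w^2+b^2 with hs
  set η := M * ε with hη
  have hη0 : 0 < η := by positivity
  have hεη : ε ≤ η := by rw [hη]; exact le_mul_of_one_le_left h0.le hM
  have hG0 : 0 ≤ G := by positivity
  have hs0 : 0 ≤ s := by positivity
  have hS0 : 0 ≤ G + s := by positivity
  have hdG : d ^ 2 ≤ 2 * G := by rw [hd, hG]; linarith only [sq_nonneg (v1 - w2), sq_nonneg v2, sq_nonneg w1]
  have t1 : -μ*R*G ≤ -(3/4*μ)*G := by
    have := mul_le_mul_of_nonneg_left hR.1 (mul_nonneg hμ.le hG0)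
    linarith only [this]
  have t4 : -μ*R2*(v*v2+w*w2) ≤ μ*η*(G+s) := by
    have h1 : |v*v2+w*w2| ≤ G + s := by
      rw [abs_le, hG, hs]
      constructor <;> linarith only [sq_nonneg (v+v2), sq_nonneg (v-v2), sq_nonneg (w+w2), sq_nonneg (w-w2), sq_nonneg v1, sq_nonneg w1, sq_nonneg b, sq_nonneg v, sq_nonneg w, sq_nonneg v2, sq_nonneg w2]
    have h2 := bm hR2 h1
    have h4 := neg_abs_le (R2 * (v*v2+w*w2))
    have h3 : -(R2 * (v*v2+w*w2)) ≤ η*(G+s) := by linarith only [h2, h4]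
    have := mul_le_mul_of_nonneg_left h3 hμ.le
    linarith only [this]
  have t5 : - lam*R*d^2 - lam*d*R2*w ≤ (1+|r|) * μ*η*(G+s) := by
    have h1 : -(R*d^2) - d*R2*w ≤ η * s := by
      have h2 : |R2 * w| ≤ η * |w| := by rw [abs_mul]; gcongr
      have h3 := neg_abs_le (d * (R2 * w))
      rw [abs_mul] at h3
      have h4 : |d| * |R2*w| ≤ |d| * (η * |w|) := by gcongr
      have h5 := sq_abs d
      have h6 := sq_abs w
      have h7 : η * (|d| * |w|) ≤ η * (1/2 * (d^2 + w^2)) := by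
        apply mul_le_mul_of_nonneg_left _ hη0.le
        rw [← h5, ← h6]
        linarith only [sq_nonneg (|d| - |w|)]
      have h8 : w^2 ≤ s := by rw [hs]; linarith only [sq_nonneg v, sq_nonneg b]
      have h9 : η * w^2 ≤ η * s := by gcongr
      have h10 : η * d^2 ≤ 1/16 * d^2 := by gcongr
      have h11 : 3/4*d^2 ≤ R*d^2 := by gcongr; exact hR.1
      have h12 : 0 ≤ η * s := by positivity
      linarith only [sq_nonneg d, h3, h4, h7, h9, h10, h11, h12]
    have hl : lam ≤ (1+|r|) * μ := by rw [hlam]; gcongr; exact le_abs_self r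
    have hl0 : 0 ≤ lam := by rw [hlam]; positivity
    calc - lam*R*d^2 - lam*d*R2*w = lam * (-(R*d^2) - d*R2*w) := by ring
      _ ≤ lam * (η * s) := by gcongr
      _ ≤ ((1+|r|) * μ) * (η * (G+s)) := by gcongr; linarith only [hG0]
      _ = _ := by ring
  have hvw : |v*w| ≤ s := by
    rw [abs_le, hs]; constructor <;> linarith only [sq_nonneg (v+w), sq_nonneg (v-w), sq_nonneg b, sq_nonneg v, sq_nonneg w]
  have hbw : |b*w| ≤ s := by
    rw [abs_le, hs]; constructor <;> linarith only [sq_nonneg (b+w), sq_nonneg (b-w), sq_nonneg b, sq_nonneg v, sq_nonneg w]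
  have hbd : |b*d| ≤ G + s := by
    rw [abs_le]; constructor <;> linarith only [sq_nonneg (b+d), sq_nonneg (b-d), sq_nonneg b, sq_nonneg v, sq_nonneg w, hs, hdG]
  have aρ : |ρ| ≤ 3/2 := by rw [abs_le]; constructor <;> linarith only [hρ.1, hρ.2]
  have aR : |R| ≤ 5/4 := by rw [abs_le]; constructor <;> linarith only [hR.1, hR.2]
  have aΘ : |Θ| ≤ 5/4 := by rw [abs_le]; constructor <;> linarith only [hΘ.1, hΘ.2]
  have t6 : -ρ*R*v*w ≤ 2 * (G+s) := by
    have h1 := bm (bm aρ aR) hvw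
    have h2 := neg_abs_le (ρ*R*(v*w))
    linarith only [h1, h2, hG0, hs0]
  have hMs : 0 ≤ M * s := by positivity
  have hMG : 0 ≤ M * G := by positivity
  have t7 : 1/2*ρ*(v^2+w^2)*w*R2 ≤ M * (G+s) := by
    have hvv : |v^2+w^2| ≤ s := by
      rw [abs_of_nonneg (by positivity), hs]; linarith only [sq_nonneg b]
    have h1 := bm (bm aρ hvv) (bm hw hR2)
    have h2 := le_abs_self (ρ*(v^2+w^2)*(w*R2))
    have h3 : 3/2*s*(M*η) ≤ 2 * (M * (G+s)) := by
      have : M*η ≤ M * (1/16) := by gcongr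
      have h4 := mul_le_mul_of_nonneg_left this hs0
      linarith only [h4, hMs, hMG]
    linarith only [h1, h2, h3]
  have t8 : ε⁻¹*ρ*b*((R-(Θ+ε*b))*d+w*R2-g1*w*Θ2) ≤ ((5*M) + 2*M + g1*2*M) * (G+s) := by
    have h1 := bm (bm aρ hRτ) hbd
    have h2 := bm (bm aρ hR2') hbw
    have h3 := bm (bm aρ hΘ2) hbw
    have l1 := le_abs_self (ρ * (ε⁻¹ * (R - (Θ + ε * b))) * (b*d))
    have l2 := le_abs_self (ρ * (ε⁻¹ * R2) * (b*w))
    have l3 := neg_abs_le (ρ * (ε⁻¹ * Θ2) * (b*w))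
    have e : ε⁻¹*ρ*b*((R-(Θ+ε*b))*d+w*R2-g1*w*Θ2) = ρ * (ε⁻¹ * (R - (Θ + ε * b))) * (b*d)
      + ρ * (ε⁻¹ * R2) * (b*w) - g1 * (ρ * (ε⁻¹ * Θ2) * (b*w)) := by ring
    have l4 : - (g1 * (ρ * (ε⁻¹ * Θ2) * (b*w))) ≤ g1 * (3/2*M*s) := by
      have := mul_le_mul_of_nonneg_left (show -(ρ * (ε⁻¹ * Θ2) * (b*w)) ≤ 3/2*M*s by linarith only [l3, h3]) hg.le
      linarith only [this]
    have hgMG : 0 ≤ g1 * (M * G) := by positivity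
    have hgMs : 0 ≤ g1 * (M * s) := by positivity
    rw [e]
    refine (sub_le_sub_right (add_le_add (l1.trans h1) (l2.trans h2)) _).trans ?_
    generalize g1 * (ρ * (ε⁻¹ * Θ2) * (b * w)) = zz at *
    linarith only [l4, hMs, hMG, hgMG, hgMs]
  have t9 : (ε/3)*Θ^3*a^3*(R*d+w*R2) ≤ M^4*ε^2*a^2 + 2*(G+s) := by
    have h1 : |Θ^3| ≤ (5/4)^3 := by rw [abs_pow]; gcongr
    have ha2 : |a^2| ≤ M^2 := by rw [abs_pow]; gcongr
    have hR2b : |R2| ≤ 1/16 := hR2.trans hε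
    have h2 := yg (p := ε * a) (q := d) (δ := M^4/2) (bm (bm h1 ha2) aR) (by positivity) hdG
    have h3 := yg (p := ε * a) (q := w) (δ := M^4/2) (S := s) (bm (bm h1 ha2) hR2b) (by positivity)
      (by rw [hs]; linarith only [sq_nonneg v, sq_nonneg b])
    have e : (ε/3)*Θ^3*a^3*(R*d+w*R2) = 1/3 * (Θ^3*a^2*R*(ε*a)*d + Θ^3*a^2*R2*(ε*a)*w) := by ring
    have f2 : ((5/4:ℝ)^3*M^2*(5/4))^2/(4*(M^4/2)) = ((5/4:ℝ)^3*(5/4))^2/2 := by field_simp; ring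
    have f3 : ((5/4:ℝ)^3*M^2*(1/16))^2/(4*(M^4/2)) = ((5/4:ℝ)^3*(1/16))^2/2 := by field_simp; ring
    rw [f2] at h2; rw [f3] at h3
    rw [e]
    have h4 : 0 ≤ M^4 * (ε*a)^2 := by positivity
    linarith only [h2, h3, h4, hG0, hs0]
  have t10 : ε*b*(2*μ*(v1^2+w2^2+1/2*(w1+v2)^2)+2*μ*(w1+v2)+r*μ*d^2) ≤ (2 + 2*|r| + 2)*η*μ*(G+s) := by
    have q1 : |v1^2+w2^2+1/2*(w1+v2)^2| ≤ G := by
      rw [abs_of_nonneg (by positivity), hG]; linarith only [sq_nonneg (w1-v2)]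
    have h1 := (le_abs_self _).trans (bm hb q1)
    have q2 : b*(w1+v2) ≤ G+s := by
      rw [hG, hs]; linarith only [sq_nonneg v1, sq_nonneg w2, sq_nonneg v, sq_nonneg w, sq_nonneg (w1-v2), sq_nonneg (b-(w1+v2)), sq_nonneg b]
    have h2 : ε*(b*(w1+v2)) ≤ η*(G+s) := by
      calc ε*(b*(w1+v2)) ≤ ε*(G+s) := by gcongr
        _ ≤ _ := by gcongr
    have h3 : ε*b*(r*d^2) ≤ η * (|r| * (2*G)) := by
      refine (le_abs_self _).trans (bm hb ?_)
      rw [abs_mul, abs_of_nonneg (sq_nonneg d)]; gcongr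
    have hη1 : 0 ≤ η*s := by positivity
    have hη2 : 0 ≤ η*(|r| * s) := by positivity
    have : ε*b*(2*(v1^2+w2^2+1/2*(w1+v2)^2)+2*(w1+v2)+r*d^2) ≤ (2 + 2*|r| + 2)*η*(G+s) := by
      have e : ε*b*(2*(v1^2+w2^2+1/2*(w1+v2)^2)+2*(w1+v2)+r*d^2) = 2 * (ε*b*(v1^2+w2^2+1/2*(w1+v2)^2))
        + 2*(ε*(b*(w1+v2))) + ε*b*(r*d^2) := by ring
      rw [e]
      refine (add_le_add (add_le_add (mul_le_mul_of_nonneg_left h1 zero_le_two)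
        (mul_le_mul_of_nonneg_left h2 zero_le_two)) h3).trans ?_
      linarith only [hη1, hη2]
    have := mul_le_mul_of_nonneg_left this hμ.le
    linarith only [this]
  have hp1 : 0 ≤ |r| * (η*μ*(G+s)) := by positivity
  have hp2 : 0 ≤ η*μ*(G+s) := by positivity
  have hp3 : G+s ≤ M*(G+s) := le_mul_of_one_le_left hS0 hM
  have key := add_le_add (add_le_add (add_le_add (add_le_add (add_le_add (add_le_add (add_le_add t1 t4) t5) t6) t7) t8) t9) t10
  calc _ = -μ*R*G + -μ*R2*(v*v2+w*w2) + (- lam*R*d^2 - lam*d*R2*w) + -ρ*R*v*w + 1/2*ρ*(v^2+w^2)*w*R2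
      + ε⁻¹*ρ*b*((R-(Θ+ε*b))*d+w*R2-g1*w*Θ2) + (ε/3)*Θ^3*a^3*(R*d+w*R2)
      + ε*b*(2*μ*(v1^2+w2^2+1/2*(w1+v2)^2)+2*μ*(w1+v2)+r*μ*d^2) - κ*(b1^2+b2^2) := by ring
    _ ≤ _ := sub_le_sub_right key _
    _ ≤ _ := by linarith only [hp1, hp2, hp3, hMs, hMG]

/-- one-field Poincare inequality -/
theorem poincare (f : Fld) [SM f] {t : ℝ}
    (h0 : ∀ x : ℝ × ℝ, (x.2 = 0 ∨ x.2 = 1) → f t x = 0) : J (f * f) t ≤ J (D2 f * D2 f) t := by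
  have h := J_div (e := f * f) (X := (0:ℝ) • Yf) (Z := Yf * (f * f) - (1/2:ℝ) • (f * f))
    (B := (1/2:ℝ) • (f * f) + (1/2:ℝ) • (D2 f * D2 f)) (t := t)
    (fun x hx => by simp [h0 x hx]) (fun x hx => by
      have hy := hx.2
      simp only [d1_add, d2_add, d1_sub, d2_sub, d1_mul, d2_mul, d1_smul, d2_smul, D1_Yf, D2_Yf]
      simp only [Pi.add_apply, Pi.mul_apply, Pi.sub_apply, Pi.smul_apply, smul_eq_mul,
        Pi.zero_apply, Pi.one_apply, Yf]
      generalize f t x = p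
      generalize D2 f t x = q
      obtain ⟨h1, h2⟩ := hy
      generalize x.2 = y at *
      have : |(2*y-1)*(p*q)| ≤ 1 * (1/2*(p^2+q^2)) := by
        refine bm ?_ ?_
        · rw [abs_le]; constructor <;> linarith
        · rw [abs_le]; constructor <;> linarith [sq_nonneg (p+q), sq_nonneg (p-q)]
      have := neg_abs_le ((2*y-1)*(p*q))
      linarith)
  rw [J_add_eq, J_smul_eq, J_smul_eq] at h
  linarith

theorem sq_int_le {h h' : ℝ → ℝ} {L : ℝ} (hL : 0 ≤ L) (hd : ∀ s, HasDerivAt h (h' s) s)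
    (hc : Continuous h') {y z : ℝ} (hy : y ∈ Set.Icc 0 L) (hz : z ∈ Set.Icc 0 L) :
    (h y - h z) ^ 2 ≤ L * ∫ s in (0:ℝ)..L, h' s ^ 2 := by
  have key : ∀ y z : ℝ, y ∈ Set.Icc 0 L → z ∈ Set.Icc 0 L → z ≤ y →
      (h y - h z) ^ 2 ≤ L * ∫ s in (0:ℝ)..L, h' s ^ 2 := by
    intro y z hy hz hzy
    have h1 : ∫ s in z..y, h' s = h y - h z :=
      intervalIntegral.integral_eq_sub_of_hasDerivAt (fun x _ => hd x) (hc.intervalIntegrable _ _)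
    set I := ∫ s in z..y, h' s
    set Q := ∫ s in z..y, h' s ^ 2
    have hQ : Q ≤ ∫ s in (0:ℝ)..L, h' s ^ 2 :=
      intervalIntegral.integral_mono_interval hz.1 hzy hy.2
          (Eventually.of_forall fun s => sq_nonneg _) ((hc.pow 2).intervalIntegrable _ _)
    have h2 : ∀ c : ℝ, 0 ≤ Q - 2 * c * I + c ^ 2 * (y - z) := by
      intro c
      have : 0 ≤ ∫ s in z..y, (h' s - c) ^ 2 :=
        intervalIntegral.integral_nonneg hzy fun _ _ => sq_nonneg _
      have e : ∫ s in z..y, (h' s - c) ^ 2 = Q - 2 * c * I + c ^ 2 * (y - z) := by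
        have : ∀ s, (h' s - c) ^ 2 = h' s ^ 2 - 2 * c * h' s + c ^ 2 := fun s => by ring
        simp only [this]
        rw [intervalIntegral.integral_add, intervalIntegral.integral_sub,
          intervalIntegral.integral_const_mul, intervalIntegral.integral_const]
        · simp only [smul_eq_mul]; ring
        all_goals exact Continuous.intervalIntegrable (by fun_prop) _ _
      linarith
    have hQ0 : 0 ≤ Q := intervalIntegral.integral_nonneg hzy fun _ _ => sq_nonneg _
    have h3 : I ^ 2 ≤ (y - z) * Q := by
      rcases eq_or_lt_of_le hzy with he | hlt
      · subst he; simp [I]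
      · have hp : 0 < y - z := by linarith
        have := h2 (I / (y - z))
        have e : Q - 2 * (I / (y - z)) * I + (I / (y - z)) ^ 2 * (y - z) = Q - I ^ 2 / (y - z) := by
          field_simp; ring
        rw [e] at this
        have : I ^ 2 / (y - z) ≤ Q := by linarith
        rwa [div_le_iff₀ hp, mul_comm] at this
    rw [← h1]
    refine h3.trans ?_
    have : y - z ≤ L := by linarith [hy.2, hz.1]
    calc (y - z) * Q ≤ L * Q := by gcongr
      _ ≤ _ := by gcongr
  rcases le_total z y with hzy | hzy
  · exact key y z hy hz hzy
  · have := key z y hz hy hzy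
    rw [← neg_sub (h z), neg_sq]; exact this

theorem vol_pos : 0 ≤ (volume.real Ω) := measureReal_nonneg

/-- Poincare-Wirtinger -/
theorem wirtinger (f : Fld) [SM f] {t : ℝ} (h0 : J f t = 0) :
    J (f * f) t ≤ 2 * (2 * π) ^ 2 * J (D1 f * D1 f) t + 2 * J (D2 f * D2 f) t := by
  have c0 := (SM.out (f := f)).contx t
  have c1 := (SM.out (f := f)).D1.contx t
  have c2 := (SM.out (f := f)).D2.contx t
  have hL : (0:ℝ) < 2 * π := by positivity
  set L := 2 * π with hLd
  let A : ℝ → ℝ := fun y => ∫ s in (0:ℝ)..L, D1 f t (s, y) ^ 2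
  let B : ℝ → ℝ := fun y => ∫ s in (0:ℝ)..1, D2 f t (y, s) ^ 2
  have cA : Continuous A := by
    apply intervalIntegral.continuous_parametric_intervalIntegral_of_continuous'
    fun_prop
  have cB : Continuous B := by
    apply intervalIntegral.continuous_parametric_intervalIntegral_of_continuous'
    fun_prop
  have JA : ∫ y in (0:ℝ)..1, A y = J (D1 f * D1 f) t := by
    unfold J
    rw [int_fubini' (by simp only [Pi.mul_apply]; exact (c1.mul c1))]
    simp only [A, Pi.mul_apply, sq]
    rfl
  have JB : ∫ y in (0:ℝ)..L, B y = J (D2 f * D2 f) t := by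
    unfold J
    rw [int_fubini (by simp only [Pi.mul_apply]; exact (c2.mul c2))]
    simp only [B, Pi.mul_apply, sq]
    rfl
  -- pointwise
  have pt : ∀ y1 ∈ Set.Icc 0 L, ∀ x ∈ Ω, (f t x - f t (y1, 0)) ^ 2 ≤ 2 * (L * A x.2) + 2 * B y1 := by
    intro y1 hy1 x hx
    obtain ⟨x1, x2⟩ := x
    have hx' := Ω_sub hx
    have a1 := sq_int_le (h := fun s => f t (s, x2)) (h' := fun s => D1 f t (s, x2)) hL.le
      (fun s => slice1 SM.out t s x2) (by fun_prop) hx'.1 hy1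
    have a2 := sq_int_le (h := fun s => f t (y1, s)) (h' := fun s => D2 f t (y1, s)) zero_le_one
      (fun s => slice2 SM.out t y1 s) (by fun_prop) hx'.2 (by simp : (0:ℝ) ∈ Set.Icc 0 1)
    simp only [one_mul] at a1 a2
    show (f t (x1, x2) - f t (y1, 0)) ^ 2 ≤ 2 * (L * ∫ s in (0:ℝ)..L, D1 f t (s, x2) ^ 2)
      + 2 * ∫ s in (0:ℝ)..1, D2 f t (y1, s) ^ 2
    have := sq_nonneg ((f t (x1, x2) - f t (y1, x2)) - (f t (y1, x2) - f t (y1, 0)))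
    nlinarith only [this, a1, a2]
  have st : ∀ y1 ∈ Set.Icc 0 L, J (f * f) t ≤ 2 * L ^ 2 * J (D1 f * D1 f) t + 2 * L * B y1 := by
    intro y1 hy1
    set c := f t (y1, 0)
    have m := setIntegral_mono_on (μ := volume) (f := fun x => (f t x - c) ^ 2)
      (g := fun x => 2 * (L * A x.2) + 2 * B y1)
      (intOn (by fun_prop)) (intOn (by fun_prop)) Ω_meas (pt y1 hy1)
    have e1 : ∫ x in Ω, (f t x - c) ^ 2 = J (f * f) t + c ^ 2 * volume.real Ω := by
      have : ∀ x, (f t x - c) ^ 2 = (f t x * f t x - 2 * c * f t x) + c ^ 2 := fun s => by ring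
      simp only [this]
      rw [integral_add (intOn (by fun_prop)) (intOn (by fun_prop)),
        integral_sub (intOn (by fun_prop)) (intOn (by fun_prop)), integral_const_mul]
      have : ∫ x in Ω, f t x = 0 := h0
      rw [this]
      simp [J]; ring
    have e2 : ∫ x in Ω, (2 * (L * A x.2) + 2 * B y1) = 2 * L ^ 2 * J (D1 f * D1 f) t + 2 * L * B y1 := by
      rw [int_fubini' (by fun_prop), ← JA]
      simp only [intervalIntegral.integral_const, smul_eq_mul, sub_zero, ← hLd]
      rw [intervalIntegral.integral_const_mul, intervalIntegral.integral_add
        (Continuous.intervalIntegrable (by fun_prop) _ _) (by simp),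
        intervalIntegral.integral_const_mul, intervalIntegral.integral_const_mul]
      simp; ring
    rw [e1, e2] at m
    have := mul_nonneg (sq_nonneg c) vol_pos
    linarith
  have fin := intervalIntegral.integral_mono_on (μ := volume) hL.le (f := fun _ => J (f * f) t)
    (g := fun y => 2 * L ^ 2 * J (D1 f * D1 f) t + 2 * L * B y) (by simp)
    (Continuous.intervalIntegrable (by fun_prop) _ _) st
  rw [intervalIntegral.integral_add (by simp) (Continuous.intervalIntegrable (by fun_prop) _ _),
    intervalIntegral.integral_const_mul (2 * L) B, JB] at fin
  simp only [intervalIntegral.integral_const, smul_eq_mul, sub_zero] at fin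
  refine le_of_mul_le_mul_left ?_ hL
  linarith

namespace Sys
variable {μ lam κ g1 r M ε T : ℝ} (S : Sys μ lam κ g1 r M ε T)

theorem mean_zero (h0 : 0 < ε) {t : ℝ} (ht : t ∈ Set.Icc 0 T) : J S.a t = 0 := by
  have hd : ∀ s ∈ Set.Icc 0 T, J (Dt S.a) s = 0 := by
    intro s hs
    have pt : ∀ x ∈ Ω, Dt S.a s x = D1 (-ε⁻¹ • (S.ρ * (Yf + S.v))) s x + D2 (-ε⁻¹ • (S.ρ * S.w)) s x
        + ((0:ℝ) • Yf) s x := by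
      intro x hx
      have hm := S.mass s hs x hx
      simp only [d1_add, d2_add, d1_mul, d2_mul, d1_smul, d2_smul, D1_Yf, D2_Yf, S.R1, Sys.ρ] at *
      simp only [Pi.add_apply, Pi.mul_apply, Pi.smul_apply, smul_eq_mul, Pi.zero_apply] at *
      linear_combination (norm := (field_simp; ring)) ε⁻¹ * hm
    have hZ : ∀ x : ℝ × ℝ, (x.2 = 0 ∨ x.2 = 1) → (-ε⁻¹ • (S.ρ * S.w)) s x = 0 := by
      intro x hx; simp [S.cw s hs x hx]
    have u : J (Dt S.a) s = J (D1 (-ε⁻¹ • (S.ρ * (Yf + S.v))) + D2 (-ε⁻¹ • (S.ρ * S.w))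
        + ((0:ℝ) • Yf)) s := J_congr pt
    rw [J_add_eq, J_add_eq, J_D1 SM.out PER.out, J_D2 SM.out hZ, J_smul_eq] at u
    linarith
  have hc := constant_of_has_deriv_right_zero (f := J S.a) (a := 0) (b := T)
    (J_cont SM.out).continuousOn (fun s hs => by
      have := (J_hasDerivAt (f := S.a) SM.out s).hasDerivWithinAt (s := Set.Ici s)
      rwa [hd s ⟨hs.1, hs.2.le⟩] at this)
  rw [hc t ht, S.mean]

/-- gradient fields -/
def gψ : Fld := D1 S.v * D1 S.v + D2 S.v * D2 S.v + D1 S.w * D1 S.w + D2 S.w * D2 S.w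
def gb : Fld := D1 S.b * D1 S.b + D2 S.b * D2 S.b
def ga : Fld := D1 S.a * D1 S.a + D2 S.a * D2 S.a
def so : Fld := S.v * S.v + S.w * S.w + S.b * S.b
instance : SM S.gψ := by unfold gψ; infer_instance
instance : SM S.gb := by unfold gb; infer_instance
instance : SM S.ga := by unfold ga; infer_instance
instance : SM S.so := by unfold so; infer_instance

theorem so_le {t : ℝ} (ht : t ∈ Set.Icc 0 T) : J S.so t ≤ J S.gψ t + J S.gb t := by
  have h1 := poincare S.v (S.cv t ht)
  have h2 := poincare S.w (S.cw t ht)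
  have h3 := poincare S.b (S.cb t ht)
  have n1 := J_sq_nonneg (D1 S.v) t
  have n2 := J_sq_nonneg (D1 S.w) t
  have n3 := J_sq_nonneg (D1 S.b) t
  simp only [so, gψ, gb, J_add_eq]
  linarith
theorem gψ0 (t : ℝ) : 0 ≤ J S.gψ t := by
  simp only [gψ, J_add_eq]
  linarith [J_sq_nonneg (D1 S.v) t, J_sq_nonneg (D1 S.w) t, J_sq_nonneg (D2 S.v) t, J_sq_nonneg (D2 S.w) t]
theorem gb0 (t : ℝ) : 0 ≤ J S.gb t := by
  simp only [gb, J_add_eq]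
  linarith [J_sq_nonneg (D1 S.b) t, J_sq_nonneg (D2 S.b) t]
theorem ga0 (t : ℝ) : 0 ≤ J S.ga t := by
  simp only [ga, J_add_eq]
  linarith [J_sq_nonneg (D1 S.a) t, J_sq_nonneg (D2 S.a) t]
theorem so0 (t : ℝ) : 0 ≤ J S.so t := by
  simp only [so, J_add_eq]
  linarith [J_sq_nonneg (S.v) t, J_sq_nonneg (S.w) t, J_sq_nonneg (S.b) t]

theorem a_le (h0 : 0 < ε) {t : ℝ} (ht : t ∈ Set.Icc 0 T) : J (S.a * S.a) t ≤ 200 * J S.ga t := by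
  have := wirtinger S.a (S.mean_zero h0 ht)
  simp only [ga, J_add_eq]
  have hp : (2 * (2 * π) ^ 2) ≤ 200 := by nlinarith [Real.pi_lt_four, Real.pi_pos]
  nlinarith [J_sq_nonneg (D1 S.a) t, J_sq_nonneg (D2 S.a) t]

theorem L0 {k : ℝ} (hM : 1 ≤ M) (h0 : 0 < ε) (hε : M * ε ≤ 1 / 16) (hμ : 0 < μ) (hr : 0 < 1 + r)
    (hlam : lam = (1 + r) * μ) (hg : 0 < g1) (hk : 0 < k) (hk1 : k ≤ 1) (hκ : k * μ ≤ κ)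
    (hs : 20 * (1 + |r|) * (M * ε) ≤ k / 8) (hC : 2 * ((20 + 2 * g1) * M) ≤ k * μ / 8)
    {t : ℝ} (ht : t ∈ Set.Icc 0 T) :
    J (Dt S.e0) t ≤ -(k * μ / 4) * (J S.gψ t + J S.gb t) + M ^ 4 * ε ^ 2 * J (S.a * S.a) t := by
  have hZ : ∀ x : ℝ × ℝ, (x.2 = 0 ∨ x.2 = 1) → S.Z0 t x = 0 := by
    intro x hx; simp [Z0, S.cw t ht x hx, S.cv t ht x hx, S.cb t ht x hx]
  set c := 10*(1+|r|) * (M*ε)*μ + (20+2*g1)*M with hc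
  have h := J_div (e := Dt S.e0) (X := S.X0) (Z := S.Z0)
    (B := (-(3/4*μ)) • S.gψ - κ • S.gb + c • (S.gψ + S.so) + (M^4*ε^2) • (S.a * S.a)) (t := t) hZ
    (fun x hx => by
      rw [S.L0_id h0.ne' ht hx rfl rfl rfl rfl rfl rfl rfl rfl rfl rfl rfl rfl rfl rfl rfl rfl rfl]
      obtain ⟨q1, q2, q3, q4, q5, q6, q7, q8, q9, q10⟩ := S.bnds hM h0 hε ht hx
      have hb : |ε * S.b t x| ≤ M * ε := by
        rw [abs_mul, abs_of_pos h0, mul_comm]; gcongr; exact S.bb t ht x hx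
      have := L0_real (v := S.v t x) (v1 := D1 S.v t x) (v2 := D2 S.v t x) (w1 := D1 S.w t x)
        (w2 := D2 S.w t x) (b1 := D1 S.b t x) (b2 := D2 S.b t x) (κ := κ)
        hM h0 hε hμ hr hlam hg (S.ba t ht x hx) (S.bw t ht x hx) hb q3 q4 q5 rfl q7
        (S.bR2 t x hx) q8 q9
      rw [← hc] at this
      refine add_le_add le_rfl (this.trans (le_of_eq ?_))
      simp only [gψ, gb, so, Pi.add_apply, Pi.mul_apply, Pi.sub_apply, Pi.smul_apply, smul_eq_mul]
      ring)
  simp only [J_add_eq, J_sub_eq, J_smul_eq] at h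
  have p := S.so_le ht
  have p0 := S.gψ0 t
  have p1 := S.gb0 t
  have hc0 : 2 * c ≤ k * μ / 4 := by
    have := mul_le_mul_of_nonneg_right hs hμ.le
    rw [hc]; linarith
  have hcn : 0 ≤ c := by rw [hc]; positivity
  have e1 : c * J S.so t ≤ c * (J S.gψ t + J S.gb t) := by gcongr
  have e2 := mul_le_mul_of_nonneg_right hc0 p0
  have e3 := mul_le_mul_of_nonneg_right hc0 p1
  have e4 := mul_le_mul_of_nonneg_right hκ p1
  have e5 := mul_le_mul_of_nonneg_right hk1 (mul_nonneg hμ.le p0)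
  have e6 : 0 ≤ c * J S.gb t := by positivity
  have e7 : 0 ≤ k * μ * J S.gb t := by positivity
  have e8 : 0 ≤ μ * J S.gψ t := by positivity
  have e9 : 0 ≤ c * J S.gψ t := by positivity
  linarith only [h, e1, e2, e3, e4, e5, e6, e7, e8, e9]
end Sys

/-- pointwise bounds used at all higher levels -/
structure PtB (M ε s y a v w b Θ R v1 v2 w1 w2 b1 b2 a1 a2 Θ2 R2 R22 : ℝ) : Prop where
  s0 : 0 ≤ s
  M1 : 1 ≤ M
  e0 : 0 < ε
  e1 : ε ≤ 1
  ρl : 1/2 ≤ R + ε * a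
  τl : 1/2 ≤ Θ + ε * b
  hρ : |R + ε * a| ≤ 3/2
  hτ : |Θ + ε * b| ≤ 3/2
  hR : |R| ≤ 5/4
  hΘ : |Θ| ≤ 5/4
  ha : |a| ≤ M
  hw : |w| ≤ M
  hb : |b| ≤ M
  hU : |y + v| ≤ 1 + M
  kv1 : |ε * v1| ≤ M
  kv2 : |ε * v2| ≤ M
  kw1 : |ε * w1| ≤ M
  kw2 : |ε * w2| ≤ M
  hRτ : |ε⁻¹ * (R - (Θ + ε * b))| ≤ 3 * M
  hR2 : |ε⁻¹ * R2| ≤ M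
  hΘ2 : |ε⁻¹ * Θ2| ≤ M
  hR22 : |ε⁻¹ * R22| ≤ M
  sa : |a| ≤ s
  sa1 : |a1| ≤ s
  sa2 : |a2| ≤ s
  sv : |v| ≤ s
  sw : |w| ≤ s
  sb : |b| ≤ s
  sv1 : |v1| ≤ s
  sv2 : |v2| ≤ s
  sw1 : |w1| ≤ s
  sw2 : |w2| ≤ s
  sb1 : |b1| ≤ s
  sb2 : |b2| ≤ s
  iv : |ε⁻¹ * v| ≤ s
  iw : |ε⁻¹ * w| ≤ s
  ib : |ε⁻¹ * b| ≤ s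
  iv1 : |ε⁻¹ * v1| ≤ s
  iv2 : |ε⁻¹ * v2| ≤ s
  iw1 : |ε⁻¹ * w1| ≤ s
  iw2 : |ε⁻¹ * w2| ≤ s
  ib1 : |ε⁻¹ * b1| ≤ s
  ib2 : |ε⁻¹ * b2| ≤ s

theorem bn {x A : ℝ} (hx : |x| ≤ A) : |-x| ≤ A := by rwa [abs_neg]
theorem bc {c x A : ℝ} (hc : 0 ≤ c) (hx : |x| ≤ A) : |c * x| ≤ c * A := by
  rw [abs_mul, abs_of_nonneg hc]; gcongr
/-- Young with an absolute bound. -/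
theorem ya {f p B δ : ℝ} (hδ : 0 < δ) (hf : |f| ≤ B) : f * p ≤ δ * p ^ 2 + B ^ 2 / (4 * δ) := by
  have := yg (c := f) (p := p) (q := 1) (S := 1) hf hδ (by norm_num)
  linarith

namespace Sys
variable {μ lam κ g1 r M ε T : ℝ} (S : Sys μ lam κ g1 r M ε T)

def sF : Fld := (ε⁻¹ * ε⁻¹) • (S.gψ + S.gb + S.so) + S.ga + S.a * S.a
instance : SM S.sF := by unfold sF; infer_instance

theorem sF_le (h0 : 0 < ε) {t : ℝ} (ht : t ∈ Set.Icc 0 T) :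
    J S.sF t ≤ 2 * (ε⁻¹ * ε⁻¹ * (J S.gψ t + J S.gb t)) + 201 * J S.ga t := by
  have h1 := S.so_le ht
  have h2 := S.a_le h0 ht
  have h3 : 0 < ε⁻¹ * ε⁻¹ := by positivity
  have h4 := mul_le_mul_of_nonneg_left h1 h3.le
  simp only [sF, J_add_eq, J_smul_eq]
  linarith only [h2, h4]

theorem sF_eq (t : ℝ) (x : ℝ × ℝ) : S.sF t x = ((ε⁻¹ * D1 S.v t x)^2+ (ε⁻¹ * D2 S.v t x)^2 + (ε⁻¹ * D1 S.w t x)^2+ (ε⁻¹ * D2 S.w t x)^2 + (ε⁻¹ * D1 S.b t x)^2+ (ε⁻¹ * D2 S.b t x)^2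
   + (ε⁻¹ * S.v t x)^2 + (ε⁻¹ * S.w t x)^2 + (ε⁻¹ * S.b t x)^2) + (D1 S.a t x ^ 2 + D2 S.a t x ^ 2 + S.a t x ^ 2) := by
  simp only [sF, gψ, gb, so, ga, Pi.add_apply, Pi.mul_apply, Pi.sub_apply, Pi.smul_apply, smul_eq_mul]
  ring
theorem sF0 (t : ℝ) (x : ℝ × ℝ) : 0 ≤ S.sF t x := by rw [sF_eq]; positivity

theorem ptB (hM : 1 ≤ M) (h0 : 0 < ε) (hε : M * ε ≤ 1 / 16) {t : ℝ} (ht : t ∈ Set.Icc 0 T)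
    {x : ℝ × ℝ} (hx : x ∈ Ω) :
    PtB M ε (√(S.sF t x)) (Yf t x) (S.a t x) (S.v t x) (S.w t x) (S.b t x) (S.Θ t x) (S.R t x)
      (D1 S.v t x) (D2 S.v t x) (D1 S.w t x) (D2 S.w t x) (D1 S.b t x) (D2 S.b t x)
      (D1 S.a t x) (D2 S.a t x) (D2 S.Θ t x) (D2 S.R t x) (D2 (D2 S.R) t x) := by
  obtain ⟨q1, q2, q3, q4, q5, q6, q7, q8, q9, q10⟩ := S.bnds hM h0 hε ht hx
  have he1 : ε ≤ 1 := by nlinarith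
  have hs : ∀ z : ℝ, z ^ 2 ≤ S.sF t x → |z| ≤ √(S.sF t x) := fun z hz => Real.abs_le_sqrt hz
  have hi : 1 ≤ ε⁻¹ := by rw [one_le_inv₀ h0]; exact he1
  have hs' : ∀ z : ℝ, |ε⁻¹ * z| ≤ √(S.sF t x) → |z| ≤ √(S.sF t x) := by
    intro z hz
    refine le_trans ?_ hz
    rw [abs_mul, abs_of_pos (inv_pos.2 h0)]
    exact le_mul_of_one_le_left (abs_nonneg z) hi
  have hY : |Yf t x| ≤ 1 := by
    have := (Ω_sub hx).2
    rw [abs_le]; constructor <;> simp only [Yf] <;> linarith [this.1, this.2]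
  have A : ∀ z, z ^ 2 ≤ S.sF t x → |z| ≤ √(S.sF t x) := hs
  have e := S.sF_eq t x
  have iv1 : |ε⁻¹ * D1 S.v t x| ≤ √(S.sF t x) := hs _ (by rw [e]; linarith only [sq_nonneg (ε⁻¹ * D2 S.v t x), sq_nonneg (ε⁻¹ * D1 S.w t x), sq_nonneg (ε⁻¹ * D2 S.w t x), sq_nonneg (ε⁻¹ * D1 S.b t x), sq_nonneg (ε⁻¹ * D2 S.b t x), sq_nonneg (ε⁻¹ * S.v t x), sq_nonneg (ε⁻¹ * S.w t x), sq_nonneg (ε⁻¹ * S.b t x), sq_nonneg (D1 S.a t x), sq_nonneg (D2 S.a t x), sq_nonneg (S.a t x)])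
  have iv2 : |ε⁻¹ * D2 S.v t x| ≤ √(S.sF t x) := hs _ (by rw [e]; linarith only [sq_nonneg (ε⁻¹ * D1 S.v t x), sq_nonneg (ε⁻¹ * D1 S.w t x), sq_nonneg (ε⁻¹ * D2 S.w t x), sq_nonneg (ε⁻¹ * D1 S.b t x), sq_nonneg (ε⁻¹ * D2 S.b t x), sq_nonneg (ε⁻¹ * S.v t x), sq_nonneg (ε⁻¹ * S.w t x), sq_nonneg (ε⁻¹ * S.b t x), sq_nonneg (D1 S.a t x), sq_nonneg (D2 S.a t x), sq_nonneg (S.a t x)])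
  have iw1 : |ε⁻¹ * D1 S.w t x| ≤ √(S.sF t x) := hs _ (by rw [e]; linarith only [sq_nonneg (ε⁻¹ * D1 S.v t x), sq_nonneg (ε⁻¹ * D2 S.v t x), sq_nonneg (ε⁻¹ * D2 S.w t x), sq_nonneg (ε⁻¹ * D1 S.b t x), sq_nonneg (ε⁻¹ * D2 S.b t x), sq_nonneg (ε⁻¹ * S.v t x), sq_nonneg (ε⁻¹ * S.w t x), sq_nonneg (ε⁻¹ * S.b t x), sq_nonneg (D1 S.a t x), sq_nonneg (D2 S.a t x), sq_nonneg (S.a t x)])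
  have iw2 : |ε⁻¹ * D2 S.w t x| ≤ √(S.sF t x) := hs _ (by rw [e]; linarith only [sq_nonneg (ε⁻¹ * D1 S.v t x), sq_nonneg (ε⁻¹ * D2 S.v t x), sq_nonneg (ε⁻¹ * D1 S.w t x), sq_nonneg (ε⁻¹ * D1 S.b t x), sq_nonneg (ε⁻¹ * D2 S.b t x), sq_nonneg (ε⁻¹ * S.v t x), sq_nonneg (ε⁻¹ * S.w t x), sq_nonneg (ε⁻¹ * S.b t x), sq_nonneg (D1 S.a t x), sq_nonneg (D2 S.a t x), sq_nonneg (S.a t x)])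
  have ib1 : |ε⁻¹ * D1 S.b t x| ≤ √(S.sF t x) := hs _ (by rw [e]; linarith only [sq_nonneg (ε⁻¹ * D1 S.v t x), sq_nonneg (ε⁻¹ * D2 S.v t x), sq_nonneg (ε⁻¹ * D1 S.w t x), sq_nonneg (ε⁻¹ * D2 S.w t x), sq_nonneg (ε⁻¹ * D2 S.b t x), sq_nonneg (ε⁻¹ * S.v t x), sq_nonneg (ε⁻¹ * S.w t x), sq_nonneg (ε⁻¹ * S.b t x), sq_nonneg (D1 S.a t x), sq_nonneg (D2 S.a t x), sq_nonneg (S.a t x)])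
  have ib2 : |ε⁻¹ * D2 S.b t x| ≤ √(S.sF t x) := hs _ (by rw [e]; linarith only [sq_nonneg (ε⁻¹ * D1 S.v t x), sq_nonneg (ε⁻¹ * D2 S.v t x), sq_nonneg (ε⁻¹ * D1 S.w t x), sq_nonneg (ε⁻¹ * D2 S.w t x), sq_nonneg (ε⁻¹ * D1 S.b t x), sq_nonneg (ε⁻¹ * S.v t x), sq_nonneg (ε⁻¹ * S.w t x), sq_nonneg (ε⁻¹ * S.b t x), sq_nonneg (D1 S.a t x), sq_nonneg (D2 S.a t x), sq_nonneg (S.a t x)])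
  have iv : |ε⁻¹ * S.v t x| ≤ √(S.sF t x) := hs _ (by rw [e]; linarith only [sq_nonneg (ε⁻¹ * D1 S.v t x), sq_nonneg (ε⁻¹ * D2 S.v t x), sq_nonneg (ε⁻¹ * D1 S.w t x), sq_nonneg (ε⁻¹ * D2 S.w t x), sq_nonneg (ε⁻¹ * D1 S.b t x), sq_nonneg (ε⁻¹ * D2 S.b t x), sq_nonneg (ε⁻¹ * S.w t x), sq_nonneg (ε⁻¹ * S.b t x), sq_nonneg (D1 S.a t x), sq_nonneg (D2 S.a t x), sq_nonneg (S.a t x)])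
  have iw : |ε⁻¹ * S.w t x| ≤ √(S.sF t x) := hs _ (by rw [e]; linarith only [sq_nonneg (ε⁻¹ * D1 S.v t x), sq_nonneg (ε⁻¹ * D2 S.v t x), sq_nonneg (ε⁻¹ * D1 S.w t x), sq_nonneg (ε⁻¹ * D2 S.w t x), sq_nonneg (ε⁻¹ * D1 S.b t x), sq_nonneg (ε⁻¹ * D2 S.b t x), sq_nonneg (ε⁻¹ * S.v t x), sq_nonneg (ε⁻¹ * S.b t x), sq_nonneg (D1 S.a t x), sq_nonneg (D2 S.a t x), sq_nonneg (S.a t x)])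
  have ib : |ε⁻¹ * S.b t x| ≤ √(S.sF t x) := hs _ (by rw [e]; linarith only [sq_nonneg (ε⁻¹ * D1 S.v t x), sq_nonneg (ε⁻¹ * D2 S.v t x), sq_nonneg (ε⁻¹ * D1 S.w t x), sq_nonneg (ε⁻¹ * D2 S.w t x), sq_nonneg (ε⁻¹ * D1 S.b t x), sq_nonneg (ε⁻¹ * D2 S.b t x), sq_nonneg (ε⁻¹ * S.v t x), sq_nonneg (ε⁻¹ * S.w t x), sq_nonneg (D1 S.a t x), sq_nonneg (D2 S.a t x), sq_nonneg (S.a t x)])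
  have ia : ∀ z, z ^ 2 ≤ D1 S.a t x ^ 2 + D2 S.a t x ^ 2 + S.a t x ^ 2 → |z| ≤ √(S.sF t x) := by
    intro z hz
    refine hs z ?_
    rw [e]
    linarith only [hz, sq_nonneg (ε⁻¹ * D1 S.v t x), sq_nonneg (ε⁻¹ * D2 S.v t x), sq_nonneg (ε⁻¹ * D1 S.w t x), sq_nonneg (ε⁻¹ * D2 S.w t x), sq_nonneg (ε⁻¹ * D1 S.b t x), sq_nonneg (ε⁻¹ * D2 S.b t x), sq_nonneg (ε⁻¹ * S.v t x), sq_nonneg (ε⁻¹ * S.w t x), sq_nonneg (ε⁻¹ * S.b t x)]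
  exact {
    s0 := Real.sqrt_nonneg _
    M1 := hM
    e0 := h0
    e1 := he1
    ρl := q5.1
    τl := q6.1
    hρ := abs_le.2 ⟨by linarith only [q5.1], q5.2⟩
    hτ := abs_le.2 ⟨by linarith only [q6.1], q6.2⟩
    hR := abs_le.2 ⟨by linarith only [q3.1], q3.2⟩
    hΘ := abs_le.2 ⟨by linarith only [q4.1], q4.2⟩
    ha := S.ba t ht x hx
    hw := S.bw t ht x hx
    hb := S.bb t ht x hx
    hU := Couette.ba hY (S.bv t ht x hx)
    kv1 := S.bv1 t ht x hx
    kv2 := S.bv2 t ht x hx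
    kw1 := S.bw1 t ht x hx
    kw2 := S.bw2 t ht x hx
    hRτ := q7
    hR2 := q8
    hΘ2 := q9
    hR22 := q10
    sa := ia _ (by linarith only [sq_nonneg (D1 S.a t x), sq_nonneg (D2 S.a t x)])
    sa1 := ia _ (by linarith only [sq_nonneg (S.a t x), sq_nonneg (D2 S.a t x)])
    sa2 := ia _ (by linarith only [sq_nonneg (D1 S.a t x), sq_nonneg (S.a t x)])
    sv := hs' _ iv
    sw := hs' _ iw
    sb := hs' _ ib
    sv1 := hs' _ iv1
    sv2 := hs' _ iv2
    sw1 := hs' _ iw1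
    sw2 := hs' _ iw2
    sb1 := hs' _ ib1
    sb2 := hs' _ ib2
    iv := iv
    iw := iw
    ib := ib
    iv1 := iv1
    iv2 := iv2
    iw1 := iw1
    iw2 := iw2
    ib1 := ib1
    ib2 := ib2 }

def e1 : Fld := (μ/2) • S.gψ + (lam/2) • (S.d * S.d) + (κ/2) • S.gb - ε⁻¹ • (S.Q * S.d)
def X1 : Fld := μ • (D1 S.v * Dt S.v + D1 S.w * Dt S.w) + lam • (S.d * Dt S.v) + κ • (D1 S.b * Dt S.b)
  - ε⁻¹ • (S.Q * Dt S.v)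
def Z1 : Fld := μ • (D2 S.v * Dt S.v + D2 S.w * Dt S.w) + lam • (S.d * Dt S.w) + κ • (D2 S.b * Dt S.b)
  - ε⁻¹ • (S.Q * Dt S.w)
def pt : Fld := Dt S.v * Dt S.v + Dt S.w * Dt S.w + Dt S.b * Dt S.b
instance : SM S.e1 := by unfold e1; infer_instance
instance : SM S.X1 := by unfold X1; infer_instance
instance : SM S.Z1 := by unfold Z1; infer_instance
instance : SM S.pt := by unfold pt; infer_instance
instance : PER S.X1 := by unfold X1; infer_instance

theorem L1_id (hε : ε ≠ 0) {t : ℝ} (ht : t ∈ Set.Icc 0 T) {x : ℝ × ℝ} (hx : x ∈ Ω)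
    {a v w b Θ R v1 v2 w1 w2 b1 b2 a1 a2 vt wt bt Θ2 R2 y : ℝ}
    (ea : S.a t x = a) (ev : S.v t x = v) (ew : S.w t x = w) (eb : S.b t x = b)
    (eΘ : S.Θ t x = Θ) (eR : S.R t x = R) (ey : Yf t x = y)
    (ev1 : D1 S.v t x = v1) (ev2 : D2 S.v t x = v2)
    (ew1 : D1 S.w t x = w1) (ew2 : D2 S.w t x = w2)
    (eb1 : D1 S.b t x = b1) (eb2 : D2 S.b t x = b2)
    (ea1 : D1 S.a t x = a1) (ea2 : D2 S.a t x = a2)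
    (evt : Dt S.v t x = vt) (ewt : Dt S.w t x = wt) (ebt : Dt S.b t x = bt)
    (eΘ2 : D2 S.Θ t x = Θ2) (eR2 : D2 S.R t x = R2) :
    Dt S.e1 t x = D1 S.X1 t x + D2 S.Z1 t x + (
      - (R+ε*a)*vt^2 - ((R+ε*a)*((y+v)*v1+w*v2+w))*vt
      - (R+ε*a)*wt^2 - ((R+ε*a)*((y+v)*w1+w*w2))*wt
      - g1*(R+ε*a)*bt^2 - (g1*((R+ε*a)*((y+v)*b1+w*b2+ε⁻¹*Θ2*w)) + (R+ε*a)*(Θ+ε*b)*(ε⁻¹*v1+ε⁻¹*w2)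
        - (2*μ*(ε*v1*v1+ε*w2*w2+1/2*((ε*w1+ε*v2)*(w1+v2))) + 2*μ*(ε*(w1+v2)) + r*μ*((ε*v1+ε*w2)*(v1+w2)))
        + (R+ε*a)*(ε⁻¹*v1+ε⁻¹*w2))*bt
      + (Θ+ε*b)*(ε⁻¹*v1+ε⁻¹*w2)*((y+v)*a1+w*a2 + (R+ε*a)*(ε⁻¹*v1+ε⁻¹*w2) + ε⁻¹*R2*w)) := by
  have hm := S.mass t ht x hx
  have h1 := S.mom1 t ht x hx
  have h2 := S.mom2 t ht x hx
  have h3 := S.energy t ht x hx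
  simp only [d1_add, d2_add, dt_add, d1_sub, d2_sub, dt_sub, d1_mul, d2_mul, dt_mul, d1_neg, d2_neg,
    dt_neg, d1_smul, d2_smul, dt_smul, d21, dt1, dt2, D1_Yf, D2_Yf, Dt_Yf, S.Θt, S.Θ1, S.Rt, S.R1,
    e1, X1, Z1, gψ, gb, Sys.ρ, Sys.d, Q] at *
  simp only [Pi.add_apply, Pi.mul_apply, Pi.sub_apply, Pi.neg_apply, Pi.smul_apply, smul_eq_mul,
    Pi.zero_apply, ea, ev, ew, eb, eΘ, eR, ev1, ev2, ew1, ew2, eb1, eb2, eΘ2, eR2, ey, evt, ewt, ebt, ea1, ea2] at *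
  generalize D1 (D1 S.v) t x = v11 at *
  generalize D1 (D2 S.v) t x = v12 at *
  generalize D2 (D2 S.v) t x = v22 at *
  generalize D1 (D1 S.w) t x = w11 at *
  generalize D1 (D2 S.w) t x = w12 at *
  generalize D2 (D2 S.w) t x = w22 at *
  generalize D1 (D1 S.b) t x = b11 at *
  generalize D2 (D2 S.b) t x = b22 at *
  generalize Dt (S.a) t x = at_ at *
  linear_combination (norm := (field_simp; ring)) (-ε⁻¹*ε⁻¹*(Θ+ε*b)*(v1+w2))*hm + vt*h1+wt*h2+bt*h3
end Sys

/-- remainder bound at level one -/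
theorem L1_real (M μ g1 r : ℝ) (hM : 1 ≤ M) (hμ : 0 < μ) (hg : 0 < g1) : ∃ c C : ℝ, 0 < c ∧ 0 < C ∧
    ∀ {ε s a v w b Θ R v1 v2 w1 w2 b1 b2 a1 a2 vt wt bt Θ2 R2 R22 y : ℝ},
    PtB M ε s y a v w b Θ R v1 v2 w1 w2 b1 b2 a1 a2 Θ2 R2 R22 →
      - (R+ε*a)*vt^2 - ((R+ε*a)*((y+v)*v1+w*v2+w))*vt
      - (R+ε*a)*wt^2 - ((R+ε*a)*((y+v)*w1+w*w2))*wt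
      - g1*(R+ε*a)*bt^2 - (g1*((R+ε*a)*((y+v)*b1+w*b2+ε⁻¹*Θ2*w)) + (R+ε*a)*(Θ+ε*b)*(ε⁻¹*v1+ε⁻¹*w2)
        - (2*μ*(ε*v1*v1+ε*w2*w2+1/2*((ε*w1+ε*v2)*(w1+v2))) + 2*μ*(ε*(w1+v2)) + r*μ*((ε*v1+ε*w2)*(v1+w2)))
        + (R+ε*a)*(ε⁻¹*v1+ε⁻¹*w2))*bt
      + (Θ+ε*b)*(ε⁻¹*v1+ε⁻¹*w2)*((y+v)*a1+w*a2 + (R+ε*a)*(ε⁻¹*v1+ε⁻¹*w2) + ε⁻¹*R2*w)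
      ≤ - c * (vt^2+wt^2+bt^2) + C * s^2 := by
  set B1 := 3/2*(1+M+M+1) with hB1
  set B2 := 3/2*(1+M+M) with hB2
  set B3 := g1*(3/2*(1+M+M+M)) + 3/2*(3/2)*(1+1) + (2*μ*(M+M+1/2*((M+M)*(1+1)))+2*μ*(1*(1+1)) + |r| *μ*((M+M)*(1+1))) + 3/2*(1+1) with hB3
  set B4 := 3/2*(1+1)*(1+M+M+3/2*(1+1)+M) with hB4
  refine ⟨min (1/4) (g1/4), B1^2+B2^2+B3^2/g1+B4, by positivity, by positivity, ?_⟩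
  intro ε s a v w b Θ R v1 v2 w1 w2 b1 b2 a1 a2 vt wt bt Θ2 R2 R22 y h
  have aε : |ε| ≤ 1 := by rw [abs_of_pos h.e0]; exact h.e1
  have dd := Couette.ba h.iv1 h.iw2
  have f1 := bm h.hρ (ba (ba (bm h.hU h.sv1) (bm h.hw h.sv2)) h.sw)
  have f2 := bm h.hρ (ba (bm h.hU h.sw1) (bm h.hw h.sw2))
  have f3a := bc hg.le (bm h.hρ (ba (ba (bm h.hU h.sb1) (bm h.hw h.sb2)) (bm h.hΘ2 h.sw)))
  have f3b := bm (bm h.hρ h.hτ) dd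
  have f3c := bc (by positivity : 0 ≤ 2*μ) (ba (ba (bm h.kv1 h.sv1) (bm h.kw2 h.sw2)) (bc (by norm_num : (0:ℝ) ≤ 1/2) (bm (ba h.kw1 h.kv2) (ba h.sw1 h.sv2))))
  have f3d := bc (by positivity : 0 ≤ 2*μ) (bm aε (ba h.sw1 h.sv2))
  have hrμ : |r*μ| ≤ |r| *μ := by rw [abs_mul, abs_of_pos hμ]
  have f3e := bm hrμ (bm (ba h.kv1 h.kw2) (ba h.sv1 h.sw2))
  have f3 := ba (bs (ba f3a f3b) (ba (ba f3c f3d) f3e)) (bm h.hρ dd)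
  have f4 := bm (bm h.hτ dd) (ba (ba (ba (bm h.hU h.sa1) (bm h.hw h.sa2)) (bm h.hρ dd)) (bm h.hR2 h.sw))
  have y1 := ya (p := -vt) (show (0:ℝ) < 1/4 by norm_num) f1
  have y2 := ya (p := -wt) (show (0:ℝ) < 1/4 by norm_num) f2
  have y3 := ya (p := -bt) (show (0:ℝ) < g1/4 by positivity) f3
  have y4 := (le_abs_self _).trans f4
  have r1 := mul_le_mul_of_nonneg_right h.ρl (sq_nonneg vt)
  have r2 := mul_le_mul_of_nonneg_right h.ρl (sq_nonneg wt)
  have r3 := mul_le_mul_of_nonneg_left h.ρl (mul_nonneg hg.le (sq_nonneg bt))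
  have m1 := mul_le_mul_of_nonneg_right (min_le_left (1/4) (g1/4)) (sq_nonneg vt)
  have m2 := mul_le_mul_of_nonneg_right (min_le_left (1/4) (g1/4)) (sq_nonneg wt)
  have m3 := mul_le_mul_of_nonneg_right (min_le_right (1/4) (g1/4)) (sq_nonneg bt)
  generalize (R+ε*a)*((y+v)*v1+w*v2+w) = F1 at *
  generalize (R+ε*a)*((y+v)*w1+w*w2) = F2 at *
  generalize (g1*((R+ε*a)*((y+v)*b1+w*b2+ε⁻¹*Θ2*w)) + (R+ε*a)*(Θ+ε*b)*(ε⁻¹*v1+ε⁻¹*w2)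
        - (2*μ*(ε*v1*v1+ε*w2*w2+1/2*((ε*w1+ε*v2)*(w1+v2))) + 2*μ*(ε*(w1+v2)) + r*μ*((ε*v1+ε*w2)*(v1+w2)))
        + (R+ε*a)*(ε⁻¹*v1+ε⁻¹*w2)) = F3 at *
  generalize (Θ+ε*b)*(ε⁻¹*v1+ε⁻¹*w2)*((y+v)*a1+w*a2 + (R+ε*a)*(ε⁻¹*v1+ε⁻¹*w2) + ε⁻¹*R2*w) = F4 at *
  have E1 : (3 / 2 * ((1 + M) * s + M * s + s)) ^ 2 / (4*(1/4)) = B1^2*s^2 := by rw [hB1]; ring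
  have E2 : (3 / 2 * ((1 + M) * s + M * s)) ^ 2 / (4*(1/4)) = B2^2*s^2 := by rw [hB2]; ring
  have E3 : (g1 * (3 / 2 * ((1 + M) * s + M * s + M * s)) + 3 / 2 * (3 / 2) * (s + s) +
            (2 * μ * (M * s + M * s + 1 / 2 * ((M + M) * (s + s))) + 2 * μ * (1 * (s + s)) +
              |r| * μ * ((M + M) * (s + s))) + 3 / 2 * (s + s)) ^ 2 / (4 * (g1 / 4)) = B3^2/g1*s^2 := by
    rw [hB3]; field_simp
  have E4 : 3 / 2 * (s + s) * ((1 + M) * s + M * s + 3 / 2 * (s + s) + M * s) = B4*s^2 := by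
    rw [hB4]; ring
  rw [E1] at y1
  rw [E2] at y2
  rw [E3] at y3
  rw [E4] at y4
  linarith only [y1, y2, y3, y4, r1, r2, r3, m1, m2, m3]

namespace Sys
theorem L1 (μ lam κ g1 r M : ℝ) (hM : 1 ≤ M) (hμ : 0 < μ) (hg : 0 < g1) : ∃ c C : ℝ, 0 < c ∧ 0 < C ∧
    ∀ {ε T : ℝ} (S : Sys μ lam κ g1 r M ε T), 0 < ε → M * ε ≤ 1/16 → ∀ t ∈ Set.Ioo 0 T,
    J (Dt S.e1) t ≤ -c * J S.pt t + C * J S.sF t := by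
  obtain ⟨c, C, hc, hC, H⟩ := L1_real M μ g1 r hM hμ hg
  refine ⟨c, C, hc, hC, ?_⟩
  intro ε T S h0 hε t ht
  have ht' : t ∈ Set.Icc 0 T := Set.Ioo_subset_Icc_self ht
  have bd : ∀ (f : Fld), SM f → (∀ t ∈ Set.Icc 0 T, ∀ x : ℝ × ℝ, (x.2 = 0 ∨ x.2 = 1) → f t x = 0) →
      ∀ x : ℝ × ℝ, (x.2 = 0 ∨ x.2 = 1) → Dt f t x = 0 := by
    intro f hf h x hx
    have : (fun s => f s x) =ᶠ[𝓝 t] fun _ => (0:ℝ) := by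
      filter_upwards [Icc_mem_nhds ht.1 ht.2] with s hs using h s hs x hx
    show deriv (fun s => f s x) t = 0
    rw [this.deriv_eq]; simp
  have hZ : ∀ x : ℝ × ℝ, (x.2 = 0 ∨ x.2 = 1) → S.Z1 t x = 0 := by
    intro x hx
    simp [Z1, bd S.v S.sv S.cv x hx, bd S.w S.sw S.cw x hx, bd S.b S.sb S.cb x hx]
  have h := J_div (e := Dt S.e1) (X := S.X1) (Z := S.Z1) (B := (-c) • S.pt + C • S.sF) (t := t) hZ
    (fun x hx => by
      rw [S.L1_id h0.ne' ht' hx rfl rfl rfl rfl rfl rfl rfl rfl rfl rfl rfl rfl rfl rfl rfl rfl rfl rfl rfl rfl]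
      have := H (vt := Dt S.v t x) (wt := Dt S.w t x) (bt := Dt S.b t x) (S.ptB hM h0 hε ht' hx)
      refine add_le_add le_rfl (this.trans (le_of_eq ?_))
      rw [Real.sq_sqrt (S.sF0 t x)]
      simp only [pt, Pi.add_apply, Pi.mul_apply, Pi.sub_apply, Pi.smul_apply, smul_eq_mul]
      ring)
  simpa only [J_add_eq, J_smul_eq] using h
end Sys

/-- tangential derivative vanishes on the boundary -/
theorem bd1 {f : Fld} {t : ℝ} (h : ∀ x : ℝ × ℝ, (x.2 = 0 ∨ x.2 = 1) → f t x = 0) [SM f] :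
    ∀ x : ℝ × ℝ, (x.2 = 0 ∨ x.2 = 1) → D1 f t x = 0 := by
  intro x hx
  have h1 := slice1 (f := f) SM.out t x.1 x.2
  have h2 : (fun s => f t (s, x.2)) = fun _ => (0:ℝ) := by
    funext s; exact h _ hx
  rw [h2] at h1
  exact h1.unique (hasDerivAt_const _ _)

namespace Sys
variable {μ lam κ g1 r M ε T : ℝ} (S : Sys μ lam κ g1 r M ε T)

theorem R12 : D1 (D2 S.R) = 0 := by rw [← d21, S.R1, D2_zero]
theorem Θ12 : D1 (D2 S.Θ) = 0 := by rw [← d21, S.Θ1, D2_zero]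
def e2 : Fld := (1/2:ℝ) • (D1 S.a * D1 S.a)
def X2 : Fld := (-1/2:ℝ) • ((Yf + S.v) * (D1 S.a * D1 S.a)) - ε⁻¹ • (S.Q * D1 (D2 S.w))
  + μ • (D1 (D2 S.v) * D2 S.v + D1 (D2 S.w) * D2 S.w) + lam • (S.d * D1 (D2 S.w))
def Z2 : Fld := (-1/2:ℝ) • (S.w * (D1 S.a * D1 S.a)) + ε⁻¹ • (S.Q * D1 (D1 S.w))
  - μ • (D1 (D1 S.v) * D2 S.v + D1 (D1 S.w) * D2 S.w) - lam • (S.d * D1 (D1 S.w))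
def N : Fld := D1 (D1 S.v) * D1 (D1 S.v) + D1 (D2 S.v) * D1 (D2 S.v) + D1 (D1 S.w) * D1 (D1 S.w)
  + D1 (D2 S.w) * D1 (D2 S.w)
instance : SM S.e2 := by unfold e2; infer_instance
instance : SM S.X2 := by unfold X2; infer_instance
instance : SM S.Z2 := by unfold Z2; infer_instance
instance : SM S.N := by unfold N; infer_instance
instance : PER S.X2 := by unfold X2; infer_instance

theorem L2_id (hε : ε ≠ 0) {t : ℝ} (ht : t ∈ Set.Icc 0 T) {x : ℝ × ℝ} (hx : x ∈ Ω)
    {a v w b Θ R v1 v2 w1 w2 b1 b2 a1 a2 vt wt v11 v12 w11 w12 Θ2 R2 y : ℝ}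
    (ea : S.a t x = a) (ev : S.v t x = v) (ew : S.w t x = w) (eb : S.b t x = b)
    (eΘ : S.Θ t x = Θ) (eR : S.R t x = R) (ey : Yf t x = y)
    (ev1 : D1 S.v t x = v1) (ev2 : D2 S.v t x = v2)
    (ew1 : D1 S.w t x = w1) (ew2 : D2 S.w t x = w2)
    (eb1 : D1 S.b t x = b1) (eb2 : D2 S.b t x = b2)
    (ea1 : D1 S.a t x = a1) (ea2 : D2 S.a t x = a2)
    (evt : Dt S.v t x = vt) (ewt : Dt S.w t x = wt)
    (ev11 : D1 (D1 S.v) t x = v11) (ev12 : D1 (D2 S.v) t x = v12)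
    (ew11 : D1 (D1 S.w) t x = w11) (ew12 : D1 (D2 S.w) t x = w12)
    (eΘ2 : D2 S.Θ t x = Θ2) (eR2 : D2 S.R t x = R2) :
    Dt S.e2 t x = D1 S.X2 t x + D2 S.Z2 t x + (
      - μ*(v11^2+v12^2+w11^2+w12^2) - lam*(v11+w12)^2
      + ((a - ε⁻¹*(R-(Θ+ε*b)) - a - a)*a1 + (R+ε*a)*(ε⁻¹*b1))*(v11+w12)
      + ((R+ε*a)*(vt+((y+v)*v1+w*v2+w)))*v11 + ((R+ε*a)*(wt+((y+v)*w1+w*w2)))*w11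
      - ε⁻¹*R2*a1*w1 + ε⁻¹*(((-1/2)*(ε*v1+ε*w2) - ε*v1)*(a1*a1) - (ε*w1)*(a1*a2))) := by
  have hm := (zero_on (S.mass t ht) hx).1
  have h1 := S.mom1 t ht x hx
  have h2 := S.mom2 t ht x hx
  simp only [d1_add, d2_add, dt_add, d1_sub, d2_sub, dt_sub, d1_mul, d2_mul, dt_mul, d1_neg, d2_neg,
    dt_neg, d1_smul, d2_smul, dt_smul, d21, dt1, dt2, D1_Yf, D2_Yf, Dt_Yf, S.Θt, S.Θ1, S.Rt, S.R1, S.R12, S.Θ12, D1_zero, D2_zero,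
    e2, X2, Z2, Sys.ρ, Sys.d, Q] at *
  simp only [Pi.add_apply, Pi.mul_apply, Pi.sub_apply, Pi.neg_apply, Pi.smul_apply, smul_eq_mul, Pi.one_apply,
    Pi.zero_apply, ea, ev, ew, eb, eΘ, eR, ev1, ev2, ew1, ew2, eb1, eb2, eΘ2, eR2, ey, evt, ewt, ea1, ea2,
    ev11, ev12, ew11, ew12] at *
  generalize D2 (D2 S.v) t x = v22 at *
  generalize D2 (D2 S.w) t x = w22 at *
  generalize D1 (D1 (D2 S.v)) t x = v112 at *
  generalize D1 (D1 (D2 S.w)) t x = w112 at *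
  generalize D1 (D2 (D2 S.w)) t x = w122 at *
  generalize D1 (D2 (D2 S.v)) t x = v122 at *
  generalize D1 (Dt (S.a)) t x = a1t at *
  generalize D1 (D1 (S.a)) t x = a11 at *
  generalize D1 (D2 (S.a)) t x = a12 at *
  linear_combination (norm := (field_simp; ring)) (ε⁻¹*a1)*hm - v11*h1-w11*h2
end Sys

/-- remainder bound at level two -/
theorem L2_real (M μ lam : ℝ) (hM : 1 ≤ M) (hμ : 0 < μ) (hl : 0 ≤ lam) : ∃ C : ℝ, 0 < C ∧
    ∀ {ε s a v w b Θ R v1 v2 w1 w2 b1 b2 a1 a2 vt wt v11 v12 w11 w12 Θ2 R2 R22 y : ℝ},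
    PtB M ε s y a v w b Θ R v1 v2 w1 w2 b1 b2 a1 a2 Θ2 R2 R22 →
      - μ*(v11^2+v12^2+w11^2+w12^2) - lam*(v11+w12)^2
      + ((a - ε⁻¹*(R-(Θ+ε*b)) - a - a)*a1 + (R+ε*a)*(ε⁻¹*b1))*(v11+w12)
      + ((R+ε*a)*(vt+((y+v)*v1+w*v2+w)))*v11 + ((R+ε*a)*(wt+((y+v)*w1+w*w2)))*w11
      - ε⁻¹*R2*a1*w1 + ε⁻¹*(((-1/2)*(ε*v1+ε*w2) - ε*v1)*(a1*a1) - (ε*w1)*(a1*a2))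
      ≤ - (μ/2) * (v11^2+v12^2+w11^2+w12^2) + C * (s^2 + (vt^2+wt^2)) + C * (ε⁻¹*(a1^2+a2^2)) := by
  set B1 := (M+3*M+M+M+3/2) with hB1
  set B2 := 3/2*(1+(1+M+M+1)) with hB2
  set B3 := 3/2*(1+(1+M+M)) with hB3
  refine ⟨B1^2*(2/μ) + 2*(B2^2*(2/μ))+2*(B3^2*(2/μ)) + 3*M, by positivity, ?_⟩
  intro ε s a v w b Θ R v1 v2 w1 w2 b1 b2 a1 a2 vt wt v11 v12 w11 w12 Θ2 R2 R22 y h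
  have hs := h.s0
  have f1 := ba (bm (bs (bs (bs h.ha h.hRτ) h.ha) h.ha) h.sa1) (bm h.hρ h.ib1)
  have svt : s ≤ s + |vt| := by linarith [abs_nonneg vt]
  have swt : s ≤ s + |wt| := by linarith [abs_nonneg wt]
  have vvt : |vt| ≤ s + |vt| := by linarith
  have wwt : |wt| ≤ s + |wt| := by linarith
  have f2 := bm h.hρ (ba vvt (ba (ba (bm h.hU (h.sv1.trans svt)) (bm h.hw (h.sv2.trans svt))) (h.sw.trans svt)))
  have f3 := bm h.hρ (ba wwt (ba (bm h.hU (h.sw1.trans swt)) (bm h.hw (h.sw2.trans swt))))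
  have f4 := bm (bm h.hR2 h.sa1) h.sw1
  have hei : 0 < ε⁻¹ := inv_pos.2 h.e0
  have a11 : |a1*a1| ≤ a1^2+a2^2 := by rw [abs_le]; constructor <;> linarith only [sq_nonneg a1, sq_nonneg a2]
  have a12 : |a1*a2| ≤ a1^2+a2^2 := by
    rw [abs_le]; constructor <;> linarith only [sq_nonneg a1, sq_nonneg a2, sq_nonneg (a1-a2), sq_nonneg (a1+a2)]
  have hhalf : |(-1/2 : ℝ)| ≤ 1/2 := by rw [abs_le]; constructor <;> norm_num
  have f5 := bc hei.le (bs (bm (bs (bm hhalf (ba h.kv1 h.kw2)) h.kv1) a11) (bm h.kw1 a12))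
  have y1 := ya (p := v11+w12) (show (0:ℝ) < μ/8 by positivity) f1
  have y2 := ya (p := v11) (show (0:ℝ) < μ/8 by positivity) f2
  have y3 := ya (p := w11) (show (0:ℝ) < μ/8 by positivity) f3
  have y4 := (neg_abs_le _).trans' (neg_le_neg f4)
  have y5 := (le_abs_self _).trans f5
  generalize ((a - ε⁻¹*(R-(Θ+ε*b)) - a - a)*a1 + (R+ε*a)*(ε⁻¹*b1)) = F1 at *
  generalize ((R+ε*a)*(vt+((y+v)*v1+w*v2+w))) = F2 at *
  generalize ((R+ε*a)*(wt+((y+v)*w1+w*w2))) = F3 at *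
  generalize ε⁻¹*(((-1/2)*(ε*v1+ε*w2) - ε*v1)*(a1*a1) - (ε*w1)*(a1*a2)) = F5 at *
  generalize ε⁻¹*R2*a1*w1 = F4 at *
  have E1 : ((M + 3 * M + M + M) * s + 3 / 2 * s) ^ 2 / (4 * (μ / 8)) = B1^2*(2/μ)*s^2 := by
    rw [hB1]; field_simp; ring
  have E2 : (3 / 2 * (s + |vt| + ((1 + M) * (s + |vt|) + M * (s + |vt|) + (s + |vt|)))) ^ 2 / (4 * (μ / 8)) = B2^2*(2/μ)*(s + |vt|)^2 := by
    rw [hB2]; field_simp; ring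
  have E3 : (3 / 2 * (s + |wt| + ((1 + M) * (s + |wt|) + M * (s + |wt|)))) ^ 2 / (4 * (μ / 8)) = B3^2*(2/μ)*(s + |wt|)^2 := by
    rw [hB3]; field_simp; ring
  rw [E1] at y1
  rw [E2] at y2
  rw [E3] at y3
  have s2 : (s+|vt|)^2 ≤ 2*(s^2+(vt^2+wt^2)) := by
    linarith only [sq_abs vt, sq_nonneg (s-|vt|), sq_nonneg wt]
  have s3 : (s+|wt|)^2 ≤ 2*(s^2+(vt^2+wt^2)) := by
    linarith only [sq_abs wt, sq_nonneg (s-|wt|), sq_nonneg vt]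
  have t2 := mul_le_mul_of_nonneg_left s2 (show 0 ≤ B2^2*(2/μ) by positivity)
  have t3 := mul_le_mul_of_nonneg_left s3 (show 0 ≤ B3^2*(2/μ) by positivity)
  have n1 : 0 ≤ B1^2*(2/μ) * (vt^2+wt^2) := by positivity
  have n2 : 0 ≤ M * (vt^2+wt^2) := by positivity
  have n3 : 0 ≤ (B1^2*(2/μ) + 2*(B2^2*(2/μ))+2*(B3^2*(2/μ))) * (ε⁻¹*(a1^2+a2^2)) := by positivity
  have n4 : 0 ≤ M * s^2 := by positivity
  have n5 : 0 ≤ lam*(v11+w12)^2 := by positivity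
  have n6 := mul_nonneg hμ.le (sq_nonneg (v11-w12))
  have n7 := mul_nonneg hμ.le (sq_nonneg v12)
  have n8 := mul_nonneg hμ.le (sq_nonneg w11)
  have n9 := mul_nonneg hμ.le (sq_nonneg v11)
  have n10 := mul_nonneg hμ.le (sq_nonneg w12)
  generalize B1^2*(2/μ) = K1 at *
  generalize B2^2*(2/μ) = K2 at *
  generalize B3^2*(2/μ) = K3 at *
  generalize ε⁻¹ = ei at *
  linarith only [y1, y2, y3, y4, y5, t2, t3, n1, n2, n3, n4, n5, n6, n7, n8, n9, n10]

namespace Sys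
theorem L2 (μ lam κ g1 r M : ℝ) (hM : 1 ≤ M) (hμ : 0 < μ) (hl : 0 ≤ lam) : ∃ C : ℝ, 0 < C ∧
    ∀ {ε T : ℝ} (S : Sys μ lam κ g1 r M ε T), 0 < ε → M * ε ≤ 1/16 → ∀ t ∈ Set.Icc 0 T,
    J (Dt S.e2) t ≤ -(μ/2) * J S.N t + C * (J S.sF t + J S.pt t) + C * (ε⁻¹ * J S.ga t) := by
  obtain ⟨C, hC, H⟩ := L2_real M μ lam hM hμ hl
  refine ⟨C, hC, ?_⟩
  intro ε T S h0 hε t ht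
  have hZ : ∀ x : ℝ × ℝ, (x.2 = 0 ∨ x.2 = 1) → S.Z2 t x = 0 := by
    intro x hx
    simp [Z2, S.cw t ht x hx, bd1 (bd1 (S.cv t ht)) x hx, bd1 (bd1 (S.cw t ht)) x hx]
  have h := J_div (e := Dt S.e2) (X := S.X2) (Z := S.Z2)
    (B := (-(μ/2)) • S.N + C • (S.sF + S.pt) + C • (ε⁻¹ • S.ga)) (t := t) hZ
    (fun x hx => by
      rw [S.L2_id h0.ne' ht hx rfl rfl rfl rfl rfl rfl rfl rfl rfl rfl rfl rfl rfl rfl rfl rfl rfl rfl rfl rfl rfl rfl rfl]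
      have := H (vt := Dt S.v t x) (wt := Dt S.w t x) (v11 := D1 (D1 S.v) t x) (v12 := D1 (D2 S.v) t x)
        (w11 := D1 (D1 S.w) t x) (w12 := D1 (D2 S.w) t x) (S.ptB hM h0 hε ht hx)
      refine add_le_add le_rfl (this.trans ?_)
      rw [Real.sq_sqrt (S.sF0 t x)]
      simp only [pt, N, ga, Pi.add_apply, Pi.mul_apply, Pi.sub_apply, Pi.smul_apply, smul_eq_mul]
      have := mul_nonneg hC.le (mul_self_nonneg (Dt S.b t x))
      linarith only [this])
  simpa only [J_add_eq, J_smul_eq] using h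
end Sys

namespace Sys
variable {μ lam κ g1 r M ε T : ℝ} (S : Sys μ lam κ g1 r M ε T)

def e3 : Fld := (1/2:ℝ) • (D2 S.a * D2 S.a)
def X3 : Fld := (-1/2:ℝ) • ((Yf + S.v) * (D2 S.a * D2 S.a))
def Z3 : Fld := (-1/2:ℝ) • (S.w * (D2 S.a * D2 S.a))
instance : SM S.e3 := by unfold e3; infer_instance
instance : SM S.X3 := by unfold X3; infer_instance
instance : SM S.Z3 := by unfold Z3; infer_instance
instance : PER S.X3 := by unfold X3; infer_instance

theorem L3_id (hε : ε ≠ 0) (hν : μ + lam ≠ 0) {t : ℝ} (ht : t ∈ Set.Icc 0 T) {x : ℝ × ℝ} (hx : x ∈ Ω)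
    {a v w b Θ R v1 v2 w1 w2 b1 b2 a1 a2 wt v12 w11 Θ2 R2 R22 y : ℝ}
    (ea : S.a t x = a) (ev : S.v t x = v) (ew : S.w t x = w) (eb : S.b t x = b)
    (eΘ : S.Θ t x = Θ) (eR : S.R t x = R) (ey : Yf t x = y)
    (ev1 : D1 S.v t x = v1) (ev2 : D2 S.v t x = v2)
    (ew1 : D1 S.w t x = w1) (ew2 : D2 S.w t x = w2)
    (eb1 : D1 S.b t x = b1) (eb2 : D2 S.b t x = b2)
    (ea1 : D1 S.a t x = a1) (ea2 : D2 S.a t x = a2)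
    (ewt : Dt S.w t x = wt)
    (ev12 : D1 (D2 S.v) t x = v12)
    (ew11 : D1 (D1 S.w) t x = w11)
    (eΘ2 : D2 S.Θ t x = Θ2) (eR2 : D2 S.R t x = R2) (eR22 : D2 (D2 S.R) t x = R22) :
    Dt S.e3 t x = D1 S.X3 t x + D2 S.Z3 t x + (
      - (R+ε*a)*(Θ+ε*b)*(μ+lam)⁻¹*(ε⁻¹*a2)^2
      - ((μ+lam)⁻¹*((R+ε*a)*((R+ε*a)*(ε⁻¹*b2)+(ε⁻¹*R2)*b+(ε⁻¹*Θ2)*a+(R+ε*a)*(wt+((y+v)*w1+w*w2))-μ*w11+μ*v12)))*(ε⁻¹*a2)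
      - a2*(ε⁻¹*R2*(v1+w2) + ε⁻¹*R2*w2 + ε⁻¹*R22*w)
      + ε⁻¹*(((-1/2)*(ε*v1+ε*w2) - ε*w2)*(a2*a2) - (ε+ε*v2)*(a1*a2))) := by
  have hm := (zero_on (S.mass t ht) hx).2
  have h2 := S.mom2 t ht x hx
  simp only [d1_add, d2_add, dt_add, d1_sub, d2_sub, dt_sub, d1_mul, d2_mul, dt_mul, d1_neg, d2_neg,
    dt_neg, d1_smul, d2_smul, dt_smul, d21, dt1, dt2, D1_Yf, D2_Yf, Dt_Yf, S.Θt, S.Θ1, S.Rt, S.R1, S.R12, S.Θ12, D1_zero, D2_zero,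
    e3, X3, Z3, Sys.ρ, Sys.d, Q] at *
  simp only [Pi.add_apply, Pi.mul_apply, Pi.sub_apply, Pi.neg_apply, Pi.smul_apply, smul_eq_mul, Pi.one_apply,
    Pi.zero_apply, ea, ev, ew, eb, eΘ, eR, ev1, ev2, ew1, ew2, eb1, eb2, eΘ2, eR2, eR22, ey, ewt, ea1, ea2,
    ev12, ew11] at *
  generalize D2 (D2 S.w) t x = w22 at *
  generalize D2 (Dt (S.a)) t x = a2t at *
  generalize D2 (D2 (S.a)) t x = a22 at *
  generalize D1 (D2 (S.a)) t x = a12 at *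
  linear_combination (norm := (field_simp; ring)) (ε⁻¹*a2)*hm + ((μ+lam)⁻¹*(R+ε*a)*(ε⁻¹*a2))*h2
end Sys

/-- remainder bound at level three -/
theorem L3_real (M μ lam : ℝ) (hM : 1 ≤ M) (hμ : 0 < μ) (hl : 0 ≤ lam) : ∃ c C : ℝ, 0 < c ∧ 0 < C ∧
    ∀ {ε s a v w b Θ R v1 v2 w1 w2 b1 b2 a1 a2 wt v12 w11 Θ2 R2 R22 y : ℝ},
    PtB M ε s y a v w b Θ R v1 v2 w1 w2 b1 b2 a1 a2 Θ2 R2 R22 →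
      - (R+ε*a)*(Θ+ε*b)*(μ+lam)⁻¹*(ε⁻¹*a2)^2
      - ((μ+lam)⁻¹*((R+ε*a)*((R+ε*a)*(ε⁻¹*b2)+(ε⁻¹*R2)*b+(ε⁻¹*Θ2)*a+(R+ε*a)*(wt+((y+v)*w1+w*w2))-μ*w11+μ*v12)))*(ε⁻¹*a2)
      - a2*(ε⁻¹*R2*(v1+w2) + ε⁻¹*R2*w2 + ε⁻¹*R22*w)
      + ε⁻¹*(((-1/2)*(ε*v1+ε*w2) - ε*w2)*(a2*a2) - (ε+ε*v2)*(a1*a2))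
      ≤ - c * (ε⁻¹*a2)^2 + C * (s^2 + wt^2 + w11^2 + v12^2) + C * (ε⁻¹*(a1^2+a2^2)) := by
  set ν := (μ+lam)⁻¹ with hν
  have hν0 : 0 < ν := by positivity
  set B1 := ν*(3/2*(3/2+M+M+3/2*(1+(1+M+M))+μ+μ)) with hB1
  set B2 := M*(1+1)+M+M with hB2
  set B3 := 1/2*(M+M)+M+(1+M) with hB3
  refine ⟨ν/8, 4*(B1^2*(2/ν)) + B2 + B3, by positivity, by positivity, ?_⟩
  intro ε s a v w b Θ R v1 v2 w1 w2 b1 b2 a1 a2 wt v12 w11 Θ2 R2 R22 y h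
  have hs := h.s0
  have aε : |ε| ≤ 1 := by rw [abs_of_pos h.e0]; exact h.e1
  set q := s + |wt| + |w11| + |v12| with hq
  have n1 := abs_nonneg wt
  have n2 := abs_nonneg w11
  have n3 := abs_nonneg v12
  have q0 : s ≤ q := by rw [hq]; linarith
  have q1 : |wt| ≤ q := by rw [hq]; linarith
  have q2 : |w11| ≤ q := by rw [hq]; linarith
  have q3 : |v12| ≤ q := by rw [hq]; linarith
  have f1 := bc hν0.le (bm h.hρ (ba (bs (ba (ba (ba (bm h.hρ (h.ib2.trans q0)) (bm h.hR2 (h.sb.trans q0)))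
    (bm h.hΘ2 (h.sa.trans q0))) (bm h.hρ (ba q1 (ba (bm h.hU (h.sw1.trans q0)) (bm h.hw (h.sw2.trans q0))))))
    (bc hμ.le q2)) (bc hμ.le q3)))
  have f2 := bm h.sa2 (ba (ba (bm h.hR2 (ba h.sv1 h.sw2)) (bm h.hR2 h.sw2)) (bm h.hR22 h.sw))
  have hei : 0 < ε⁻¹ := inv_pos.2 h.e0
  have a22 : |a2*a2| ≤ a1^2+a2^2 := by rw [abs_le]; constructor <;> linarith only [sq_nonneg a1, sq_nonneg a2]
  have a12 : |a1*a2| ≤ a1^2+a2^2 := by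
    rw [abs_le]; constructor <;> linarith only [sq_nonneg a1, sq_nonneg a2, sq_nonneg (a1-a2), sq_nonneg (a1+a2)]
  have hhalf : |(-1/2 : ℝ)| ≤ 1/2 := by rw [abs_le]; constructor <;> norm_num
  have f3 := bc hei.le (bs (bm (bs (bm hhalf (ba h.kv1 h.kw2)) h.kw2) a22) (bm (ba aε h.kv2) a12))
  have y1 := ya (p := -(ε⁻¹*a2)) (show (0:ℝ) < ν/8 by positivity) f1
  have y2 := (neg_abs_le _).trans' (neg_le_neg f2)
  have y3 := (le_abs_self _).trans f3
  have ρτ : 1/4 ≤ (R+ε*a)*(Θ+ε*b) := by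
    have := mul_le_mul h.ρl h.τl (by norm_num) (by linarith only [h.ρl])
    linarith only [this]
  have y4 := mul_le_mul_of_nonneg_right ρτ (mul_nonneg hν0.le (sq_nonneg (ε⁻¹*a2)))
  generalize (ν*((R+ε*a)*((R+ε*a)*(ε⁻¹*b2)+(ε⁻¹*R2)*b+(ε⁻¹*Θ2)*a+(R+ε*a)*(wt+((y+v)*w1+w*w2))-μ*w11+μ*v12))) = F1 at *
  generalize a2*(ε⁻¹*R2*(v1+w2) + ε⁻¹*R2*w2 + ε⁻¹*R22*w) = F2 at *
  generalize ε⁻¹*(((-1/2)*(ε*v1+ε*w2) - ε*w2)*(a2*a2) - (ε+ε*v2)*(a1*a2)) = F3 at *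
  have E1 : (ν * (3 / 2 * (3 / 2 * q + M * q + M * q + 3 / 2 * (q + ((1 + M) * q + M * q)) + μ * q + μ * q))) ^ 2 / (4 * (ν / 8)) = B1^2*(2/ν)*q^2 := by
    rw [hB1]; field_simp; ring
  rw [E1] at y1
  have s2 : q^2 ≤ 4*(s^2+wt^2+w11^2+v12^2) := by
    rw [hq]
    linarith only [sq_abs wt, sq_abs w11, sq_abs v12, sq_nonneg (s-|wt|), sq_nonneg (s-|w11|), sq_nonneg (s-|v12|), sq_nonneg (|wt|-|w11|), sq_nonneg (|wt|-|v12|), sq_nonneg (|v12|-|w11|)]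
  have t2 := mul_le_mul_of_nonneg_left s2 (show 0 ≤ B1^2*(2/ν) by positivity)
  have E2 : s * (M * (s + s) + M * s + M * s) = B2*s^2 := by rw [hB2]; ring
  have E3 : ε⁻¹ * ((1 / 2 * (M + M) + M) * (a1 ^ 2 + a2 ^ 2) + (1 + M) * (a1 ^ 2 + a2 ^ 2)) = B3*(ε⁻¹ *(a1^2+a2^2)) := by
    rw [hB3]; ring
  rw [E2] at y2
  rw [E3] at y3
  have m1 : 0 ≤ (4*(B1^2*(2/ν)) + B2) * (ε⁻¹*(a1^2+a2^2)) := by positivity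
  have m2 : 0 ≤ B2 * (wt^2+w11^2+v12^2) := by positivity
  have m3 : 0 ≤ B3 * (s^2+wt^2+w11^2+v12^2) := by positivity
  clear_value B1 B2 B3 ν q
  generalize B1^2*(2/ν) = K1 at *
  generalize ε⁻¹*(a1^2+a2^2) = A at *
  generalize ε⁻¹*a2 = z at *
  linarith only [y1, y2, y3, y4, t2, m1, m2, m3]

namespace Sys
theorem L3 (μ lam κ g1 r M : ℝ) (hM : 1 ≤ M) (hμ : 0 < μ) (hl : 0 ≤ lam) : ∃ c C : ℝ, 0 < c ∧ 0 < C ∧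
    ∀ {ε T : ℝ} (S : Sys μ lam κ g1 r M ε T), 0 < ε → M * ε ≤ 1/16 → ∀ t ∈ Set.Icc 0 T,
    J (Dt S.e3) t ≤ -c * (ε⁻¹ * ε⁻¹ * J (D2 S.a * D2 S.a) t) + C * (J S.sF t + J S.pt t + J S.N t)
      + C * (ε⁻¹ * J S.ga t) := by
  obtain ⟨c, C, hc, hC, H⟩ := L3_real M μ lam hM hμ hl
  refine ⟨c, C, hc, hC, ?_⟩
  intro ε T S h0 hε t ht
  have hZ : ∀ x : ℝ × ℝ, (x.2 = 0 ∨ x.2 = 1) → S.Z3 t x = 0 := by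
    intro x hx
    simp [Z3, S.cw t ht x hx]
  have h := J_div (e := Dt S.e3) (X := S.X3) (Z := S.Z3)
    (B := (-c) • ((ε⁻¹*ε⁻¹) • (D2 S.a * D2 S.a)) + C • (S.sF + S.pt + S.N) + C • (ε⁻¹ • S.ga)) (t := t) hZ
    (fun x hx => by
      rw [S.L3_id h0.ne' (by positivity) ht hx rfl rfl rfl rfl rfl rfl rfl rfl rfl rfl rfl rfl rfl rfl rfl rfl rfl rfl rfl rfl rfl]
      have := H (wt := Dt S.w t x) (v12 := D1 (D2 S.v) t x)
        (w11 := D1 (D1 S.w) t x) (S.ptB hM h0 hε ht hx)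
      refine add_le_add le_rfl (this.trans ?_)
      rw [Real.sq_sqrt (S.sF0 t x)]
      simp only [pt, N, ga, Pi.add_apply, Pi.mul_apply, Pi.sub_apply, Pi.smul_apply, smul_eq_mul]
      have m1 := mul_nonneg hC.le (mul_self_nonneg (Dt S.b t x))
      have m2 := mul_nonneg hC.le (mul_self_nonneg (Dt S.v t x))
      have m3 := mul_nonneg hC.le (mul_self_nonneg (D1 (D1 S.v) t x))
      have m4 := mul_nonneg hC.le (mul_self_nonneg (D1 (D2 S.w) t x))
      linarith only [m1, m2, m3, m4])
  simpa only [J_add_eq, J_smul_eq] using h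
end Sys

/-- constant field -/
def cst (c : ℝ) : Fld := fun _ _ => c
instance (c : ℝ) : SM (cst c) := ⟨(contDiff_const : ContDiff ℝ _ fun _ : ℝ × ℝ × ℝ => c)⟩
instance (c : ℝ) : PER (cst c) := ⟨fun _ _ => rfl⟩
theorem D1_cst {c : ℝ} : D1 (cst c) = 0 := by
  ext t x; show fderiv ℝ (fun _ => c) x (1, 0) = 0; simp
theorem D2_cst {c : ℝ} : D2 (cst c) = 0 := by
  ext t x; show fderiv ℝ (fun _ => c) x (0, 1) = 0; simp

/-- sheared field -/
def sh (f : Fld) : Fld := fun t x => f t (x.1 + x.2 * (1 - x.2), x.2)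

theorem sh_sm {f : Fld} (hf : Sm f) : Sm (sh f) := by
  have : Function.uncurry (sh f) = Function.uncurry f ∘
      (fun z : ℝ × ℝ × ℝ => (z.1, (z.2.1 + z.2.2 * (1 - z.2.2), z.2.2))) := by ext z; rfl
  unfold Sm
  rw [this]
  exact ContDiff.comp hf (by fun_prop)
instance (f : Fld) [SM f] : SM (sh f) := ⟨sh_sm SM.out⟩
instance (f : Fld) [PER f] : PER (sh f) := ⟨fun t x => by
  have := PER.out (f := f) t (x.1 + x.2 * (1 - x.2), x.2)
  simp only [sh]
  rw [← this]
  congr 2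
  simp only; ring⟩

theorem sh_fderiv {f : Fld} (hf : Sm f) (t : ℝ) (x e : ℝ × ℝ) :
    fderiv ℝ (sh f t) x e = fderiv ℝ (f t) (x.1 + x.2 * (1 - x.2), x.2) (e.1 + (1 - 2 * x.2) * e.2, e.2) := by
  have h1 := ((hf.slice t).differentiable (by simp) (x.1 + x.2 * (1 - x.2), x.2)).hasFDerivAt
  have a1 : HasFDerivAt (fun y : ℝ × ℝ => y.1) (ContinuousLinearMap.fst ℝ ℝ ℝ) x := hasFDerivAt_fst
  have a2 : HasFDerivAt (fun y : ℝ × ℝ => y.2) (ContinuousLinearMap.snd ℝ ℝ ℝ) x := hasFDerivAt_snd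
  have h2 := (a1.add (a2.mul (a2.const_sub 1))).prodMk a2
  have h3 := HasFDerivAt.comp x h1 h2
  have h4 := congrArg (fun L => L e) h3.fderiv
  have h5 : (f t ∘ fun y : ℝ × ℝ => (y.1 + y.2 * (1 - y.2), y.2)) = sh f t := by ext y; rfl
  refine Eq.trans ?_ (h4.trans ?_)
  · rw [← h5]; rfl
  · show fderiv ℝ (f t) _ _ = _
    congr 1
    simp
    ring

theorem D1_sh {f : Fld} [SM f] : D1 (sh f) = sh (D1 f) := by
  ext t x
  show fderiv ℝ (sh f t) x (1, 0) = _
  rw [sh_fderiv SM.out]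
  show _ = fderiv ℝ (f t) _ (1, 0)
  simp
theorem D2_sh {f : Fld} [SM f] : D2 (sh f) = sh (D2 f) + (cst 1 - (2:ℝ) • Yf) * sh (D1 f) := by
  ext t x
  show fderiv ℝ (sh f t) x (0, 1) = fderiv ℝ (f t) _ (0, 1) + (1 - 2 * x.2) * fderiv ℝ (f t) _ (1, 0)
  rw [sh_fderiv SM.out]
  have e : ((((0:ℝ), (1:ℝ)).1 + (1 - 2 * x.2) * ((0:ℝ), (1:ℝ)).2, ((0:ℝ), (1:ℝ)).2) : ℝ × ℝ)
      = (0, 1) + (1 - 2 * x.2) • (1, 0) := by ext <;> simp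
  rw [e, map_add, map_smul, smul_eq_mul]

theorem J_sh (f : Fld) [SM f] [PER f] (t : ℝ) : J (sh f) t = J f t := by
  unfold J
  rw [int_fubini' ((SM.out (f := f)).contx t), int_fubini' ((SM.out (f := sh f)).contx t)]
  congr 1; ext x2
  show ∫ x1 in (0:ℝ)..(2 * π), f t (x1 + x2 * (1 - x2), x2) = _
  rw [intervalIntegral.integral_comp_add_right (fun s => f t (s, x2))]
  have hp : Function.Periodic (fun s => f t (s, x2)) (2 * π) := fun s => PER.out (f := f) t (s, x2)
  have := hp.intervalIntegral_add_eq (0 + x2 * (1 - x2)) 0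
  rw [zero_add] at this
  rw [zero_add, add_comm (2 * π), this]; simp

theorem J_ibp {e X Z B : Fld} [SM e] [SM X] [SM Z] [SM B] [PER X] {t : ℝ}
    (hZ : ∀ x : ℝ × ℝ, (x.2 = 0 ∨ x.2 = 1) → Z t x = 0)
    (h : ∀ x ∈ Ω, e t x = D1 X t x + D2 Z t x + B t x) : J e t = J B t := by
  refine le_antisymm (J_div hZ fun x hx => (h x hx).le) ?_
  refine J_div (X := -X) (Z := -Z) (fun x hx => by simp [hZ x hx]) fun x hx => ?_
  rw [d1_neg, d2_neg, h x hx]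
  simp only [Pi.neg_apply]; linarith

theorem J_le {e B : Fld} [SM e] [SM B] {t : ℝ} (h : ∀ x ∈ Ω, e t x ≤ B t x) : J e t ≤ J B t :=
  J_mono SM.out SM.out h

theorem yh {h x y δ : ℝ} (hh : |h| ≤ 1) (hδ : 0 < δ) : h * x * y ≤ δ * x ^ 2 + 1 / (4 * δ) * y ^ 2 := by
  have := yg (p := x) hh hδ (le_refl (y ^ 2))
  simpa using this

/-- tangential pressure estimate, mean-free version -/
theorem L4_core {Q f F : Fld} [SM Q] [SM f] [SM F] [PER Q] [PER f] {t μ : ℝ} (hμ : 0 < μ)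
    (h0 : J Q t = 0) (hE : ∀ x ∈ Ω, μ * D2 (D2 f) t x = D1 Q t x + F t x) :
    J (D1 Q * D1 Q) t ≤ 2 * ((100000000 * (1 + μ ^ 2))  * (J (D2 Q * D2 Q) t + J (D1 (D2 f) * D1 (D2 f)) t
      + J (D2 f * D2 f) t + J (F * F) t)) := by
  set Hf : Fld := Yf - Yf * Yf with hHf
  set Hp : Fld := cst 1 - (2:ℝ) • Yf with hHp
  set V : Fld := Q - sh Q with hV
  set W : Fld := D2 Q - sh (D2 Q) - Hp * sh (D1 Q) with hW
  have bd : ∀ x : ℝ × ℝ, (x.2 = 0 ∨ x.2 = 1) → V t x = 0 ∧ Hf t x = 0 ∧ D1 V t x = 0 := by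
    intro x hx
    have e : ∀ g : Fld, sh g t x = g t x := by
      intro g; rcases hx with h | h <;> simp [sh, h] <;> congr 1 <;> ext <;> simp [h]
    refine ⟨by simp [V, e], ?_, ?_⟩
    · rcases hx with h | h <;> simp [Hf, Yf, h]
    · simp [V, d1_sub, D1_sh, e]
  have X1 : J (sh (D1 Q) * sh (D1 Q)) t = J (D1 Q * D1 Q) t := J_sh (D1 Q * D1 Q) t
  have P1 : J (sh (D2 Q) * sh (D2 Q)) t = J (D2 Q * D2 Q) t := J_sh (D2 Q * D2 Q) t
  have hE' : J (Hp * Hp * (sh (D1 Q) * sh (D1 Q))) t = J (Hp * Hp * (D1 Q * D1 Q)) t :=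
    J_sh (Hp * Hp * (D1 Q * D1 Q)) t
  have hw := wirtinger Q h0
  have hpi : (2 * (2 * π) ^ 2) ≤ 100 := by nlinarith [Real.pi_lt_d2, Real.pi_pos]
  have hw' : J (Q * Q) t ≤ 100 * J (D1 Q * D1 Q) t + 2 * J (D2 Q * D2 Q) t := by
    have := mul_le_mul_of_nonneg_right hpi (J_sq_nonneg (D1 Q) t); linarith
  -- W bound
  have bw : J (W * W) t ≤ J ((3:ℝ) • (D2 Q * D2 Q + sh (D2 Q) * sh (D2 Q) + sh (D1 Q) * sh (D1 Q))) t := by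
    refine J_le fun x hx => ?_
    have hy1 := hx.2.1
    have hy2 := hx.2.2
    simp only [W, Hp, Pi.add_apply, Pi.mul_apply, Pi.sub_apply, Pi.smul_apply, smul_eq_mul, cst, Yf]
    generalize sh (D1 Q) t x = s1
    generalize sh (D2 Q) t x = s2
    generalize D2 Q t x = q2
    have hp : (1 - 2 * x.2) ^ 2 ≤ 1 := by nlinarith
    have := mul_le_mul_of_nonneg_right hp (sq_nonneg s1)
    nlinarith [sq_nonneg (q2 + s2), sq_nonneg (q2 + (1 - 2 * x.2) * s1), sq_nonneg (s2 - (1 - 2 * x.2) * s1)]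
  simp only [J_add_eq, J_smul_eq, X1, P1] at bw
  -- V1 estimate
  have Y1 : J (D1 V * D1 V) t = 2 * J (D1 V * D1 Q) t := by
    have : J (D1 V * D1 V) t = J ((2:ℝ) • (D1 V * D1 Q) + sh (D1 Q) * sh (D1 Q) - D1 Q * D1 Q) t := by
      refine J_congr fun x hx => ?_
      simp only [V, d1_sub, D1_sh, Pi.add_apply, Pi.mul_apply, Pi.sub_apply, Pi.smul_apply, smul_eq_mul]
      ring
    rw [this]; simp only [J_add_eq, J_sub_eq, J_smul_eq, X1]; ring
  have Y2 : J (D1 V * D1 Q) t ≤ J ((1/40000:ℝ) • (W * W) + (10000 * μ ^ 2) • (D1 (D2 f) * D1 (D2 f))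
      + (1/4:ℝ) • (D1 V * D1 V) + F * F) t := by
    refine J_div (X := (-μ) • (D2 f * W)) (Z := μ • (D2 f * D1 V)) (fun x hx => by simp [(bd x hx).2.2]) fun x hx => ?_
    have hq := hE x hx
    simp only [V, W, Hp, d1_sub, D1_sh, d2_sub, D2_sh, d1_mul, d2_mul, d1_smul, d2_smul, d1_add, d2_add, d21, D1_Yf, D2_Yf,
      D1_cst, D2_cst]
    simp only [Pi.add_apply, Pi.mul_apply, Pi.sub_apply, Pi.smul_apply, smul_eq_mul, cst, Yf, Pi.zero_apply, Pi.one_apply]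
    generalize sh (D1 Q) t x = s1
    generalize sh (D2 Q) t x = s2
    generalize D2 Q t x = q2
    generalize D1 Q t x = q1 at *
    generalize D2 (D2 f) t x = f22 at *
    generalize D1 (D2 f) t x = f12 at *
    generalize D2 f t x = f2 at *
    generalize F t x = ff at *
    generalize 1 - 2 * x.2 = h
    generalize sh (D1 (D2 Q)) t x = s12
    generalize sh (D1 (D1 Q)) t x = s11
    generalize D1 (D2 Q) t x = q12
    have hq1 : q1 = μ * f22 - ff := by linarith
    have E : (q1 - s1) * q1 = (q1 - s1) * (μ * f22 - ff) := by rw [← hq1]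
    have y1 := sq_nonneg ((q2 - s2 - h * s1) / 200 - 100 * μ * f12)
    have y2 := sq_nonneg ((q1 - s1) / 2 + ff)
    rw [E]
    nlinarith [y1, y2]
  simp only [J_add_eq, J_smul_eq] at Y2
  -- main
  have Z1 : J (D1 Q * D1 Q) t = J ((4:ℝ) • (Hf * (D1 Q * D1 Q)) + Hp * Hp * (sh (D1 Q) * sh (D1 Q))) t := by
    rw [J_add_eq, hE', ← J_add_eq]
    refine J_congr fun x hx => ?_
    simp only [Hf, Hp, Pi.add_apply, Pi.mul_apply, Pi.sub_apply, Pi.smul_apply, smul_eq_mul, cst, Yf]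
    ring
  have Z2 : J ((4:ℝ) • (Hf * (D1 Q * D1 Q)) + Hp * Hp * (sh (D1 Q) * sh (D1 Q))) t ≤
      J ((1/250:ℝ) • (D1 Q * D1 Q) + (2000 * μ ^ 2) • (D2 f * D2 f) + (D2 Q * D2 Q) + μ ^ 2 • (D1 (D2 f) * D1 (D2 f))
        + (125:ℝ) • (F * F) + (1/500:ℝ) • (sh (D1 Q) * sh (D1 Q)) + (250:ℝ) • (D2 Q * D2 Q + sh (D2 Q) * sh (D2 Q))
        + (1/500:ℝ) • (W * W) + (626:ℝ) • (D1 V * D1 V) + D2 Q * D2 Q + (1/500:ℝ) • (Q * Q)) t := by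
    refine J_div (X := (-(4 * μ)) • (Hf * (D2 Q * D2 f)) + Hp * (V * D2 Q) - (2:ℝ) • (V * Q))
      (Z := (4 * μ) • (Hf * (D1 Q * D2 f)) - Hp * (V * D1 Q))
      (fun x hx => by simp [(bd x hx).1, (bd x hx).2.1]) fun x hx => ?_
    have hq := hE x hx
    have hy1 := hx.2.1
    have hy2 := hx.2.2
    simp only [V, W, Hp, Hf, d1_sub, D1_sh, d2_sub, D2_sh, d1_mul, d2_mul, d1_smul, d2_smul, d1_add, d2_add, d21, D1_Yf, D2_Yf,
      D1_cst, D2_cst]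
    simp only [Pi.add_apply, Pi.mul_apply, Pi.sub_apply, Pi.smul_apply, smul_eq_mul, cst, Yf, Pi.zero_apply, Pi.one_apply]
    generalize sh (D1 Q) t x = s1
    generalize sh (D2 Q) t x = s2
    generalize sh Q t x = s
    generalize D2 Q t x = q2
    generalize D1 Q t x = q1 at *
    generalize D2 (D2 f) t x = f22 at *
    generalize D1 (D2 f) t x = f12 at *
    generalize D2 f t x = f2 at *
    generalize F t x = ff at *
    generalize D1 (D2 Q) t x = q12
    generalize Q t x = q
    generalize x.2 = y at *
    have hq1 : q1 = μ * f22 - ff := by linarith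
    have E : (y - y * y) * (q1 * q1) = (y - y * y) * (q1 * (μ * f22 - ff)) := by rw [← hq1]
    have b1 : |1 - 2 * y| ≤ 1 := by rw [abs_le]; constructor <;> linarith
    have b1' : |-(1 - 2 * y)| ≤ 1 := by rwa [abs_neg]
    have b2 : |4 * (y - y * y)| ≤ 1 := by
      rw [abs_le]; constructor <;> nlinarith [sq_nonneg (1 - 2 * y)]
    have b2' : |-(4 * (y - y * y))| ≤ 1 := by rwa [abs_neg]
    have i1 := yh (x := q1) (y := 4 * μ * f2) (δ := 1/500) b1' (by norm_num)
    have i2 := yh (x := q2) (y := μ * f12) (δ := 1) b2 (by norm_num)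
    have i3 := yh (x := q1) (y := ff) (δ := 1/500) b2' (by norm_num)
    have i4 := yh (x := s1) (y := q2 - s2) (δ := 1/500) b1 (by norm_num)
    have i5 := yh (x := q2 - s2 - (1 - 2 * y) * s1) (y := q1 - s1) (δ := 1/500) b1 (by norm_num)
    have i6 := yh (x := q1 - s1) (y := q2) (δ := 1) b1' (by norm_num)
    have i7 := yh (x := q) (y := 2 * (q1 - s1)) (δ := 1/500) (show |(1:ℝ)| ≤ 1 by simp) (by norm_num)
    norm_num at i1 i2 i3 i4 i5 i6 i7
    have e4 := sq_nonneg (q2 + s2)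
    have e5 : 0 ≤ (μ * f12) ^ 2 := sq_nonneg _
    rw [E]
    linarith only [i1, i2, i3, i4, i5, i6, i7, e4, e5, sq_nonneg q2]
  rw [← Z1] at Z2
  simp only [J_add_eq, J_smul_eq, X1, P1] at Z2
  have n1 := J_sq_nonneg (D2 Q) t
  have n2 := J_sq_nonneg (D1 (D2 f)) t
  have n3 := J_sq_nonneg (D2 f) t
  have n4 := J_sq_nonneg F t
  generalize J (D2 Q * D2 Q) t = P at *
  generalize J (D1 (D2 f) * D1 (D2 f)) t = G at *
  generalize J (D2 f * D2 f) t = K at *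
  generalize J (F * F) t = FF at *
  generalize J (D1 Q * D1 Q) t = X at *
  generalize J (D1 V * D1 V) t = Y at *
  generalize J (W * W) t = Z at *
  generalize J (D1 V * D1 Q) t = Y' at *
  generalize J (Q * Q) t = Q' at *
  have m1 := mul_nonneg (sq_nonneg μ) n1
  have m2 := mul_nonneg (sq_nonneg μ) n2
  have m3 := mul_nonneg (sq_nonneg μ) n3
  have m4 := mul_nonneg (sq_nonneg μ) n4
  linarith only [Z2, Y1, Y2, bw, hw', n1, n2, n3, n4, m1, m2, m3, m4]

theorem J_cst (c t : ℝ) : J (cst c) t = c * (2 * π) := by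
  have : J (cst c) t = _ := int_fubini (g := fun _ => c) continuous_const
  rw [this]; simp [mul_comm]

theorem L4_abs {Q f F : Fld} [SM Q] [SM f] [SM F] [PER Q] [PER f] {t μ : ℝ} (hμ : 0 < μ)
    (hE : ∀ x ∈ Ω, μ * D2 (D2 f) t x = D1 Q t x + F t x) :
    J (D1 Q * D1 Q) t ≤ 2 * ((100000000 * (1 + μ ^ 2))  * (J (D2 Q * D2 Q) t + J (D1 (D2 f) * D1 (D2 f)) t
      + J (D2 f * D2 f) t + J (F * F) t)) := by
  have hv := Real.pi_pos
  set c := J Q t / (2 * π) with hc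
  have e1 : D1 (Q - cst c) = D1 Q := by rw [d1_sub, D1_cst, sub_zero]
  have e2 : D2 (Q - cst c) = D2 Q := by rw [d2_sub, D2_cst, sub_zero]
  have := L4_core (Q := Q - cst c) (f := f) (F := F) (t := t) hμ
    (by rw [J_sub_eq, J_cst, hc]; field_simp; ring) (by rw [e1]; exact hE)
  rwa [e1, e2] at this

theorem bp {x y A B : ℝ} (hx : |x| ≤ A) (hy : |y| ≤ B) : |x + y| ≤ A + B := ba hx hy

theorem sqle {f A q : ℝ} (h : |f| ≤ A * q) : f * f ≤ A ^ 2 * q ^ 2 := by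
  have := pow_le_pow_left₀ (abs_nonneg f) h 2
  rw [sq_abs] at this
  nlinarith

theorem q5 (s a b c d : ℝ) : (s + |a| + |b| + |c| + |d|) ^ 2 ≤ 5 * (s ^ 2 + a ^ 2 + b ^ 2 + c ^ 2 + d ^ 2) := by
  rw [← sq_abs a, ← sq_abs b, ← sq_abs c, ← sq_abs d]
  generalize |a| = a; generalize |b| = b; generalize |c| = c; generalize |d| = d
  nlinarith [sq_nonneg (s-a), sq_nonneg (s-b), sq_nonneg (s-c), sq_nonneg (s-d), sq_nonneg (a-b), sq_nonneg (a-c),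
    sq_nonneg (a-d), sq_nonneg (b-c), sq_nonneg (b-d), sq_nonneg (c-d)]

namespace Sys
variable {μ lam κ g1 r M ε T : ℝ} (S : Sys μ lam κ g1 r M ε T)

def Fp : Fld := S.ρ * (Dt S.v + (Yf + S.v) * D1 S.v + S.w * D2 S.v + S.w) - μ • D1 (D1 S.v) - lam • (D1 (D1 S.v) + D1 (D2 S.w))
instance : SM S.Fp := by unfold Fp; infer_instance
def Qp : Fld := ε⁻¹ • S.Q
instance : SM S.Qp := by unfold Qp; infer_instance
instance : PER S.Qp := by unfold Qp Q; infer_instance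

theorem mom1' {t : ℝ} (ht : t ∈ Set.Icc 0 T) {x : ℝ × ℝ} (hx : x ∈ Ω) :
    μ * D2 (D2 S.v) t x = D1 S.Qp t x + S.Fp t x := by
  have h1 := S.mom1 t ht x hx
  simp only [d1_add, d2_add, d1_sub, d2_sub, d1_mul, d2_mul, d1_smul, d2_smul, d21, D1_Yf, D2_Yf,
    S.Θ1, S.R1, Fp, Qp, Sys.ρ, Q] at *
  simp only [Pi.add_apply, Pi.mul_apply, Pi.sub_apply, Pi.neg_apply, Pi.smul_apply, smul_eq_mul, Pi.one_apply,
    Pi.zero_apply] at *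
  linarith

theorem mom2' {t : ℝ} (ht : t ∈ Set.Icc 0 T) {x : ℝ × ℝ} (hx : x ∈ Ω) :
    (μ + lam) * D2 (D2 S.w) t x = D2 S.Qp t x + (S.ρ t x * (Dt S.w t x + ((Yf t x + S.v t x) * D1 S.w t x + S.w t x * D2 S.w t x))
      - μ * D1 (D1 S.w) t x - lam * D1 (D2 S.v) t x) := by
  have h1 := S.mom2 t ht x hx
  simp only [d1_add, d2_add, d1_sub, d2_sub, d1_mul, d2_mul, d1_smul, d2_smul, d21, D1_Yf, D2_Yf,
    S.Θ1, S.R1, Fp, Qp, Sys.ρ, Q] at *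
  simp only [Pi.add_apply, Pi.mul_apply, Pi.sub_apply, Pi.neg_apply, Pi.smul_apply, smul_eq_mul, Pi.one_apply,
    Pi.zero_apply] at *
  linarith

theorem Q1p (hε : ε ≠ 0) (t : ℝ) (x : ℝ × ℝ) : D1 S.Qp t x =
    (S.R t x + ε * S.a t x) * (ε⁻¹ * D1 S.b t x) + (S.Θ t x + ε * S.b t x) * (ε⁻¹ * D1 S.a t x) := by
  simp only [d1_add, d2_add, d1_sub, d2_sub, d1_mul, d2_mul, d1_smul, d2_smul, d21, D1_Yf, D2_Yf,
    S.Θ1, S.R1, Fp, Qp, Sys.ρ, Q] at *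
  simp only [Pi.add_apply, Pi.mul_apply, Pi.sub_apply, Pi.neg_apply, Pi.smul_apply, smul_eq_mul, Pi.one_apply,
    Pi.zero_apply] at *
  field_simp; ring

theorem Q2p (hε : ε ≠ 0) (t : ℝ) (x : ℝ × ℝ) : D2 S.Qp t x =
    (S.R t x + ε * S.a t x) * (ε⁻¹ * D2 S.b t x) + (ε⁻¹ * D2 S.R t x) * S.b t x + (ε⁻¹ * D2 S.Θ t x) * S.a t x
      + (S.Θ t x + ε * S.b t x) * (ε⁻¹ * D2 S.a t x) := by
  simp only [d1_add, d2_add, d1_sub, d2_sub, d1_mul, d2_mul, d1_smul, d2_smul, d21, D1_Yf, D2_Yf,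
    S.Θ1, S.R1, Fp, Qp, Sys.ρ, Q] at *
  simp only [Pi.add_apply, Pi.mul_apply, Pi.sub_apply, Pi.neg_apply, Pi.smul_apply, smul_eq_mul, Pi.one_apply,
    Pi.zero_apply] at *
  field_simp; ring

/-- the dissipation that controls everything else -/
def W5 : Fld := (ε⁻¹ * ε⁻¹) • (D2 S.a * D2 S.a) + S.N + S.pt + S.sF
instance : SM S.W5 := by unfold W5; infer_instance

theorem F_pt (hM : 1 ≤ M) (hμ : 0 < μ) (hl : 0 ≤ lam) (h0 : 0 < ε) (hε : M * ε ≤ 1/16) {t : ℝ} (ht : t ∈ Set.Icc 0 T)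
    {x : ℝ × ℝ} (hx : x ∈ Ω) : S.Fp t x * S.Fp t x ≤ (5 * (3/2*(1+(1+M)+M+1)+μ+2*lam)^2) * S.W5 t x := by
  have h := S.ptB hM h0 hε ht hx
  set s := √(S.sF t x) with hs
  have hs2 : s ^ 2 = S.sF t x := Real.sq_sqrt (S.sF0 t x)
  set q := s + |Dt S.v t x| + |D1 (D1 S.v) t x| + |D1 (D2 S.w) t x| + |0| with hq
  have n1 := abs_nonneg (Dt S.v t x)
  have n2 := abs_nonneg (D1 (D1 S.v) t x)
  have n3 := abs_nonneg (D1 (D2 S.w) t x)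
  have n4 := h.s0
  have q0 : s ≤ q := by rw [hq, abs_zero]; linarith
  have q1 : |Dt S.v t x| ≤ q := by rw [hq, abs_zero]; linarith
  have q2 : |D1 (D1 S.v) t x| ≤ q := by rw [hq, abs_zero]; linarith
  have q3 : |D1 (D2 S.w) t x| ≤ q := by rw [hq, abs_zero]; linarith
  have f1 := bs (bs (bm h.hρ (bp (bp (bp q1 (bm h.hU (h.sv1.trans q0))) (bm h.hw (h.sv2.trans q0))) (h.sw.trans q0)))
    (bc hμ.le q2)) (bc hl (bp q2 q3))
  have f2 : |S.Fp t x| ≤ (3/2*(1+(1+M)+M+1)+μ+2*lam) * q := by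
    refine le_trans (le_of_eq ?_) (f1.trans (le_of_eq ?_))
    · simp only [Fp, Sys.ρ, Pi.add_apply, Pi.mul_apply, Pi.sub_apply, Pi.smul_apply, smul_eq_mul]
    · ring
  have f3 := sqle f2
  have f4 := q5 s (Dt S.v t x) (D1 (D1 S.v) t x) (D1 (D2 S.w) t x) 0
  have f5 : s ^ 2 + Dt S.v t x ^ 2 + D1 (D1 S.v) t x ^ 2 + D1 (D2 S.w) t x ^ 2 + 0 ^ 2 ≤ S.W5 t x := by
    rw [hs2]
    simp only [W5, N, pt, Pi.add_apply, Pi.mul_apply, Pi.sub_apply, Pi.smul_apply, smul_eq_mul]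
    have m1 := mul_nonneg (mul_self_nonneg ε⁻¹) (mul_self_nonneg (D2 S.a t x))
    nlinarith only [m1, mul_self_nonneg (D1 (D2 S.v) t x), mul_self_nonneg (D1 (D1 S.w) t x), mul_self_nonneg (Dt S.w t x), mul_self_nonneg (Dt S.b t x)]
  have f6 : q^2 ≤ 5 * S.W5 t x := f4.trans (mul_le_mul_of_nonneg_left f5 (by norm_num : (0:ℝ) ≤ 5))
  have f7 := mul_le_mul_of_nonneg_left f6 (sq_nonneg (3/2*(1+(1+M)+M+1)+μ+2*lam))
  linarith only [f3, f7]

theorem Q2_pt (hM : 1 ≤ M) (h0 : 0 < ε) (hε : M * ε ≤ 1/16) {t : ℝ} (ht : t ∈ Set.Icc 0 T)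
    {x : ℝ × ℝ} (hx : x ∈ Ω) : D2 S.Qp t x * D2 S.Qp t x ≤ (5 * (3/2+M+M+3/2)^2) * S.W5 t x := by
  have h := S.ptB hM h0 hε ht hx
  set s := √(S.sF t x) with hs
  have hs2 : s ^ 2 = S.sF t x := Real.sq_sqrt (S.sF0 t x)
  set q := s + |ε⁻¹ * D2 S.a t x| + |0| + |0| + |0| with hq
  have n1 := abs_nonneg (ε⁻¹ * D2 S.a t x)
  have n4 := h.s0
  have q0 : s ≤ q := by rw [hq, abs_zero]; linarith
  have q1 : |ε⁻¹ * D2 S.a t x| ≤ q := by rw [hq, abs_zero]; linarith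
  have f1 := bp (bp (bp (bm h.hρ (h.ib2.trans q0)) (bm h.hR2 (h.sb.trans q0))) (bm h.hΘ2 (h.sa.trans q0)))
    (bm h.hτ q1)
  have f2 : |D2 S.Qp t x| ≤ (3/2+M+M+3/2) * q := by
    rw [S.Q2p h0.ne']
    exact f1.trans (le_of_eq (by ring))
  have f3 := sqle f2
  have f4 := q5 s (ε⁻¹ * D2 S.a t x) 0 0 0
  have f5 : s ^ 2 + (ε⁻¹ * D2 S.a t x) ^ 2 + 0 ^ 2 + 0 ^ 2 + 0 ^ 2 ≤ S.W5 t x := by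
    rw [hs2]
    simp only [W5, N, pt, Pi.add_apply, Pi.mul_apply, Pi.sub_apply, Pi.smul_apply, smul_eq_mul]
    nlinarith only [mul_self_nonneg (D1 (D2 S.v) t x), mul_self_nonneg (D1 (D2 S.w) t x), mul_self_nonneg (D1 (D1 S.v) t x), mul_self_nonneg (D1 (D1 S.w) t x), mul_self_nonneg (Dt S.v t x), mul_self_nonneg (Dt S.w t x), mul_self_nonneg (Dt S.b t x)]
  have f6 : q^2 ≤ 5 * S.W5 t x := f4.trans (mul_le_mul_of_nonneg_left f5 (by norm_num : (0:ℝ) ≤ 5))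
  have f7 := mul_le_mul_of_nonneg_left f6 (sq_nonneg (3/2+M+M+3/2))
  linarith only [f3, f7]


theorem L4 (μ lam κ g1 r M : ℝ) (hM : 1 ≤ M) (hμ : 0 < μ) (hl : 0 ≤ lam) : ∃ C : ℝ, 0 < C ∧
    ∀ {ε T : ℝ} (S : Sys μ lam κ g1 r M ε T), 0 < ε → M * ε ≤ 1/16 → ∀ t ∈ Set.Icc 0 T,
    J (D1 S.Qp * D1 S.Qp) t ≤ C * J S.W5 t := by
  refine ⟨2 * ((100000000 * (1 + μ ^ 2)) * ((5 * (3/2+M+M+3/2)^2) + 1 + 1 + (5 * (3/2*(1+(1+M)+M+1)+μ+2*lam)^2))), by positivity, ?_⟩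
  intro ε T S h0 hε t ht
  have h := L4_abs (Q := S.Qp) (f := S.v) (F := S.Fp) hμ (fun x hx => S.mom1' ht hx)
  have h1 : J (D2 S.Qp * D2 S.Qp) t ≤ J ((5 * (3/2+M+M+3/2)^2) • S.W5) t := J_le fun x hx => S.Q2_pt hM h0 hε ht hx
  have h2 : J (S.Fp * S.Fp) t ≤ J ((5 * (3/2*(1+(1+M)+M+1)+μ+2*lam)^2) • S.W5) t := J_le fun x hx => S.F_pt hM hμ hl h0 hε ht hx
  have h3 : J (D1 (D2 S.v) * D1 (D2 S.v)) t ≤ J S.W5 t := J_le fun x hx => by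
    have := S.sF0 t x
    simp only [W5, N, pt, Pi.add_apply, Pi.mul_apply, Pi.sub_apply, Pi.smul_apply, smul_eq_mul]
    have m1 := mul_nonneg (mul_self_nonneg ε⁻¹) (mul_self_nonneg (D2 S.a t x))
    linarith only [this, m1, mul_self_nonneg (D1 (D2 S.w) t x), mul_self_nonneg (D1 (D1 S.v) t x), mul_self_nonneg (D1 (D1 S.w) t x), mul_self_nonneg (Dt S.v t x), mul_self_nonneg (Dt S.w t x), mul_self_nonneg (Dt S.b t x)]
  have h4 : J (D2 S.v * D2 S.v) t ≤ J S.W5 t := J_le fun x hx => by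
    have h := S.ptB hM h0 hε ht hx
    have := sqle (h.sv2.trans (one_mul _).ge)
    rw [Real.sq_sqrt (S.sF0 t x)] at this
    simp only [W5, N, pt, Pi.add_apply, Pi.mul_apply, Pi.sub_apply, Pi.smul_apply, smul_eq_mul]
    have m1 := mul_nonneg (mul_self_nonneg ε⁻¹) (mul_self_nonneg (D2 S.a t x))
    linarith only [this, m1, mul_self_nonneg (D1 (D2 S.w) t x), mul_self_nonneg (D1 (D1 S.v) t x), mul_self_nonneg (D1 (D1 S.w) t x), mul_self_nonneg (Dt S.v t x), mul_self_nonneg (Dt S.w t x), mul_self_nonneg (Dt S.b t x), mul_self_nonneg (D1 (D2 S.v) t x)]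
  rw [J_smul_eq] at h1 h2
  have := mul_le_mul_of_nonneg_left (add_le_add (add_le_add (add_le_add h1 h3) h4) h2) (show 0 ≤ 2 * (100000000 * (1 + μ ^ 2)) by positivity)
  linarith only [h, this]

/-- everything else -/
def W6 : Fld := Dt S.a * Dt S.a + (ε⁻¹ * ε⁻¹) • (D1 S.a * D1 S.a) + D2 (D2 S.v) * D2 (D2 S.v) + D2 (D2 S.w) * D2 (D2 S.w)
instance : SM S.W6 := by unfold W6; infer_instance

theorem W6_pt (μ lam κ g1 r M : ℝ) (hM : 1 ≤ M) (hμ : 0 < μ) (hl : 0 ≤ lam) : ∃ C : ℝ, 0 < C ∧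
    ∀ {ε T : ℝ} (S : Sys μ lam κ g1 r M ε T), 0 < ε → M * ε ≤ 1/16 → ∀ t ∈ Set.Icc 0 T, ∀ x ∈ Ω,
    S.W6 t x ≤ C * (S.W5 t x + D1 S.Qp t x * D1 S.Qp t x) := by
  set K1 := 2*(1+M)+3 + M with hK1
  set K2 := μ⁻¹ ^ 2 * 2 * ((5 * (3/2*(1+(1+M)+M+1)+μ+2*lam)^2) + 1) with hK2
  set K3 := (μ+lam)⁻¹ ^ 2 * (2*(5 * (3/2+M+M+3/2)^2) + 2*(5*(3/2*(1+(1+M)+M)+μ+lam)^2)) with hK3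
  refine ⟨K1 ^ 2 + 18 + K2 + K3, by positivity, ?_⟩
  intro ε T S h0 hε t ht x hx
  have h := S.ptB hM h0 hε ht hx
  set s := √(S.sF t x) with hs
  have hs2 : s ^ 2 = S.sF t x := Real.sq_sqrt (S.sF0 t x)
  have hei : 0 < ε⁻¹ := inv_pos.2 h0
  have hW : s ^ 2 + Dt S.w t x ^ 2 + D1 (D1 S.w) t x ^ 2 + D1 (D2 S.v) t x ^ 2 + 0 ^ 2 ≤ S.W5 t x := by
    rw [hs2]
    simp only [W5, N, pt, Pi.add_apply, Pi.mul_apply, Pi.sub_apply, Pi.smul_apply, smul_eq_mul]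
    have m1 := mul_nonneg (mul_self_nonneg ε⁻¹) (mul_self_nonneg (D2 S.a t x))
    nlinarith only [m1, mul_self_nonneg (D1 (D1 S.v) t x), mul_self_nonneg (D1 (D2 S.w) t x), mul_self_nonneg (Dt S.v t x), mul_self_nonneg (Dt S.b t x)]
  have hW5 : s ^ 2 ≤ S.W5 t x := by
    linarith only [hW, sq_nonneg (Dt S.w t x), sq_nonneg (D1 (D1 S.w) t x), sq_nonneg (D1 (D2 S.v) t x)]
  have hW0 : 0 ≤ S.W5 t x := (sq_nonneg s).trans hW5
  have hQ0 := mul_self_nonneg (D1 S.Qp t x)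
  -- time derivative of a
  have a1 : |Dt S.a t x| ≤ K1 * s := by
    have hm := S.mass t ht x hx
    simp only [Pi.add_apply, Pi.mul_apply, Pi.sub_apply, Pi.smul_apply, smul_eq_mul] at hm
    have e : Dt S.a t x = -((Yf t x + S.v t x) * D1 S.a t x + S.w t x * D2 S.a t x
        + (S.R t x + ε * S.a t x) * (ε⁻¹ * D1 S.v t x + ε⁻¹ * D2 S.w t x) + ε⁻¹ * D2 S.R t x * S.w t x) := by
      have hne := h0.ne'
      linear_combination (norm := (field_simp; ring)) ε⁻¹ * hm
    rw [e, abs_neg]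
    refine (bp (bp (bp (bm h.hU h.sa1) (bm h.hw h.sa2)) (bm h.hρ (bp h.iv1 h.iw2))) (bm h.hR2 h.sw)).trans ?_
    have := mul_nonneg (show 0 ≤ 1 + M - M by linarith) h.s0
    rw [hK1]
    linarith only [this]
  have a1' := sqle a1
  have a1'' := mul_le_mul_of_nonneg_left hW5 (sq_nonneg K1)
  -- tangential derivative of a
  have a2 : ε⁻¹ * ε⁻¹ * (D1 S.a t x * D1 S.a t x) ≤ 18 * (S.W5 t x + D1 S.Qp t x * D1 S.Qp t x) := by
    have e := S.Q1p h0.ne' t x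
    have b1 := sqle (bm h.hρ h.ib1)
    have b2 : 0 ≤ ((S.Θ t x + ε * S.b t x) ^ 2 - 1/4) * (ε⁻¹ * D1 S.a t x) ^ 2 := by
      refine mul_nonneg ?_ (sq_nonneg _)
      nlinarith only [h.τl]
    generalize (S.R t x + ε * S.a t x) * (ε⁻¹ * D1 S.b t x) = p at *
    generalize S.Θ t x + ε * S.b t x = τ at *
    have e2 : (τ * (ε⁻¹ * D1 S.a t x)) = D1 S.Qp t x - p := by rw [e]; ring
    have e3 : τ ^ 2 * (ε⁻¹ * D1 S.a t x) ^ 2 = (D1 S.Qp t x - p) ^ 2 := by rw [← e2]; ring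
    have e4 := sq_nonneg (D1 S.Qp t x + p)
    nlinarith only [b1, b2, e3, e4, hW5, hQ0]
  -- v22
  have a3 : D2 (D2 S.v) t x * D2 (D2 S.v) t x ≤ K2 * (S.W5 t x + D1 S.Qp t x * D1 S.Qp t x) := by
    have e := S.mom1' ht hx
    have b := S.F_pt hM hμ hl h0 hε ht hx
    have e1 : D2 (D2 S.v) t x = μ⁻¹ * (D1 S.Qp t x + S.Fp t x) := by rw [← e]; field_simp
    rw [e1, hK2]
    have hK : 0 ≤ (5 * (3/2*(1+(1+M)+M+1)+μ+2*lam)^2) := by positivity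
    generalize (5 * (3/2*(1+(1+M)+M+1)+μ+2*lam)^2) = K at *
    have f1 : (D1 S.Qp t x + S.Fp t x) ^ 2 ≤ 2 * (K + 1) * (S.W5 t x + D1 S.Qp t x * D1 S.Qp t x) := by
      nlinarith only [b, sq_nonneg (D1 S.Qp t x - S.Fp t x), mul_nonneg hK hQ0, hW0]
    have := mul_le_mul_of_nonneg_left f1 (sq_nonneg μ⁻¹)
    linarith only [this]
  have a4 : D2 (D2 S.w) t x * D2 (D2 S.w) t x ≤ K3 * S.W5 t x := by
    have hν : 0 < μ + lam := by positivity
    have e := S.mom2' ht hx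
    have b := S.Q2_pt hM h0 hε ht hx
    set q := s + |Dt S.w t x| + |D1 (D1 S.w) t x| + |D1 (D2 S.v) t x| + |0| with hq
    have n1 := abs_nonneg (Dt S.w t x)
    have n2 := abs_nonneg (D1 (D1 S.w) t x)
    have n3 := abs_nonneg (D1 (D2 S.v) t x)
    have n4 := h.s0
    have q0 : s ≤ q := by rw [hq, abs_zero]; linarith
    have q1 : |Dt S.w t x| ≤ q := by rw [hq, abs_zero]; linarith
    have q2 : |D1 (D1 S.w) t x| ≤ q := by rw [hq, abs_zero]; linarith
    have q3 : |D1 (D2 S.v) t x| ≤ q := by rw [hq, abs_zero]; linarith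
    have f1 := bs (bs (bm h.hρ (bp q1 (bp (bm h.hU (h.sw1.trans q0)) (bm h.hw (h.sw2.trans q0)))))
      (bc hμ.le q2)) (bc hl q3)
    have f4 := q5 s (Dt S.w t x) (D1 (D1 S.w) t x) (D1 (D2 S.v) t x) 0
    have f6 : q^2 ≤ 5 * S.W5 t x := f4.trans (mul_le_mul_of_nonneg_left hW (by norm_num : (0:ℝ) ≤ 5))
    have e1 : D2 (D2 S.w) t x = (μ+lam)⁻¹ * (D2 S.Qp t x + ((S.R t x + ε * S.a t x) * (Dt S.w t x + ((Yf t x + S.v t x) * D1 S.w t x + S.w t x * D2 S.w t x))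
      - μ * D1 (D1 S.w) t x - lam * D1 (D2 S.v) t x)) := by
      show _ = (μ+lam)⁻¹ * (D2 S.Qp t x + ((S.ρ t x) * (Dt S.w t x + ((Yf t x + S.v t x) * D1 S.w t x + S.w t x * D2 S.w t x))
      - μ * D1 (D1 S.w) t x - lam * D1 (D2 S.v) t x))
      rw [← e]; field_simp
    rw [e1, hK3]
    generalize ((S.R t x + ε * S.a t x) * (Dt S.w t x + ((Yf t x + S.v t x) * D1 S.w t x + S.w t x * D2 S.w t x))
      - μ * D1 (D1 S.w) t x - lam * D1 (D2 S.v) t x) = G at *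
    have f2 : |G| ≤ (3/2*(1+(1+M)+M)+μ+lam) * q := f1.trans (le_of_eq (by ring))
    have f3 := sqle f2
    have f7 := mul_le_mul_of_nonneg_left f6 (sq_nonneg (3/2*(1+(1+M)+M)+μ+lam))
    have f8 : (D2 S.Qp t x + G) ^ 2 ≤ (2*(5 * (3/2+M+M+3/2)^2) + 2*(5*(3/2*(1+(1+M)+M)+μ+lam)^2)) * S.W5 t x := by
      linarith only [b, sq_nonneg (D2 S.Qp t x - G), f3, f7]
    have := mul_le_mul_of_nonneg_left f8 (sq_nonneg (μ+lam)⁻¹)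
    linarith only [this]
  have hK3' : 0 ≤ K3 := by positivity
  have hh := mul_nonneg hK3' hQ0
  have hh2 := mul_nonneg (sq_nonneg K1) hQ0
  simp only [W6, Pi.add_apply, Pi.mul_apply, Pi.sub_apply, Pi.smul_apply, smul_eq_mul]
  linarith only [a1', a1'', a2, a3, a4, hh, hh2]

end Sys

theorem J_hess {f : Fld} [SM f] [PER f] {t : ℝ} (h : ∀ x : ℝ × ℝ, (x.2 = 0 ∨ x.2 = 1) → f t x = 0) :
    J (D1 (D1 f) * D1 (D1 f) + (2:ℝ) • (D1 (D2 f) * D1 (D2 f)) + D2 (D2 f) * D2 (D2 f)) t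
      = J ((D1 (D1 f) + D2 (D2 f)) * (D1 (D1 f) + D2 (D2 f))) t := by
  refine J_ibp (X := (2:ℝ) • (D1 (D2 f) * D2 f)) (Z := (-2:ℝ) • (D1 (D1 f) * D2 f)) ?_ ?_
  · intro x hx
    have := bd1 (f := D1 f) (bd1 h) x hx
    simp only [Pi.smul_apply, Pi.mul_apply, smul_eq_mul, this]; ring
  · intro x hx
    simp only [d1_add, d2_add, d1_sub, d2_sub, d1_mul, d2_mul, d1_smul, d2_smul, d21]
    simp only [Pi.add_apply, Pi.mul_apply, Pi.sub_apply, Pi.neg_apply, Pi.smul_apply, smul_eq_mul]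
    ring

namespace Sys
variable {μ lam κ g1 r M ε T : ℝ} (S : Sys μ lam κ g1 r M ε T)

def Hb : Fld := D1 (D1 S.b) * D1 (D1 S.b) + D1 (D2 S.b) * D1 (D2 S.b) + D2 (D2 S.b) * D2 (D2 S.b)
instance : SM S.Hb := by unfold Hb; infer_instance

theorem lapb_pt (hM : 1 ≤ M) (hμ : 0 < μ) (hκ : 0 < κ) (hg : 0 < g1) (h0 : 0 < ε) (hε : M * ε ≤ 1/16) {t : ℝ} (ht : t ∈ Set.Icc 0 T)
    {x : ℝ × ℝ} (hx : x ∈ Ω) : (D1 (D1 S.b) t x + D2 (D2 S.b) t x) * (D1 (D1 S.b) t x + D2 (D2 S.b) t x)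
      ≤ (5 * (κ⁻¹*(g1*(3/2*(1+(1+M)+M+M))+9/2 + 2*μ*(M+M+1/2*(2*M*2)) + 2*μ*2 + |r| *μ*(2*M*2)))^2) * S.W5 t x := by
  have h := S.ptB hM h0 hε ht hx
  set s := √(S.sF t x) with hs
  have hs2 : s ^ 2 = S.sF t x := Real.sq_sqrt (S.sF0 t x)
  set q := s + |Dt S.b t x| + |0| + |0| + |0| with hq
  have n1 := abs_nonneg (Dt S.b t x)
  have n4 := h.s0
  have q0 : s ≤ q := by rw [hq, abs_zero]; linarith
  have q1 : |Dt S.b t x| ≤ q := by rw [hq, abs_zero]; linarith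
  have qn : 0 ≤ q := n4.trans q0
  have s1 := h.sv1.trans q0
  have s2 := h.sv2.trans q0
  have s3 := h.sw1.trans q0
  have s4 := h.sw2.trans q0
  have f1 := bc hg.le (bm h.hρ (bp (bp (bp q1 (bm h.hU (h.sb1.trans q0))) (bm h.hw (h.sb2.trans q0))) (bm h.hΘ2 (h.sw.trans q0))))
  have f2 := bm (bm h.hρ h.hτ) (bp (h.iv1.trans q0) (h.iw2.trans q0))
  have f3 := bc (show 0 ≤ 2 * μ by linarith) (bp (bp (bm h.kv1 s1) (bm h.kw2 s4)) (bc (show (0:ℝ) ≤ 1/2 by norm_num) (bm (bp h.kw1 h.kv2) (bp s3 s2))))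
  have f4 := bc (show 0 ≤ 2 * μ by linarith) (bm (show |ε| ≤ 1 by rw [abs_of_pos h0]; exact h.e1) (bp s3 s2))
  have f5 := bm (le_refl |r * μ|) (bm (bp h.kv1 h.kw2) (bp s1 s4))
  have f6 := bs (bs (bs (bp f1 f2) f3) f4) f5
  have g2 : |D1 (D1 S.b) t x + D2 (D2 S.b) t x| ≤ (κ⁻¹*(g1*(3/2*(1+(1+M)+M+M))+9/2 + 2*μ*(M+M+1/2*(2*M*2)) + 2*μ*2 + |r| *μ*(2*M*2))) * q := by
    have he := S.energy t ht x hx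
    simp only [Pi.add_apply, Pi.mul_apply, Pi.sub_apply, Pi.smul_apply, smul_eq_mul] at he
    have e : D1 (D1 S.b) t x + D2 (D2 S.b) t x = κ⁻¹ * (κ * (D1 (D1 S.b) t x + D2 (D2 S.b) t x)) := by
      field_simp
    rw [e, mul_assoc]
    refine bc (inv_pos.2 hκ).le ?_
    refine le_trans (le_of_eq ?_) (f6.trans (le_of_eq ?_))
    · congr 1
      linear_combination -he
    · rw [abs_mul r μ, abs_of_pos hμ]; ring
  have g3 := sqle g2
  have g4 := q5 s (Dt S.b t x) 0 0 0
  have g5 : s ^ 2 + (Dt S.b t x) ^ 2 + 0 ^ 2 + 0 ^ 2 + 0 ^ 2 ≤ S.W5 t x := by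
    rw [hs2]
    simp only [W5, N, pt, Pi.add_apply, Pi.mul_apply, Pi.sub_apply, Pi.smul_apply, smul_eq_mul]
    have m1 := mul_nonneg (mul_self_nonneg ε⁻¹) (mul_self_nonneg (D2 S.a t x))
    nlinarith only [m1, mul_self_nonneg (D1 (D2 S.v) t x), mul_self_nonneg (D1 (D2 S.w) t x), mul_self_nonneg (D1 (D1 S.v) t x), mul_self_nonneg (D1 (D1 S.w) t x), mul_self_nonneg (Dt S.v t x), mul_self_nonneg (Dt S.w t x)]
  have g6 : q^2 ≤ 5 * S.W5 t x := g4.trans (mul_le_mul_of_nonneg_left g5 (by norm_num : (0:ℝ) ≤ 5))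
  have g7 := mul_le_mul_of_nonneg_left g6 (sq_nonneg (κ⁻¹*(g1*(3/2*(1+(1+M)+M+M))+9/2 + 2*μ*(M+M+1/2*(2*M*2)) + 2*μ*2 + |r| *μ*(2*M*2))))
  refine g3.trans (g7.trans (le_of_eq (by ring)))

/-- all remaining second order quantities are controlled by `W5` -/
theorem L5 (μ lam κ g1 r M : ℝ) (hM : 1 ≤ M) (hμ : 0 < μ) (hl : 0 ≤ lam) (hκ : 0 < κ) (hg : 0 < g1) : ∃ C : ℝ, 0 < C ∧
    ∀ {ε T : ℝ} (S : Sys μ lam κ g1 r M ε T), 0 < ε → M * ε ≤ 1/16 → ∀ t ∈ Set.Icc 0 T,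
    J S.W6 t + J S.Hb t ≤ C * J S.W5 t := by
  obtain ⟨C1, hC1, H1⟩ := L4 μ lam κ g1 r M hM hμ hl
  obtain ⟨C2, hC2, H2⟩ := W6_pt μ lam κ g1 r M hM hμ hl
  refine ⟨C2 * (1 + C1) + (5 * (κ⁻¹*(g1*(3/2*(1+(1+M)+M+M))+9/2 + 2*μ*(M+M+1/2*(2*M*2)) + 2*μ*2 + |r| *μ*(2*M*2)))^2), by positivity, ?_⟩
  intro ε T S h0 hε t ht
  have a1 := H1 S h0 hε t ht
  have a2 : J S.W6 t ≤ J (C2 • (S.W5 + D1 S.Qp * D1 S.Qp)) t := J_le fun x hx => H2 S h0 hε t ht x hx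
  rw [J_smul_eq, J_add_eq] at a2
  have a3 : J S.Hb t ≤ J (D1 (D1 S.b) * D1 (D1 S.b) + (2:ℝ) • (D1 (D2 S.b) * D1 (D2 S.b)) + D2 (D2 S.b) * D2 (D2 S.b)) t :=
    J_le fun x hx => by
      simp only [Hb, Pi.add_apply, Pi.mul_apply, Pi.sub_apply, Pi.smul_apply, smul_eq_mul]
      linarith only [mul_self_nonneg (D1 (D2 S.b) t x)]
  rw [J_hess (S.cb t ht)] at a3
  have a4 : J ((D1 (D1 S.b) + D2 (D2 S.b)) * (D1 (D1 S.b) + D2 (D2 S.b))) t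
     ≤ J ((5 * (κ⁻¹*(g1*(3/2*(1+(1+M)+M+M))+9/2 + 2*μ*(M+M+1/2*(2*M*2)) + 2*μ*2 + |r| *μ*(2*M*2)))^2) • S.W5) t := J_le fun x hx =>
       S.lapb_pt hM hμ hκ hg h0 hε ht hx
  rw [J_smul_eq] at a4
  have a5 := mul_le_mul_of_nonneg_left a1 hC2.le
  linarith only [a2, a3, a4, a5]

end Sys

/-- the algebra of the combination of the differential inequalities -/
theorem comb {c0 c1 c2 c3 C1 C2 C3 C5 m k0 k1 k2 c ε G P N A g gi s W x0 x1 x2 x3 : ℝ}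
    (hC1 : 0 < C1) (hC2 : 0 < C2) (hC3 : 0 < C3) (hC5 : 0 < C5) (hm : 0 < m)
    (h0 : 0 < k0) (h1 : 0 < k1) (h2 : 0 < k2) (e2 : k2 * c2 = C3 + 1) (e1 : k1 * c1 = k2 * C2 + C3 + 1)
    (e0 : 2 * (k1 * C1 + k2 * C2 + C3) + 1 ≤ k0 * c0) (hc1 : c ≤ 1) (hc3 : c ≤ c3)
    (hε : 0 < ε) (hε1 : ε ≤ 1) (hε2 : 402 * (1 + C5) * ε ≤ 1)
    (hε3 : ε * ((k0 * m + 201 * (k1 * C1 + k2 * C2 + C3) + (k2 * C2 + C3)) * (4 * (1 + C5))) ≤ c / 2)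
    (hG : 0 ≤ G) (hP : 0 ≤ P) (hN : 0 ≤ N) (hA : 0 ≤ A) (hg : 0 ≤ g)
    (hs : s ≤ 2 * G + 201 * g) (hW : W = A + N + P + s) 
    (hgi : gi ≤ ε * ((1 + C5) * W)) (hgg : g ≤ ε * ((1 + C5) * W)) 
    (i0 : x0 ≤ -c0 * G + m * g) (i1 : x1 ≤ -c1 * P + C1 * s) (i2 : x2 ≤ -c2 * N + C2 * (s + P) + C2 * gi)
    (i3 : x3 ≤ -c3 * A + C3 * (s + P + N) + C3 * gi) :
    k0 * x0 + k1 * x1 + k2 * x2 + x3 ≤ -(c / 2) * (A + N + P + G) ∧ W ≤ 4 * (A + N + P + G) := by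
  have w1 : W ≤ 4 * (A + N + P + G) := by
    by_contra hcon
    push Not at hcon
    have hW0 : 0 ≤ W := by linarith
    have := mul_le_mul_of_nonneg_right hε2 hW0
    nlinarith only [this, hgg, hs, hW, hcon, hA, hN, hP, hG]
  refine ⟨?_, w1⟩
  have y := mul_le_mul_of_nonneg_left w1 (show 0 ≤ ε * (1 + C5) by positivity)
  have g1 : g ≤ ε * (4 * (1 + C5)) * (A + N + P + G) := by linarith only [y, hgg]
  have g2 : gi ≤ ε * (4 * (1 + C5)) * (A + N + P + G) := by linarith only [y, hgi]
  set D := A + N + P + G with hD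
  have hD0 : 0 ≤ D := by positivity
  have z0 := mul_le_mul_of_nonneg_left i0 h0.le
  have z1 := mul_le_mul_of_nonneg_left i1 h1.le
  have z2 := mul_le_mul_of_nonneg_left i2 h2.le
  have z3 := mul_le_mul_of_nonneg_left hs (show 0 ≤ k1 * C1 + k2 * C2 + C3 by positivity)
  have z4 := mul_le_mul_of_nonneg_left g1 (show 0 ≤ k0 * m + 201 * (k1 * C1 + k2 * C2 + C3) by positivity)
  have z5 := mul_le_mul_of_nonneg_left g2 (show 0 ≤ k2 * C2 + C3 by positivity)
  have z6 := mul_le_mul_of_nonneg_right hε3 hD0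
  have z7 := mul_le_mul_of_nonneg_right e0 hG
  have z8 : k1 * c1 * P = (k2 * C2 + C3 + 1) * P := by rw [e1]
  have z9 : k2 * c2 * N = (C3 + 1) * N := by rw [e2]
  have z10 := mul_le_mul_of_nonneg_right hc3 hA
  have z11 := mul_le_mul_of_nonneg_right hc1 (show 0 ≤ N + P + G by positivity)
  have z12 : c * D = c * A + c * (N + P + G) := by rw [hD]; ring
  have z13 : D = A + (N + P + G) := by rw [hD]; ring
  linarith only [z0, z1, z2, i3, z3, z4, z5, z6, z7, z8, z9, z10, z11, z12, z13]

namespace Sys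
variable {μ lam κ g1 r M ε T : ℝ} (S : Sys μ lam κ g1 r M ε T)

theorem e0_lo (hM : 1 ≤ M) (h0 : 0 < ε) (hε : M * ε ≤ 1/16) {cg : ℝ} (hc1 : cg ≤ 1/8) (hc2 : cg ≤ g1/4) (hg : 0 < g1)
    {t : ℝ} (ht : t ∈ Set.Icc 0 T) : cg * (J S.so t + J (S.a * S.a) t) ≤ J S.e0 t := by
  rw [← J_add_eq, ← J_smul_eq]
  refine J_le fun x hx => ?_
  obtain ⟨q1, q2, ⟨q3, q3'⟩, ⟨q4, q4'⟩, ⟨q5, q5'⟩, q6, q7, q8, q9, q10⟩ := S.bnds hM h0 hε ht hx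
  simp only [e0, so, ρ, Pi.add_apply, Pi.mul_apply, Pi.sub_apply, Pi.smul_apply, smul_eq_mul]
  generalize S.R t x = R at *
  generalize S.Θ t x = Θ at *
  generalize S.a t x = a at *
  generalize S.b t x = b at *
  generalize S.v t x = v at *
  generalize S.w t x = w at *
  have p1 : 3/8 ≤ (R + ε * a) * R := by nlinarith only [q3, q5]
  have p2 : 1/4 ≤ 1/2 * Θ - 1/6 * (ε * a) * Θ ^ 2 := by
    have := (abs_le.1 q1).2
    nlinarith only [q4, q4', this, sq_nonneg Θ]
  have p3 := mul_le_mul_of_nonneg_right p1 (add_nonneg (mul_self_nonneg v) (mul_self_nonneg w))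
  have p4 := mul_le_mul_of_nonneg_right p2 (mul_self_nonneg a)
  have p5 := mul_le_mul_of_nonneg_right q5 (mul_nonneg (half_pos hg).le (mul_self_nonneg b))
  have p6 := mul_le_mul_of_nonneg_right hc1 (add_nonneg (add_nonneg (mul_self_nonneg v) (mul_self_nonneg w)) (mul_self_nonneg a))
  have p7 := mul_le_mul_of_nonneg_right hc2 (mul_self_nonneg b)
  have p8 := add_nonneg (mul_self_nonneg v) (mul_self_nonneg w)
  have p9 := mul_self_nonneg a
  linarith only [p3, p4, p5, p6, p7, p8, p9]

theorem e0_hi (hM : 1 ≤ M) (h0 : 0 < ε) (hε : M * ε ≤ 1/16) (hg : 0 < g1)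
    {t : ℝ} (ht : t ∈ Set.Icc 0 T) : J S.e0 t ≤ (2 + g1) * (J S.so t + J (S.a * S.a) t) := by
  rw [← J_add_eq, ← J_smul_eq]
  refine J_le fun x hx => ?_
  obtain ⟨q1, q2, ⟨q3, q3'⟩, ⟨q4, q4'⟩, ⟨q5, q5'⟩, q6, q7, q8, q9, q10⟩ := S.bnds hM h0 hε ht hx
  simp only [e0, so, ρ, Pi.add_apply, Pi.mul_apply, Pi.sub_apply, Pi.smul_apply, smul_eq_mul]
  generalize S.R t x = R at *
  generalize S.Θ t x = Θ at *
  generalize S.a t x = a at *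
  generalize S.b t x = b at *
  generalize S.v t x = v at *
  generalize S.w t x = w at *
  have p1 : (R + ε * a) * R ≤ 4 := by nlinarith only [q3, q5, q3', q5']
  have p2 : 1/2 * Θ - 1/6 * (ε * a) * Θ ^ 2 ≤ 2 := by
    have := (abs_le.1 q1).1
    nlinarith only [q4, q4', this, sq_nonneg Θ]
  have p3 := mul_le_mul_of_nonneg_right p1 (add_nonneg (mul_self_nonneg v) (mul_self_nonneg w))
  have p4 := mul_le_mul_of_nonneg_right p2 (mul_self_nonneg a)
  have p5 := mul_le_mul_of_nonneg_right q5' (mul_nonneg (half_pos hg).le (mul_self_nonneg b))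
  have p8 := mul_nonneg hg.le (add_nonneg (mul_self_nonneg v) (mul_self_nonneg w))
  have p9 := mul_nonneg hg.le (mul_self_nonneg a)
  have p10 := mul_nonneg hg.le (mul_self_nonneg b)
  have p11 := mul_self_nonneg b
  linarith only [p3, p4, p5, p8, p9, p10, p11]

theorem e1_b (hM : 1 ≤ M) (h0 : 0 < ε) (hε : M * ε ≤ 1/16) (hμ : 0 < μ) (hl : 0 ≤ lam) (hκ : 0 < κ)
    {t : ℝ} (ht : t ∈ Set.Icc 0 T) :
    μ/4 * J S.gψ t + κ/2 * J S.gb t - 9/μ * (ε⁻¹ * ε⁻¹ * (J S.so t + J (S.a * S.a) t)) ≤ J S.e1 t ∧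
    J S.e1 t ≤ (μ + lam) * J S.gψ t + κ/2 * J S.gb t + 9/μ * (ε⁻¹ * ε⁻¹ * (J S.so t + J (S.a * S.a) t)) := by
  have key : ∀ x ∈ Ω, |ε⁻¹ * (S.Q t x * S.d t x)| ≤ μ/4 * S.gψ t x + 9/μ * (ε⁻¹ * ε⁻¹ * (S.so t x + (S.a * S.a) t x)) := by
    intro x hx
    have h := S.ptB hM h0 hε ht hx
    have b1 := bp (bm h.hρ (le_refl |S.b t x|)) (bm h.hΘ (le_refl |S.a t x|))
    have hQ : S.Q t x ^ 2 ≤ 9/2 * (S.a t x ^ 2 + S.b t x ^ 2) := by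
      rw [← sq_abs (S.Q t x), ← sq_abs (S.a t x), ← sq_abs (S.b t x)]
      have b2 : |S.Q t x| ≤ 3 / 2 * |S.b t x| + 5 / 4 * |S.a t x| := b1
      have := pow_le_pow_left₀ (abs_nonneg _) b2 2
      generalize |S.b t x| = b at *
      generalize |S.a t x| = a at *
      nlinarith only [this, sq_nonneg (a - b), sq_nonneg a, sq_nonneg b]
    have hd : S.d t x ^ 2 ≤ 2 * S.gψ t x := by
      simp only [d, gψ, Pi.add_apply, Pi.mul_apply]
      nlinarith only [sq_nonneg (D1 S.v t x - D2 S.w t x), sq_nonneg (D2 S.v t x), sq_nonneg (D1 S.w t x)]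
    have y1 : |ε⁻¹ * (S.Q t x * S.d t x)| ≤ μ/8 * S.d t x ^ 2 + 2/μ * (ε⁻¹ * ε⁻¹ * S.Q t x ^ 2) := by
      have e : μ/8 * S.d t x ^ 2 + 2/μ * (ε⁻¹ * ε⁻¹ * S.Q t x ^ 2) = 2/μ * ((μ/4 * S.d t x) ^ 2 + (ε⁻¹ * S.Q t x) ^ 2) := by
        field_simp; ring
      rw [e, show ε⁻¹ * (S.Q t x * S.d t x) = 2/μ * (2 * (μ/4 * S.d t x) * (ε⁻¹ * S.Q t x)) by field_simp; ring, abs_mul,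
        abs_of_pos (show 0 < 2/μ by positivity)]
      gcongr
      rw [abs_le]
      constructor
      · nlinarith only [sq_nonneg (μ/4 * S.d t x + ε⁻¹ * S.Q t x)]
      · nlinarith only [sq_nonneg (μ/4 * S.d t x - ε⁻¹ * S.Q t x)]
    have y2 := mul_le_mul_of_nonneg_left hd (show 0 ≤ μ/8 by positivity)
    have y3 := mul_le_mul_of_nonneg_left hQ (show 0 ≤ 2/μ * (ε⁻¹ * ε⁻¹) by positivity)
    have y4 : 0 ≤ 9/μ * (ε⁻¹ * ε⁻¹) * (S.v t x ^ 2 + S.w t x ^ 2) := by positivity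
    refine y1.trans ?_
    have e : 9/μ = 9/2 * (2/μ) := by ring
    rw [e] at y4 ⊢
    simp only [so, Pi.add_apply, Pi.mul_apply]
    nlinarith only [y2, y3, y4]
  have kd : ∀ x, S.d t x ^ 2 ≤ 2 * S.gψ t x := by
      intro x
      simp only [d, gψ, Pi.add_apply, Pi.mul_apply]
      nlinarith only [sq_nonneg (D1 S.v t x - D2 S.w t x), sq_nonneg (D2 S.v t x), sq_nonneg (D1 S.w t x)]
  have kg : ∀ x, 0 ≤ S.gψ t x := fun x => by linarith [kd x, sq_nonneg (S.d t x)]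
  constructor
  · rw [← J_add_eq]
    simp only [← J_smul_eq]
    rw [← J_add_eq, ← J_sub_eq]
    refine J_le fun x hx => ?_
    have := key x hx
    simp only [e1, Pi.add_apply, Pi.mul_apply, Pi.sub_apply, Pi.smul_apply, smul_eq_mul] at *
    have := (abs_le.1 this).2
    have h2 := mul_nonneg hl (mul_self_nonneg (S.d t x))
    linarith only [this, h2]
  · rw [← J_add_eq]
    simp only [← J_smul_eq]
    rw [← J_add_eq, ← J_add_eq]
    refine J_le fun x hx => ?_
    have := key x hx
    simp only [e1, Pi.add_apply, Pi.mul_apply, Pi.sub_apply, Pi.smul_apply, smul_eq_mul] at *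
    have := (abs_le.1 this).1
    have h2 := mul_le_mul_of_nonneg_left (kd x) hl
    have h3 := mul_nonneg hμ.le (kg x)
    linarith only [this, h2, h3]

end Sys

namespace Sys
variable {μ lam κ g1 r M ε T : ℝ} (S : Sys μ lam κ g1 r M ε T)

/-- total dissipation -/
def Wt : Fld := S.W5 + S.W6 + S.Hb
instance : SM S.Wt := by unfold Wt; infer_instance

theorem main (μ lam κ g1 r M k : ℝ) (hM : 1 ≤ M) (hμ : 0 < μ) (hr : 0 < 1 + r)
    (hlam : lam = (1 + r) * μ) (hg : 0 < g1) (hk : 0 < k) (hk1 : k ≤ 1) (hκ : k * μ ≤ κ)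
    (hC : 2 * ((20 + 2 * g1) * M) ≤ k * μ / 8) :
    ∃ ε2 C : ℝ, 0 < ε2 ∧ 0 < C ∧ ∀ {ε T : ℝ} (S : Sys μ lam κ g1 r M ε T), 0 < ε → ε ≤ ε2 →
      ∀ t ∈ Set.Icc 0 T, (J S.gψ t + J S.gb t + J S.ga t) + (∫ s in (0:ℝ)..t, J S.Wt s) ≤
        C * (J S.gψ 0 + J S.gb 0 + J S.ga 0 + ε⁻¹ * ε⁻¹ * (J S.so 0 + J (S.a * S.a) 0)) := by
  have hl : 0 ≤ lam := by rw [hlam]; positivity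
  have hκ0 : 0 < κ := lt_of_lt_of_le (by positivity) hκ
  obtain ⟨c1, C1, hc1, hC1, H1⟩ := L1 μ lam κ g1 r M hM hμ hg
  obtain ⟨C2, hC2, H2⟩ := L2 μ lam κ g1 r M hM hμ hl
  obtain ⟨c3, C3, hc3, hC3, H3⟩ := L3 μ lam κ g1 r M hM hμ hl
  obtain ⟨C5, hC5, H5⟩ := L5 μ lam κ g1 r M hM hμ hl hκ0 hg
  set c0 := k * μ / 4 with hc0
  have hc0' : 0 < c0 := by positivity
  set k2 := (C3 + 1) / (μ/2) with hk2
  have hk2' : 0 < k2 := by positivity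
  have e2 : k2 * (μ/2) = C3 + 1 := by rw [hk2]; field_simp
  set k1 := (k2 * C2 + C3 + 1) / c1 with hkk1
  have hk1' : 0 < k1 := by positivity
  have e1 : k1 * c1 = k2 * C2 + C3 + 1 := by rw [hkk1]; field_simp
  set cg := min (1/8) (g1/4) with hcg
  have hcg0 : 0 < cg := by rw [hcg]; exact lt_min (by norm_num) (by positivity)
  set k0 := (2 * (k1 * C1 + k2 * C2 + C3) + 1) / c0 + k1 * (9/μ) / cg with hkk0
  have hk0' : 0 < k0 := by positivity
  have e0 : 2 * (k1 * C1 + k2 * C2 + C3) + 1 ≤ k0 * c0 := by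
    rw [hkk0, add_mul, div_mul_cancel₀ _ hc0'.ne']
    have : 0 ≤ k1 * (9/μ) / cg * c0 := by positivity
    linarith
  have e0' : k1 * (9/μ) ≤ k0 * cg := by
    rw [hkk0, add_mul, div_mul_cancel₀ _ hcg0.ne']
    have : 0 ≤ (2 * (k1 * C1 + k2 * C2 + C3) + 1) / c0 * cg := by positivity
    linarith
  set c := min 1 c3 with hc
  have hc' : 0 < c := lt_min one_pos hc3
  set m := 200 * M ^ 4 with hm
  have hm' : 0 < m := by positivity
  set K := (k0 * m + 201 * (k1 * C1 + k2 * C2 + C3) + (k2 * C2 + C3)) * (4 * (1 + C5)) with hK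
  have hK' : 0 < K := by positivity
  set C6 := 4 * (1 + C5) with hC6
  have hC6' : 0 < C6 := by positivity
  set η := c / 2 / C6 with hη
  have hη' : 0 < η := by positivity
  set cm := min (min (k1 * (μ/4)) (k1 * (κ/2))) (min (min (k2/2) (1/2)) η) with hcm
  have hcm' : 0 < cm := by
    rw [hcm]; refine lt_min (lt_min ?_ ?_) (lt_min (lt_min ?_ ?_) ?_) <;> positivity
  have m1 : cm ≤ k1 * (μ/4) := (min_le_left _ _).trans (min_le_left _ _)
  have m2 : cm ≤ k1 * (κ/2) := (min_le_left _ _).trans (min_le_right _ _)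
  have m3 : cm ≤ k2/2 := (min_le_right _ _).trans ((min_le_left _ _).trans (min_le_left _ _))
  have m4 : cm ≤ 1/2 := (min_le_right _ _).trans ((min_le_left _ _).trans (min_le_right _ _))
  have m5 : cm ≤ η := (min_le_right _ _).trans (min_le_right _ _)
  set Cb := k0 * (2 + g1) + k1 * (μ + lam + κ + 9/μ) + k2 + 1 with hCb
  have hCb' : 0 < Cb := by positivity
  refine ⟨min (min (1 / (16 * M)) (k / 8 / (20 * (1 + |r|) * M))) (min (min 1 (1 / (402 * (1 + C5)))) (c / 2 / K)),
    Cb / cm, ?_, by positivity, ?_⟩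
  · refine lt_min (lt_min ?_ ?_) (lt_min (lt_min ?_ ?_) ?_) <;> positivity
  intro ε T S h0 hε t ht
  have ε1 : M * ε ≤ 1/16 := by
    have := hε.trans ((min_le_left _ _).trans (min_le_left _ _))
    rw [le_div_iff₀ (by positivity)] at this; linarith
  have ε2 : 20 * (1 + |r|) * (M * ε) ≤ k / 8 := by
    have := hε.trans ((min_le_left _ _).trans (min_le_right _ _))
    rw [le_div_iff₀ (by positivity)] at this; linarith
  have ε3 : ε ≤ 1 := hε.trans ((min_le_right _ _).trans ((min_le_left _ _).trans (min_le_left _ _)))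
  have ε4 : 402 * (1 + C5) * ε ≤ 1 := by
    have := hε.trans ((min_le_right _ _).trans ((min_le_left _ _).trans (min_le_right _ _)))
    rw [le_div_iff₀ (by positivity)] at this; linarith
  have ε5 : ε * K ≤ c / 2 := by
    have := hε.trans ((min_le_right _ _).trans (min_le_right _ _))
    rwa [le_div_iff₀ (by positivity)] at this
  clear hε
  have hei : 0 < ε⁻¹ := inv_pos.2 h0
  have hee : ε⁻¹ * ε = 1 := inv_mul_cancel₀ h0.ne'
  -- the differential inequality
  have diff : ∀ s ∈ Set.Ioo 0 T, k0 * (ε⁻¹ * ε⁻¹ * J (Dt S.e0) s) + k1 * J (Dt S.e1) s + k2 * J (Dt S.e2) s + J (Dt S.e3) s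
      ≤ -η * J S.Wt s := by
    intro s hs
    have hs' : s ∈ Set.Icc 0 T := Set.Ioo_subset_Icc_self hs
    have q0 := S.L0 hM h0 ε1 hμ hr hlam hg hk hk1 hκ ε2 hC hs'
    have q1 := H1 S h0 ε1 s hs
    have q2 := H2 S h0 ε1 s hs'
    have q3 := H3 S h0 ε1 s hs'
    have q5 := H5 S h0 ε1 s hs'
    have qa := S.a_le h0 hs'
    have qs := S.sF_le h0 hs'
    have hWe : J S.W5 s = ε⁻¹ * ε⁻¹ * J (D2 S.a * D2 S.a) s + J S.N s + J S.pt s + J S.sF s := by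
      simp only [W5, J_add_eq, J_smul_eq]
    have hN : 0 ≤ J S.N s := J_nonneg fun x hx => by
      simp only [N, Pi.add_apply, Pi.mul_apply]
      linarith only [mul_self_nonneg (D1 (D2 S.v) s x), mul_self_nonneg (D1 (D2 S.w) s x), mul_self_nonneg (D1 (D1 S.v) s x), mul_self_nonneg (D1 (D1 S.w) s x)]
    have hP : 0 ≤ J S.pt s := J_nonneg fun x hx => by
      simp only [pt, Pi.add_apply, Pi.mul_apply]
      linarith only [mul_self_nonneg (Dt S.v s x), mul_self_nonneg (Dt S.w s x), mul_self_nonneg (Dt S.b s x)]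
    have hH : 0 ≤ J S.Hb s := J_nonneg fun x hx => by
      simp only [Hb, Pi.add_apply, Pi.mul_apply]
      linarith only [mul_self_nonneg (D1 (D2 S.b) s x), mul_self_nonneg (D1 (D1 S.b) s x), mul_self_nonneg (D2 (D2 S.b) s x)]
    have hsF : 0 ≤ J S.sF s := J_nonneg fun x hx => S.sF0 s x
    have hA := mul_nonneg (mul_self_nonneg ε⁻¹) (J_sq_nonneg (D2 S.a) s)
    have hG := mul_nonneg (mul_self_nonneg ε⁻¹) (add_nonneg (S.gψ0 s) (S.gb0 s))
    have hg0 := S.ga0 s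
    have hW6 : ε⁻¹ * ε⁻¹ * J (D1 S.a * D1 S.a) s ≤ J S.W6 s := by
      simp only [W6, J_add_eq, J_smul_eq]
      linarith only [J_sq_nonneg (Dt S.a) s, J_sq_nonneg (D2 (D2 S.v)) s, J_sq_nonneg (D2 (D2 S.w)) s]
    have hga : ε⁻¹ * ε⁻¹ * J S.ga s ≤ (1 + C5) * J S.W5 s := by
      simp only [ga, J_add_eq]
      linarith only [hW6, q5, hH, hWe, hN, hP, hsF]
    have hgi : ε⁻¹ * J S.ga s ≤ ε * ((1 + C5) * J S.W5 s) := by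
      have := mul_le_mul_of_nonneg_left hga h0.le
      calc ε⁻¹ * J S.ga s = ε * (ε⁻¹ * ε⁻¹ * J S.ga s) := by field_simp
        _ ≤ _ := this
    have hgg : J S.ga s ≤ ε * ((1 + C5) * J S.W5 s) := by
      refine le_trans ?_ hgi
      have : 1 ≤ ε⁻¹ := (one_le_inv₀ h0).2 ε3
      exact le_mul_of_one_le_left hg0 this
    have i0 : ε⁻¹ * ε⁻¹ * J (Dt S.e0) s ≤ -c0 * (ε⁻¹ * ε⁻¹ * (J S.gψ s + J S.gb s)) + m * J S.ga s := by
      have z1 := mul_le_mul_of_nonneg_left q0 (mul_self_nonneg ε⁻¹)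
      have z2 := mul_le_mul_of_nonneg_left qa (show 0 ≤ M ^ 4 by positivity)
      have z3 : ε⁻¹ * ε⁻¹ * (M ^ 4 * ε ^ 2 * J (S.a * S.a) s) = M ^ 4 * J (S.a * S.a) s := by field_simp
      rw [hm, hc0]
      nlinarith only [z1, z2, z3]
    obtain ⟨f1, f2⟩ := comb hC1 hC2 hC3 hC5 hm' hk0' hk1' hk2' e2 e1 e0 (min_le_left _ _) (min_le_right _ _)
      h0 ε3 ε4 ε5 hG hP hN hA hg0 qs hWe hgi hgg i0 q1 q2 q3
    refine f1.trans ?_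
    have f3 : J S.Wt s ≤ C6 * (ε⁻¹ * ε⁻¹ * J (D2 S.a * D2 S.a) s + J S.N s + J S.pt s + ε⁻¹ * ε⁻¹ * (J S.gψ s + J S.gb s)) := by
      have e : J S.Wt s = J S.W5 s + J S.W6 s + J S.Hb s := by simp only [Wt, J_add_eq]
      have := mul_le_mul_of_nonneg_left f2 (show 0 ≤ 1 + C5 by positivity)
      rw [e, hC6]
      linarith only [this, q5]
    have f4 := mul_le_mul_of_nonneg_left f3 hη'.le
    have f5 : η * C6 = c / 2 := by rw [hη]; field_simp
    rw [← mul_assoc, f5] at f4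
    linarith only [f4]
  -- integrate
  set E : ℝ → ℝ := fun s => k0 * (ε⁻¹ * ε⁻¹ * J S.e0 s) + k1 * J S.e1 s + k2 * J S.e2 s + J S.e3 s with hE
  have dE : ∀ s, HasDerivAt E (k0 * (ε⁻¹ * ε⁻¹ * J (Dt S.e0) s) + k1 * J (Dt S.e1) s + k2 * J (Dt S.e2) s + J (Dt S.e3) s) s := by
    intro s
    exact (((((J_hasDerivAt (f := S.e0) SM.out s).const_mul _).const_mul _).add ((J_hasDerivAt (f := S.e1) SM.out s).const_mul _)).add
      ((J_hasDerivAt (f := S.e2) SM.out s).const_mul _)).add (J_hasDerivAt (f := S.e3) SM.out s)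
  have cE : Continuous fun s => (k0 * (ε⁻¹ * ε⁻¹ * J (Dt S.e0) s) + k1 * J (Dt S.e1) s + k2 * J (Dt S.e2) s + J (Dt S.e3) s) := by
    have a0 := J_cont (f := Dt S.e0) SM.out
    have a1 := J_cont (f := Dt S.e1) SM.out
    have a2 := J_cont (f := Dt S.e2) SM.out
    have a3 := J_cont (f := Dt S.e3) SM.out
    fun_prop
  have cW := J_cont (f := S.Wt) SM.out
  have ftc := intervalIntegral.integral_eq_sub_of_hasDerivAt (a := 0) (b := t) (fun s _ => dE s) (cE.intervalIntegrable _ _)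
  have hmono := intervalIntegral.integral_mono_on_of_le_Ioo (μ := volume) (a := 0) (b := t) ht.1 (cE.intervalIntegrable _ _)
    ((cW.const_mul (-η)).intervalIntegrable _ _) (fun s hs => diff s ⟨hs.1, hs.2.trans_le ht.2⟩)
  rw [ftc, intervalIntegral.integral_const_mul] at hmono
  have hW0 : 0 ≤ ∫ s in (0:ℝ)..t, J S.Wt s := by
    refine intervalIntegral.integral_nonneg ht.1 fun s hs => J_nonneg fun x hx => ?_
    have := S.sF0 s x
    simp only [Wt, W5, W6, Hb, N, pt, Pi.add_apply, Pi.mul_apply, Pi.sub_apply, Pi.smul_apply, smul_eq_mul]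
    have m1 := mul_nonneg (mul_self_nonneg ε⁻¹) (mul_self_nonneg (D2 S.a s x))
    have m2 := mul_nonneg (mul_self_nonneg ε⁻¹) (mul_self_nonneg (D1 S.a s x))
    linarith only [this, m1, m2, mul_self_nonneg (D1 (D2 S.v) s x), mul_self_nonneg (D1 (D2 S.w) s x), mul_self_nonneg (D1 (D1 S.v) s x), mul_self_nonneg (D1 (D1 S.w) s x), mul_self_nonneg (Dt S.v s x), mul_self_nonneg (Dt S.w s x), mul_self_nonneg (Dt S.b s x),
      mul_self_nonneg (D1 (D2 S.b) s x), mul_self_nonneg (D1 (D1 S.b) s x), mul_self_nonneg (D2 (D2 S.b) s x),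
      mul_self_nonneg (Dt S.a s x), mul_self_nonneg (D2 (D2 S.v) s x), mul_self_nonneg (D2 (D2 S.w) s x)]
  have ht0 : (0:ℝ) ∈ Set.Icc 0 T := ⟨le_rfl, ht.1.trans ht.2⟩
  -- lower bound at t
  have lo : cm * (J S.gψ t + J S.gb t + J S.ga t) ≤ E t := by
    have a0 := S.e0_lo hM h0 ε1 (min_le_left _ _) (min_le_right _ _) hg ht
    have a1 := (S.e1_b hM h0 ε1 hμ hl hκ0 ht).1
    have b0 := mul_le_mul_of_nonneg_left a0 (show 0 ≤ k0 * (ε⁻¹ * ε⁻¹) by positivity)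
    have b1 := mul_le_mul_of_nonneg_left a1 hk1'.le
    have hX : 0 ≤ ε⁻¹ * ε⁻¹ * (J S.so t + J (S.a * S.a) t) :=
      mul_nonneg (mul_self_nonneg _) (add_nonneg (S.so0 t) (J_sq_nonneg _ _))
    have b2 := mul_le_mul_of_nonneg_right e0' hX
    have d1 := mul_le_mul_of_nonneg_right m1 (S.gψ0 t)
    have d2 := mul_le_mul_of_nonneg_right m2 (S.gb0 t)
    have d3 := mul_le_mul_of_nonneg_right m3 (J_sq_nonneg (D1 S.a) t)
    have d4 := mul_le_mul_of_nonneg_right m4 (J_sq_nonneg (D2 S.a) t)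
    have ee2 : J S.e2 t = 1/2 * J (D1 S.a * D1 S.a) t := J_smul_eq
    have ee3 : J S.e3 t = 1/2 * J (D2 S.a * D2 S.a) t := J_smul_eq
    have eg : J S.ga t = J (D1 S.a * D1 S.a) t + J (D2 S.a * D2 S.a) t := by simp only [ga, J_add_eq]
    simp only [hE]
    rw [ee2, ee3, eg]
    linarith only [b0, b1, b2, d1, d2, d3, d4]
  have hi : E 0 ≤ Cb * (J S.gψ 0 + J S.gb 0 + J S.ga 0 + ε⁻¹ * ε⁻¹ * (J S.so 0 + J (S.a * S.a) 0)) := by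
    have a0 := S.e0_hi hM h0 ε1 hg ht0
    have a1 := (S.e1_b hM h0 ε1 hμ hl hκ0 ht0).2
    have b0 := mul_le_mul_of_nonneg_left a0 (show 0 ≤ k0 * (ε⁻¹ * ε⁻¹) by positivity)
    have b1 := mul_le_mul_of_nonneg_left a1 hk1'.le
    have hX : 0 ≤ ε⁻¹ * ε⁻¹ * (J S.so 0 + J (S.a * S.a) 0) :=
      mul_nonneg (mul_self_nonneg _) (add_nonneg (S.so0 0) (J_sq_nonneg _ _))
    have ee2 : J S.e2 0 = 1/2 * J (D1 S.a * D1 S.a) 0 := J_smul_eq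
    have ee3 : J S.e3 0 = 1/2 * J (D2 S.a * D2 S.a) 0 := J_smul_eq
    have eg : J S.ga 0 = J (D1 S.a * D1 S.a) 0 + J (D2 S.a * D2 S.a) 0 := by simp only [ga, J_add_eq]
    have n1 := S.gψ0 0
    have n2 := S.gb0 0
    have n3 := J_sq_nonneg (D1 S.a) 0
    have n4 := J_sq_nonneg (D2 S.a) 0
    simp only [hE]
    rw [ee2, ee3, eg, hCb]
    have hv : 0 < 9/μ := by positivity
    have b0' : k0 * (ε⁻¹ * ε⁻¹ * J S.e0 0) ≤ k0 * (2 + g1) * (ε⁻¹ * ε⁻¹ * (J S.so 0 + J (S.a * S.a) 0)) := by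
      linarith only [b0]
    clear b0 a0 a1
    generalize ε⁻¹ * ε⁻¹ * (J S.so 0 + J (S.a * S.a) 0) = X at *
    have p1 : 0 ≤ (k0 * (2 + g1) + k1*(κ+9/μ) + k2 + 1) * J S.gψ 0 := by positivity
    have p2 : 0 ≤ (k0 * (2 + g1) + k1*(μ+lam+κ/2+9/μ) + k2 + 1) * J S.gb 0 := by positivity
    have p3 : 0 ≤ (k0 * (2 + g1) + k1*(μ+lam+κ+9/μ) + k2/2 + 1) * J (D1 S.a * D1 S.a) 0 := by positivity
    have p4 : 0 ≤ (k0 * (2 + g1) + k1*(μ+lam+κ+9/μ) + k2 + 1/2) * J (D2 S.a * D2 S.a) 0 := by positivity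
    have p5 : 0 ≤ (k1*(μ+lam+κ) + k2 + 1) * X := by positivity
    linarith only [b0', b1, p1, p2, p3, p4, p5]
  have fin1 := mul_le_mul_of_nonneg_right m5 hW0
  rw [div_mul_eq_mul_div, le_div_iff₀ hcm']
  linarith only [fin1, lo, hi, hmono]
end Sys

theorem ifd_clm {E F : Type*} [NormedAddCommGroup E] [NormedSpace ℝ E] [NormedAddCommGroup F]
    [NormedSpace ℝ F] (L : E →L[ℝ] F) (hL : ‖L‖ ≤ 1) {g : ℝ × ℝ → E}
    (hg : ContDiff ℝ (⊤ : ℕ∞) g) (n : ℕ) (x : ℝ × ℝ) :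
    ‖iteratedFDeriv ℝ n (fun y => L (g y)) x‖ ≤ ‖iteratedFDeriv ℝ n g x‖ := by
  have h := L.norm_iteratedFDeriv_comp_left (n := n) (x := x) (f := g)
    (N := (⊤ : ℕ∞)) hg.contDiffAt (by exact_mod_cast le_top)
  have h2 : ‖L‖ * ‖iteratedFDeriv ℝ n g x‖ ≤ 1 * ‖iteratedFDeriv ℝ n g x‖ :=
    mul_le_mul_of_nonneg_right hL (norm_nonneg _)
  rw [one_mul] at h2
  exact h.trans h2

theorem cd_fderiv {E : Type*} [NormedAddCommGroup E] [NormedSpace ℝ E] {g : ℝ × ℝ → E}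
    (hg : ContDiff ℝ (⊤ : ℕ∞) g) : ContDiff ℝ (⊤ : ℕ∞) (fderiv ℝ g) :=
  ContDiff.fderiv_right hg (by simp)

theorem ifd_dir (e : ℝ × ℝ) (he : ‖e‖ ≤ 1) {g : ℝ × ℝ → ℝ}
    (hg : ContDiff ℝ (⊤ : ℕ∞) g) (n : ℕ) (x : ℝ × ℝ) :
    ‖iteratedFDeriv ℝ n (fun y => fderiv ℝ g y e) x‖ ≤ ‖iteratedFDeriv ℝ (n + 1) g x‖ := by
  rw [← norm_iteratedFDeriv_fderiv]
  refine ifd_clm (ContinuousLinearMap.apply ℝ ℝ e) ?_ (cd_fderiv hg) n x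
  refine ContinuousLinearMap.opNorm_le_bound _ (by norm_num) fun L => ?_
  rw [one_mul]
  exact (L.le_opNorm e).trans (mul_le_of_le_one_right (norm_nonneg _) he)

theorem ifd_le {g : ℝ × ℝ → ℝ} (hg : ContDiff ℝ (⊤ : ℕ∞) g) (n : ℕ) (x : ℝ × ℝ) :
    ‖iteratedFDeriv ℝ (n + 1) g x‖ ≤
      ‖iteratedFDeriv ℝ n (d1 g) x‖ + ‖iteratedFDeriv ℝ n (d2 g) x‖ := by
  have h1 : ContDiff ℝ (⊤ : ℕ∞) (d1 g) := (cd_fderiv hg).clm_apply contDiff_const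
  have h2 : ContDiff ℝ (⊤ : ℕ∞) (d2 g) := (cd_fderiv hg).clm_apply contDiff_const
  let L1 : ℝ →L[ℝ] (ℝ × ℝ →L[ℝ] ℝ) :=
    (ContinuousLinearMap.id ℝ ℝ).smulRight (ContinuousLinearMap.fst ℝ ℝ ℝ)
  let L2 : ℝ →L[ℝ] (ℝ × ℝ →L[ℝ] ℝ) :=
    (ContinuousLinearMap.id ℝ ℝ).smulRight (ContinuousLinearMap.snd ℝ ℝ ℝ)
  have e : fderiv ℝ g = (fun y => L1 (d1 g y)) + (fun y => L2 (d2 g y)) := by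
    ext y
    · simp [L1, L2, d1, d2]
    · simp [L1, L2, d1, d2]
  have n1 : ‖L1‖ ≤ 1 := by
    refine ContinuousLinearMap.opNorm_le_bound _ (by norm_num) fun c => ?_
    refine ContinuousLinearMap.opNorm_le_bound _ (by positivity) fun z => ?_
    simp only [L1, ContinuousLinearMap.smulRight_apply, ContinuousLinearMap.id_apply, one_mul]
    rw [smul_apply, norm_smul]
    exact mul_le_mul_of_nonneg_left (norm_fst_le z) (norm_nonneg _)
  have n2 : ‖L2‖ ≤ 1 := by
    refine ContinuousLinearMap.opNorm_le_bound _ (by norm_num) fun c => ?_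
    refine ContinuousLinearMap.opNorm_le_bound _ (by positivity) fun z => ?_
    simp only [L2, ContinuousLinearMap.smulRight_apply, ContinuousLinearMap.id_apply, one_mul]
    rw [smul_apply, norm_smul]
    exact mul_le_mul_of_nonneg_left (norm_snd_le z) (norm_nonneg _)
  have c1 : ContDiff ℝ (⊤ : ℕ∞) (fun y => L1 (d1 g y)) := L1.contDiff.comp h1
  have c2 : ContDiff ℝ (⊤ : ℕ∞) (fun y => L2 (d2 g y)) := L2.contDiff.comp h2
  rw [← norm_iteratedFDeriv_fderiv, e, iteratedFDeriv_add_apply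
    (c1.of_le (by exact_mod_cast le_top)).contDiffAt (c2.of_le (by exact_mod_cast le_top)).contDiffAt]
  exact (norm_add_le _ _).trans (add_le_add (ifd_clm L1 n1 h1 n x) (ifd_clm L2 n2 h2 n x))

theorem ifd_fst {g : ℝ × ℝ → ℝ × ℝ} (hg : ContDiff ℝ (⊤ : ℕ∞) g) (n : ℕ) (x : ℝ × ℝ) :
    ‖iteratedFDeriv ℝ n (fun y => (g y).1) x‖ ≤ ‖iteratedFDeriv ℝ n g x‖ :=
  ifd_clm (ContinuousLinearMap.fst ℝ ℝ ℝ) (ContinuousLinearMap.norm_fst_le ..) hg n x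

theorem ifd_snd {g : ℝ × ℝ → ℝ × ℝ} (hg : ContDiff ℝ (⊤ : ℕ∞) g) (n : ℕ) (x : ℝ × ℝ) :
    ‖iteratedFDeriv ℝ n (fun y => (g y).2) x‖ ≤ ‖iteratedFDeriv ℝ n g x‖ :=
  ifd_clm (ContinuousLinearMap.snd ℝ ℝ ℝ) (ContinuousLinearMap.norm_snd_le ..) hg n x

theorem ifd_pair {g : ℝ × ℝ → ℝ × ℝ} (hg : ContDiff ℝ (⊤ : ℕ∞) g) (n : ℕ) (x : ℝ × ℝ) :
    ‖iteratedFDeriv ℝ n g x‖ ≤ ‖iteratedFDeriv ℝ n (fun y => (g y).1) x‖ +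
      ‖iteratedFDeriv ℝ n (fun y => (g y).2) x‖ := by
  have h1 : ContDiff ℝ (⊤ : ℕ∞) (fun y => (g y).1) := contDiff_fst.comp hg
  have h2 : ContDiff ℝ (⊤ : ℕ∞) (fun y => (g y).2) := contDiff_snd.comp hg
  have e : g = (fun y => ContinuousLinearMap.inl ℝ ℝ ℝ (g y).1) +
      (fun y => ContinuousLinearMap.inr ℝ ℝ ℝ (g y).2) := by
    ext y <;> simp
  have n1 : ‖ContinuousLinearMap.inl ℝ ℝ ℝ‖ ≤ 1 :=
    ContinuousLinearMap.opNorm_le_bound _ (by norm_num) fun c => by simp [Prod.norm_def]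
  have n2 : ‖ContinuousLinearMap.inr ℝ ℝ ℝ‖ ≤ 1 :=
    ContinuousLinearMap.opNorm_le_bound _ (by norm_num) fun c => by simp [Prod.norm_def]
  have c1 : ContDiff ℝ (⊤ : ℕ∞) (fun y => ContinuousLinearMap.inl ℝ ℝ ℝ (g y).1) :=
    (ContinuousLinearMap.inl ℝ ℝ ℝ).contDiff.comp h1
  have c2 : ContDiff ℝ (⊤ : ℕ∞) (fun y => ContinuousLinearMap.inr ℝ ℝ ℝ (g y).2) :=
    (ContinuousLinearMap.inr ℝ ℝ ℝ).contDiff.comp h2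
  conv_lhs => rw [e]
  rw [iteratedFDeriv_add_apply
    (c1.of_le (by exact_mod_cast le_top)).contDiffAt (c2.of_le (by exact_mod_cast le_top)).contDiffAt]
  exact (norm_add_le _ _).trans (add_le_add (ifd_clm _ n1 h1 n x) (ifd_clm _ n2 h2 n x))

theorem dSq_int {E : Type*} [NormedAddCommGroup E] [NormedSpace ℝ E] {g : ℝ × ℝ → E}
    (hg : ContDiff ℝ (⊤ : ℕ∞) g) (n : ℕ) :
    IntegrableOn (fun x => ‖iteratedFDeriv ℝ n g x‖ ^ 2) Ω :=
  intOn (((hg.continuous_iteratedFDeriv (m := n) (by exact_mod_cast le_top)).norm).pow 2)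

theorem dSq_nonneg {E : Type*} [NormedAddCommGroup E] [NormedSpace ℝ E] (g : ℝ × ℝ → E)
    (n : ℕ) : 0 ≤ dSq n g := integral_nonneg fun x => by positivity

theorem HSq_nonneg {E : Type*} [NormedAddCommGroup E] [NormedSpace ℝ E] (g : ℝ × ℝ → E)
    (n : ℕ) : 0 ≤ HSq n g := Finset.sum_nonneg fun j _ => dSq_nonneg g j

theorem dSq_mono {E F : Type*} [NormedAddCommGroup E] [NormedSpace ℝ E]
    [NormedAddCommGroup F] [NormedSpace ℝ F] {g : ℝ × ℝ → E} {h : ℝ × ℝ → F}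
    (hg : ContDiff ℝ (⊤ : ℕ∞) g) (hh : ContDiff ℝ (⊤ : ℕ∞) h) {n m : ℕ}
    (H : ∀ x, ‖iteratedFDeriv ℝ n g x‖ ≤ ‖iteratedFDeriv ℝ m h x‖) : dSq n g ≤ dSq m h := by
  refine setIntegral_mono (dSq_int hg n) (dSq_int hh m) fun x => ?_
  have := H x
  show ‖iteratedFDeriv ℝ n g x‖ ^ 2 ≤ ‖iteratedFDeriv ℝ m h x‖ ^ 2
  gcongr

theorem dSq_add {E F G : Type*} [NormedAddCommGroup E] [NormedSpace ℝ E]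
    [NormedAddCommGroup F] [NormedSpace ℝ F] [NormedAddCommGroup G] [NormedSpace ℝ G]
    {g : ℝ × ℝ → E} {h : ℝ × ℝ → F} {k : ℝ × ℝ → G}
    (hg : ContDiff ℝ (⊤ : ℕ∞) g) (hh : ContDiff ℝ (⊤ : ℕ∞) h) (hk : ContDiff ℝ (⊤ : ℕ∞) k)
    {n m l : ℕ}
    (H : ∀ x, ‖iteratedFDeriv ℝ n g x‖ ≤ ‖iteratedFDeriv ℝ m h x‖ + ‖iteratedFDeriv ℝ l k x‖) :
    dSq n g ≤ 2 * dSq m h + 2 * dSq l k := by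
  have i1 := (dSq_int hh m).const_mul 2
  have i2 := (dSq_int hk l).const_mul 2
  have e : 2 * dSq m h + 2 * dSq l k = ∫ x in Ω, (2 * ‖iteratedFDeriv ℝ m h x‖ ^ 2
      + 2 * ‖iteratedFDeriv ℝ l k x‖ ^ 2) := by
    rw [integral_add i1 i2, integral_const_mul, integral_const_mul]; rfl
  rw [e]
  refine setIntegral_mono (dSq_int hg n) (i1.add i2) fun x => ?_
  have h1 := H x
  have h0 := norm_nonneg (iteratedFDeriv ℝ n g x)
  show ‖iteratedFDeriv ℝ n g x‖ ^ 2 ≤ 2 * ‖iteratedFDeriv ℝ m h x‖ ^ 2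
      + 2 * ‖iteratedFDeriv ℝ l k x‖ ^ 2
  have h2 := pow_le_pow_left₀ h0 h1 2
  have h3 := sq_nonneg (‖iteratedFDeriv ℝ m h x‖ - ‖iteratedFDeriv ℝ l k x‖)
  linarith only [h2, h3]

theorem dSq_zero (f : Fld) (s : ℝ) : dSq 0 (f s) = J (f * f) s := by
  unfold dSq J
  refine setIntegral_congr_fun Ω_meas fun x _ => ?_
  simp [norm_iteratedFDeriv_zero, sq]

variable {f : Fld}

theorem dSq_D1_le (hf : Sm f) (n : ℕ) (s : ℝ) : dSq n (D1 f s) ≤ dSq (n + 1) (f s) :=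
  dSq_mono (hf.D1.slice s) (hf.slice s) fun x =>
    ifd_dir (1, 0) (by simp [Prod.norm_def]) (hf.slice s) n x

theorem dSq_D2_le (hf : Sm f) (n : ℕ) (s : ℝ) : dSq n (D2 f s) ≤ dSq (n + 1) (f s) :=
  dSq_mono (hf.D2.slice s) (hf.slice s) fun x =>
    ifd_dir (0, 1) (by simp [Prod.norm_def]) (hf.slice s) n x

theorem dSq_succ_le (hf : Sm f) (n : ℕ) (s : ℝ) :
    dSq (n + 1) (f s) ≤ 2 * dSq n (D1 f s) + 2 * dSq n (D2 f s) :=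
  dSq_add (hf.slice s) (hf.D1.slice s) (hf.D2.slice s) fun x => ifd_le (hf.slice s) n x

/-- Smooth vector-valued space-time fields. -/
abbrev VSm (ψ : ℝ → ℝ × ℝ → ℝ × ℝ) : Prop := ContDiff ℝ (⊤ : ℕ∞) (Function.uncurry ψ)

def C1 (ψ : ℝ → ℝ × ℝ → ℝ × ℝ) : Fld := fun t x => (ψ t x).1
def C2 (ψ : ℝ → ℝ × ℝ → ℝ × ℝ) : Fld := fun t x => (ψ t x).2

variable {ψ : ℝ → ℝ × ℝ → ℝ × ℝ}

theorem VSm.c1 (h : VSm ψ) : Sm (C1 ψ) := contDiff_fst.comp h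
theorem VSm.c2 (h : VSm ψ) : Sm (C2 ψ) := contDiff_snd.comp h
theorem VSm.slice (h : VSm ψ) (t : ℝ) : ContDiff ℝ (⊤ : ℕ∞) (ψ t) := by
  have : ψ t = Function.uncurry ψ ∘ (fun x => (t, x)) := by ext x <;> rfl
  rw [this]
  exact ContDiff.comp h (by fun_prop)

theorem VSm.dt_eq (h : VSm ψ) (t : ℝ) (x : ℝ × ℝ) :
    dt ψ t x = (Dt (C1 ψ) t x, Dt (C2 ψ) t x) := by
  have h1 := hasDerivAt_Dt h.c1 t x
  have h2 := hasDerivAt_Dt h.c2 t x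
  exact (h1.prodMk h2).deriv

theorem VSm.dt (h : VSm ψ) : VSm (dt ψ) := by
  have e : Couette.dt ψ = fun t x => (Dt (C1 ψ) t x, Dt (C2 ψ) t x) := by
    ext t x <;> rw [h.dt_eq]
  rw [e]
  exact ContDiff.prodMk h.c1.Dt h.c2.Dt

theorem VSm.dSq_c1 (h : VSm ψ) (n : ℕ) (s : ℝ) : dSq n (C1 ψ s) ≤ dSq n (ψ s) :=
  dSq_mono (h.c1.slice s) (h.slice s) fun x => ifd_fst (h.slice s) n x
theorem VSm.dSq_c2 (h : VSm ψ) (n : ℕ) (s : ℝ) : dSq n (C2 ψ s) ≤ dSq n (ψ s) :=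
  dSq_mono (h.c2.slice s) (h.slice s) fun x => ifd_snd (h.slice s) n x
theorem VSm.dSq_le (h : VSm ψ) (n : ℕ) (s : ℝ) :
    dSq n (ψ s) ≤ 2 * dSq n (C1 ψ s) + 2 * dSq n (C2 ψ s) :=
  dSq_add (h.slice s) (h.c1.slice s) (h.c2.slice s) fun x => ifd_pair (h.slice s) n x

/-- local boundedness in time -/
def LB (g : ℝ → ℝ) : Prop := ∃ B : ℝ → ℝ, Continuous B ∧ ∀ s, g s ≤ B s

theorem LB.add {g h : ℝ → ℝ} (hg : LB g) (hh : LB h) : LB (fun s => g s + h s) := by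
  obtain ⟨B, c, b⟩ := hg
  obtain ⟨B', c', b'⟩ := hh
  exact ⟨fun s => B s + B' s, c.add c', fun s => add_le_add (b s) (b' s)⟩

theorem LB.mul {g : ℝ → ℝ} (hg : LB g) {c : ℝ} (hc : 0 ≤ c) : LB (fun s => c * g s) := by
  obtain ⟨B, k, b⟩ := hg
  exact ⟨fun s => c * B s, k.const_mul c, fun s => mul_le_mul_of_nonneg_left (b s) hc⟩

theorem LB.of_le {g h : ℝ → ℝ} (hh : LB h) (H : ∀ s, g s ≤ h s) : LB g := by
  obtain ⟨B, k, b⟩ := hh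
  exact ⟨B, k, fun s => (H s).trans (b s)⟩

theorem Sm.lb (n : ℕ) : ∀ {f : Fld}, Sm f → LB (fun s => dSq n (f s)) := by
  induction n with
  | zero => exact fun {f} hf => ⟨J (f * f), J_cont (hf.mul hf), fun s => (dSq_zero f s).le⟩
  | succ n ih => exact fun {f} hf =>
      (((ih hf.D1).mul zero_le_two).add ((ih hf.D2).mul zero_le_two)).of_le fun s =>
        dSq_succ_le hf n s

theorem VSm.lb (h : VSm ψ) (n : ℕ) : LB (fun s => dSq n (ψ s)) :=
  (((h.c1.lb n).mul zero_le_two).add ((h.c2.lb n).mul zero_le_two)).of_le fun s => h.dSq_le n s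

theorem biSup_ge {g : ℝ → ℝ} (h0 : ∀ s, 0 ≤ g s) (hb : LB g) {t s : ℝ}
    (hs : s ∈ Set.Icc 0 t) : g s ≤ ⨆ u ∈ Set.Icc (0 : ℝ) t, g u := by
  obtain ⟨B, c, b⟩ := hb
  obtain ⟨K, hK⟩ := (isCompact_Icc (a := (0 : ℝ)) (b := t)).bddAbove_image c.continuousOn
  have hK' : ∀ u ∈ Set.Icc (0 : ℝ) t, g u ≤ K := fun u hu =>
    (b u).trans (hK (Set.mem_image_of_mem _ hu))
  have hK0 : 0 ≤ K := (h0 s).trans (hK' s hs)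
  have bd : BddAbove (Set.range fun u => ⨆ (_ : u ∈ Set.Icc (0 : ℝ) t), g u) := by
    refine ⟨K, ?_⟩
    rintro _ ⟨u, rfl⟩
    exact Real.iSup_le (fun h => hK' u h) hK0
  have h1 := le_ciSup bd s
  have h2 : (⨆ (_ : s ∈ Set.Icc (0 : ℝ) t), g s) = g s := ciSup_pos hs
  exact h2.symm.le.trans h1

theorem biSup_le {g : ℝ → ℝ} {K t : ℝ} (hK : 0 ≤ K) (h : ∀ u ∈ Set.Icc (0 : ℝ) t, g u ≤ K) :
    ⨆ u ∈ Set.Icc (0 : ℝ) t, g u ≤ K :=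
  Real.iSup_le (fun u => Real.iSup_le (fun hu => h u hu) hK) hK

theorem biSup_nonneg {g : ℝ → ℝ} (h0 : ∀ s, 0 ≤ g s) (t : ℝ) :
    0 ≤ ⨆ u ∈ Set.Icc (0 : ℝ) t, g u :=
  Real.iSup_nonneg fun u => Real.iSup_nonneg fun _ => h0 u

theorem iint_le {g h : ℝ → ℝ} (h0 : ∀ s, 0 ≤ g s) (hh : Continuous h) {t : ℝ} (ht : 0 ≤ t)
    (H : ∀ s ∈ Set.Icc (0 : ℝ) t, g s ≤ h s) :
    ∫ s in (0 : ℝ)..t, g s ≤ ∫ s in (0 : ℝ)..t, h s := by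
  rw [intervalIntegral.integral_of_le ht, intervalIntegral.integral_of_le ht]
  refine integral_mono_of_nonneg (Eventually.of_forall h0) ?_ ?_
  · exact (hh.intervalIntegrable (μ := volume) 0 t).1
  · exact (ae_restrict_iff' measurableSet_Ioc).2 (Eventually.of_forall fun s hs => H s ⟨hs.1.le, hs.2⟩)

/-! ### The background state -/

theorem loc_fderiv {f g : ℝ × ℝ → ℝ} (h : ∀ x ∈ Ω, f x = g x) {x : ℝ × ℝ} (hx : x ∈ Ω) :
    fderiv ℝ f x = fderiv ℝ g x :=
  Filter.EventuallyEq.fderiv_eq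
    (Filter.eventually_of_mem (Ω_open.mem_nhds hx) h)

theorem loc_D2 {f g : Fld} {t : ℝ} (h : ∀ x ∈ Ω, f t x = g t x) {x : ℝ × ℝ} (hx : x ∈ Ω) :
    D2 f t x = D2 g t x := by
  show fderiv ℝ (f t) x _ = fderiv ℝ (g t) x _
  rw [loc_fderiv h hx]

/-- A smooth positive function equal to the identity on `[1/4,∞)`. -/
def hcut (y : ℝ) : ℝ := Real.smoothTransition (8 * y - 1) * y + (1 - Real.smoothTransition (8 * y - 1))

theorem hcut_smooth : ContDiff ℝ (⊤ : ℕ∞) hcut := by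
  have h : ContDiff ℝ (⊤ : ℕ∞) (fun y : ℝ => Real.smoothTransition (8 * y - 1)) :=
    Real.smoothTransition.contDiff.comp (by fun_prop)
  unfold hcut
  exact (h.mul contDiff_id).add (contDiff_const.sub h)

theorem hcut_pos (y : ℝ) : 0 < hcut y := by
  unfold hcut
  have h0 := Real.smoothTransition.nonneg (8 * y - 1)
  have h1 := Real.smoothTransition.le_one (8 * y - 1)
  rcases le_or_gt y (1 / 8) with h | h
  · rw [Real.smoothTransition.zero_of_nonpos (by linarith)]; norm_num
  · nlinarith

theorem hcut_eq {y : ℝ} (h : 1 / 4 ≤ y) : hcut y = y := by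
  unfold hcut
  rw [Real.smoothTransition.one_of_one_le (by linarith)]; ring

def Θf (c ε χ : ℝ) : Fld := fun _ x => χ + (1 - χ) * x.2 - ε ^ 2 * c * (x.2 ^ 2 - x.2)
def Rf (c ε χ : ℝ) : Fld := fun t x => (hcut (Θf c ε χ t x))⁻¹

theorem Θf_sm (c ε χ : ℝ) : Sm (Θf c ε χ) := by
  unfold Sm Θf Function.uncurry
  fun_prop

theorem Rf_sm (c ε χ : ℝ) : Sm (Rf c ε χ) := by
  have h : ContDiff ℝ (⊤ : ℕ∞) (fun z => hcut (Function.uncurry (Θf c ε χ) z)) :=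
    hcut_smooth.comp (Θf_sm c ε χ)
  exact h.inv fun z => (hcut_pos _).ne'

theorem D1_of_const {f : Fld} (hf : Sm f) (h : ∀ t a b c, f t (a, c) = f t (b, c)) : D1 f = 0 := by
  ext t x
  have h1 := slice1 hf t x.1 x.2
  have h2 : (fun s => f t (s, x.2)) = fun _ => f t (0, x.2) := by
    ext s; exact h t s 0 x.2
  rw [h2] at h1
  exact h1.unique (hasDerivAt_const _ _)

theorem Dt_of_const {f : Fld} (h : ∀ t s x, f t x = f s x) : Dt f = 0 := by
  ext t x
  show deriv (fun s => f s x) t = 0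
  have h2 : (fun s => f s x) = fun _ => f 0 x := by
    ext s; exact h s 0 x
  rw [h2]; exact deriv_const t _

theorem D2_Θf (c ε χ : ℝ) : D2 (Θf c ε χ) = fun _ x => (1 - χ) - ε ^ 2 * c * (2 * x.2 - 1) := by
  ext t x
  have h1 := slice2 (Θf_sm c ε χ) t x.1 x.2
  refine h1.unique ?_
  have h := (((hasDerivAt_id x.2).const_mul (1 - χ)).const_add χ).sub
    ((((hasDerivAt_id x.2).pow 2).sub (hasDerivAt_id x.2)).const_mul (ε ^ 2 * c))
  refine HasDerivAt.congr_deriv h ?_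
  simp

theorem D22_Θf (c ε χ : ℝ) : D2 (D2 (Θf c ε χ)) = fun _ x => - (2 * (ε ^ 2 * c)) := by
  ext t x
  have h1 := slice2 (Θf_sm c ε χ).D2 t x.1 x.2
  refine h1.unique ?_
  rw [D2_Θf]
  have h := ((((hasDerivAt_id x.2).const_mul 2).sub_const 1).const_mul (ε ^ 2 * c)).const_sub (1 - χ)
  refine HasDerivAt.congr_deriv h ?_
  ring

section bg
variable {c ε χ K : ℝ}

theorem Θf_ge (hc : 0 ≤ c) (hχ : |1 - χ| ≤ 1 / 2) (t : ℝ) {x : ℝ × ℝ} (hx : x ∈ Ω)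
    : 1 / 2 ≤ Θf c ε χ t x := by
  obtain ⟨_, h0, h1⟩ := hx
  have h2 := abs_le.1 hχ
  have h3 : 0 ≤ ε ^ 2 * c * (x.2 - x.2 ^ 2) :=
    mul_nonneg (by positivity) (by nlinarith)
  have h4 : (1 - χ) * (1 - x.2) ≤ 1 / 2 * 1 :=
    mul_le_mul h2.2 (by linarith) (by linarith) (by norm_num)
  unfold Θf
  linarith

theorem Θf_bd (hc : 0 ≤ c) (hε : 0 < ε) (hε1 : ε ≤ 1) (hK : |1 - χ| ≤ K * ε) (t : ℝ) {x : ℝ × ℝ} (hx : x ∈ Ω)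
    : |Θf c ε χ t x - 1| ≤ (K + c) * ε := by
  obtain ⟨_, h0, h1⟩ := hx
  have e : Θf c ε χ t x - 1 = - ((1 - χ) * (1 - x.2)) + ε ^ 2 * c * (x.2 * (1 - x.2)) := by
    unfold Θf; ring
  rw [e]
  have a1 : |(1 - χ) * (1 - x.2)| ≤ K * ε * 1 := bm hK (abs_le.2 ⟨by linarith, by linarith⟩)
  have a2 : |x.2 * (1 - x.2)| ≤ 1 := abs_le.2 ⟨by nlinarith, by nlinarith⟩
  have a3 : |ε ^ 2 * c| ≤ ε * c := by
    rw [abs_of_nonneg (by positivity)]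
    exact mul_le_mul_of_nonneg_right (by nlinarith) hc
  have a4 := bm a3 a2
  have a5 := ba (x := -((1 - χ) * (1 - x.2))) (A := K * ε * 1) (by rw [abs_neg]; exact a1) a4
  linarith

theorem Θf2_bd (hc : 0 ≤ c) (hε : 0 < ε) (hε1 : ε ≤ 1) (hK : |1 - χ| ≤ K * ε) (t : ℝ) {x : ℝ × ℝ} (hx : x ∈ Ω)
    : |D2 (Θf c ε χ) t x| ≤ (K + c) * ε := by
  obtain ⟨_, h0, h1⟩ := hx
  rw [D2_Θf]
  have a2 : |2 * x.2 - 1| ≤ 1 := abs_le.2 ⟨by linarith, by linarith⟩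
  have a3 : |ε ^ 2 * c| ≤ ε * c := by
    rw [abs_of_nonneg (by positivity)]
    exact mul_le_mul_of_nonneg_right (by nlinarith) hc
  have a5 := bs hK (bm a3 a2)
  linarith

theorem RΘ_one (hc : 0 ≤ c) (hχ : |1 - χ| ≤ 1 / 2) (t : ℝ) {x : ℝ × ℝ} (hx : x ∈ Ω)
    : Rf c ε χ t x * Θf c ε χ t x = 1 := by
  have h := Θf_ge (ε := ε) hc hχ t hx
  unfold Rf
  rw [hcut_eq (by linarith)]
  exact inv_mul_cancel₀ (by linarith)

theorem Rf_bd (hc : 0 ≤ c) (hχ : |1 - χ| ≤ 1 / 2) (t : ℝ) {x : ℝ × ℝ} (hx : x ∈ Ω)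
    : |Rf c ε χ t x| ≤ 2 := by
  have h := Θf_ge (ε := ε) hc hχ t hx
  unfold Rf
  rw [hcut_eq (by linarith), abs_inv, abs_of_pos (by linarith)]
  rw [inv_le_comm₀ (by linarith) (by norm_num)]
  linarith

theorem Rf_bd1 (hc : 0 ≤ c) (hε : 0 < ε) (hε1 : ε ≤ 1) (hK : |1 - χ| ≤ K * ε) (hχ : |1 - χ| ≤ 1 / 2) (t : ℝ) {x : ℝ × ℝ} (hx : x ∈ Ω)
    : |Rf c ε χ t x - 1| ≤ 2 * (K + c) * ε := by
  have h := RΘ_one (ε := ε) hc hχ t hx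
  have e : Rf c ε χ t x - 1 = -(Rf c ε χ t x * (Θf c ε χ t x - 1)) := by
    linear_combination h
  rw [e, abs_neg]
  have := bm (Rf_bd (ε := ε) hc hχ t hx) (Θf_bd hc hε hε1 hK t hx)
  linarith

theorem Rf_D2 (hc : 0 ≤ c) (hχ : |1 - χ| ≤ 1 / 2) (t : ℝ) {x : ℝ × ℝ} (hx : x ∈ Ω)
    : D2 (Rf c ε χ) t x = - (Rf c ε χ t x ^ 2 * D2 (Θf c ε χ) t x) := by
  have h := RΘ_one (ε := ε) hc hχ t hx
  have h1 : D2 (Rf c ε χ * Θf c ε χ) t x = D2 (fun _ _ => (1 : ℝ)) t x :=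
    loc_D2 (fun y hy => RΘ_one hc hχ t hy) hx
  have h2 : D2 (fun _ _ => (1 : ℝ)) t x = 0 := by
    show fderiv ℝ (fun _ : ℝ × ℝ => (1 : ℝ)) x _ = 0
    simp
  rw [D2_mul (Rf_sm c ε χ) (Θf_sm c ε χ), h2] at h1
  simp only [Pi.add_apply, Pi.mul_apply] at h1
  linear_combination Rf c ε χ t x * h1 - D2 (Rf c ε χ) t x * h

theorem Rf2_bd (hc : 0 ≤ c) (hε : 0 < ε) (hε1 : ε ≤ 1) (hK : |1 - χ| ≤ K * ε) (hχ : |1 - χ| ≤ 1 / 2) (t : ℝ) {x : ℝ × ℝ} (hx : x ∈ Ω)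
    : |D2 (Rf c ε χ) t x| ≤ 4 * (K + c) * ε := by
  rw [Rf_D2 hc hχ t hx, abs_neg, sq]
  have h := Rf_bd (ε := ε) hc hχ t hx
  have := bm (bm h h) (Θf2_bd hc hε hε1 hK t hx)
  linarith

theorem Rf22_bd (hc : 0 ≤ c) (hε : 0 < ε) (hε1 : ε ≤ 1) (hK : |1 - χ| ≤ K * ε) (hχ : |1 - χ| ≤ 1 / 2) (t : ℝ) {x : ℝ × ℝ} (hx : x ∈ Ω)
    (hK0 : 0 ≤ K) : |D2 (D2 (Rf c ε χ)) t x| ≤ (16 * (K + c) ^ 2 + 8 * c) * ε := by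
  have h1 : D2 (D2 (Rf c ε χ)) t x = D2 (-(Rf c ε χ * Rf c ε χ * D2 (Θf c ε χ))) t x :=
    loc_D2 (fun y hy => by
      rw [Rf_D2 hc hχ t hy, sq]; rfl) hx
  have sR := Rf_sm c ε χ
  have sΘ := Θf_sm c ε χ
  rw [h1, D2_neg ((sR.mul sR).mul sΘ.D2), D2_mul (sR.mul sR) sΘ.D2, D2_mul sR sR, D22_Θf]
  simp only [Pi.add_apply, Pi.mul_apply, Pi.neg_apply]
  rw [abs_neg]
  have b1 := Rf_bd (ε := ε) hc hχ t hx
  have b2 := Rf2_bd hc hε hε1 hK hχ t hx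
  have b3 := Θf2_bd hc hε hε1 hK t hx
  have b4 : |-(2 * (ε ^ 2 * c))| ≤ 2 * (ε * c) := by
    rw [abs_neg, abs_of_nonneg (by positivity)]
    have : ε ^ 2 * c ≤ ε * c := mul_le_mul_of_nonneg_right (by nlinarith) hc
    linarith
  refine (ba (bm (ba (bm b2 b1) (bm b1 b2)) b3) (bm (bm b1 b1) b4)).trans ?_
  have : (K + c) ^ 2 * ε ^ 2 ≤ (K + c) ^ 2 * ε :=
    mul_le_mul_of_nonneg_left (by nlinarith) (by positivity)
  nlinarith
end bg

/-! ### Pointwise bounds from the energy functional -/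

theorem pw {f : Fld} (hf : Sm f) (t : ℝ) {ε K : ℝ} (h0 : 0 < ε) (h1 : ε ≤ 1)
    (e0 : (ε ^ 2)⁻¹ * dSq 0 (f t) ≤ K) (e1 : dSq 1 (f t) ≤ K) (e2 : ε ^ 2 * dSq 2 (f t) ≤ K)
    {x : ℝ × ℝ} (hx : x ∈ Ω) : f t x ^ 2 ≤ 16 * K := by
  have h := agmon hf t hx h0 h1
  rw [inv_pow, ← dSq_zero, ← dSq_zero, ← dSq_zero, ← dSq_zero] at h
  have a1 := dSq_D1_le hf 0 t
  have a2 := dSq_D2_le hf 0 t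
  have a3 := dSq_D1_le hf.D2 0 t
  have a4 := dSq_D2_le hf 1 t
  have a5 : ε ^ 2 * dSq 0 (D1 (D2 f) t) ≤ ε ^ 2 * dSq 2 (f t) :=
    mul_le_mul_of_nonneg_left (a3.trans a4) (by positivity)
  norm_num at a1 a2
  linarith

section
variable {φ : Fld} {ψ : ℝ → ℝ × ℝ → ℝ × ℝ} {θ : Fld} {ε T : ℝ}

theorem ii_nonneg {g : ℝ → ℝ} (h : ∀ s, 0 ≤ g s) {t : ℝ} (ht : 0 ≤ t) :
    0 ≤ ∫ s in (0 : ℝ)..t, g s := intervalIntegral.integral_nonneg ht fun s _ => h s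

theorem N_bounds (hφ : Sm φ) (hψ : VSm ψ) (hθ : Sm θ) (h0 : 0 < ε) (hT : 0 ≤ T)
    (hN : Nfun ε φ ψ θ T ≤ 1) {t : ℝ} (ht : t ∈ Set.Icc 0 T) :
    (ε ^ 2)⁻¹ * (dSq 0 (ψ t) + (ε ^ 2)⁻¹ * dSq 0 (φ t) + (ε ^ 2)⁻¹ * dSq 0 (θ t)) ≤ 1 ∧
    dSq 1 (ψ t) + (ε ^ 2)⁻¹ * dSq 1 (θ t) ≤ 1 ∧ (ε ^ 2)⁻¹ * dSq 1 (φ t) ≤ 1 ∧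
    ε ^ 2 * ((ε ^ 2)⁻¹ * dSq 2 (φ t) + dSq 2 (ψ t) + (ε ^ 2)⁻¹ * dSq 2 (θ t)) ≤ 1 ∧
    ε ^ 4 * dSq 3 (ψ t) ≤ 1 := by
  have p2 : 0 ≤ (ε ^ 2)⁻¹ := by positivity
  have p4 : 0 ≤ (ε ^ 4)⁻¹ := by positivity
  have z : ∀ (n : ℕ) (s : ℝ), 0 ≤ dSq n (φ s) := fun n s => dSq_nonneg _ _
  have zψ : ∀ (n : ℕ) (s : ℝ), 0 ≤ dSq n (ψ s) := fun n s => dSq_nonneg _ _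
  have zθ : ∀ (n : ℕ) (s : ℝ), 0 ≤ dSq n (θ s) := fun n s => dSq_nonneg _ _
  -- A0
  have a0 : dSq 0 (ψ t) + (ε ^ 2)⁻¹ * dSq 0 (φ t) + (ε ^ 2)⁻¹ * dSq 0 (θ t) ≤ A0 ε φ ψ θ T := by
    have s := biSup_ge (g := fun s => dSq 0 (ψ s) + (ε ^ 2)⁻¹ * dSq 0 (φ s) + (ε ^ 2)⁻¹ * dSq 0 (θ s))
      (fun s => add_nonneg (add_nonneg (zψ 0 s) (mul_nonneg p2 (z 0 s))) (mul_nonneg p2 (zθ 0 s)))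
      (((hψ.lb 0).add ((hφ.lb 0).mul p2)).add ((hθ.lb 0).mul p2)) ht
    have i := ii_nonneg (g := fun s => HSq 1 (ψ s) + (ε ^ 2)⁻¹ * HSq 1 (θ s))
      (fun s => add_nonneg (HSq_nonneg _ _) (mul_nonneg p2 (HSq_nonneg _ _))) hT
    unfold A0 L2Sq
    linarith
  have a1 : dSq 1 (ψ t) + (ε ^ 2)⁻¹ * dSq 1 (θ t) ≤ A1 ε φ ψ θ T := by
    have s := biSup_ge (g := fun s => dSq 1 (ψ s) + (ε ^ 2)⁻¹ * dSq 1 (θ s))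
      (fun s => add_nonneg (zψ 1 s) (mul_nonneg p2 (zθ 1 s)))
      ((hψ.lb 1).add ((hθ.lb 1).mul p2)) ht
    have i := ii_nonneg (g := fun s => L2Sq (dt ψ s) + (ε ^ 2)⁻¹ * L2Sq (dt θ s))
      (fun s => add_nonneg (dSq_nonneg _ _) (mul_nonneg p2 (dSq_nonneg _ _))) hT
    unfold A1
    linarith
  have a2 : (ε ^ 2)⁻¹ * dSq 1 (φ t) ≤ A2 ε φ ψ θ T := by
    have s := mul_le_mul_of_nonneg_left (biSup_ge (g := fun s => dSq 1 (φ s))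
      (fun s => z 1 s) (hφ.lb 1) ht) p2
    have i := ii_nonneg (g := fun s => (ε ^ 4)⁻¹ * HSq 1 (φ s) + (ε ^ 2)⁻¹ * L2Sq (dt φ s))
      (fun s => add_nonneg (mul_nonneg p4 (HSq_nonneg _ _)) (mul_nonneg p2 (dSq_nonneg _ _))) hT
    have i2 := ii_nonneg (g := fun s => HSq 2 (ψ s) + (ε ^ 2)⁻¹ * HSq 2 (θ s))
      (fun s => add_nonneg (HSq_nonneg _ _) (mul_nonneg p2 (HSq_nonneg _ _))) hT
    unfold A2
    linarith
  have a3 : 0 ≤ A3 ε φ ψ θ T := by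
    have s := biSup_nonneg (g := fun s =>
      (ε ^ 2)⁻¹ * L2Sq (dt φ s) + L2Sq (dt ψ s) + (ε ^ 2)⁻¹ * L2Sq (dt θ s))
      (fun s => add_nonneg (add_nonneg (mul_nonneg p2 (dSq_nonneg _ _)) (dSq_nonneg _ _))
        (mul_nonneg p2 (dSq_nonneg _ _))) T
    have i := ii_nonneg (g := fun s => dSq 1 (dt ψ s) + (ε ^ 2)⁻¹ * dSq 1 (dt θ s))
      (fun s => add_nonneg (dSq_nonneg _ _) (mul_nonneg p2 (dSq_nonneg _ _))) hT
    exact add_nonneg s i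
  have a4 : (ε ^ 2)⁻¹ * dSq 2 (φ t) + dSq 2 (ψ t) + (ε ^ 2)⁻¹ * dSq 2 (θ t) ≤ A4 ε φ ψ θ T := by
    have s := biSup_ge (g := fun s => (ε ^ 2)⁻¹ * dSq 2 (φ s) + dSq 2 (ψ s) + (ε ^ 2)⁻¹ * dSq 2 (θ s))
      (fun s => add_nonneg (add_nonneg (mul_nonneg p2 (z 2 s)) (zψ 2 s)) (mul_nonneg p2 (zθ 2 s)))
      ((((hφ.lb 2).mul p2).add (hψ.lb 2)).add ((hθ.lb 2).mul p2)) ht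
    have i := ii_nonneg (g := fun s =>
      (ε ^ 4)⁻¹ * HSq 2 (φ s) + HSq 3 (ψ s) + (ε ^ 2)⁻¹ * HSq 3 (θ s))
      (fun s => add_nonneg (add_nonneg (mul_nonneg p4 (HSq_nonneg _ _)) (HSq_nonneg _ _))
        (mul_nonneg p2 (HSq_nonneg _ _))) hT
    unfold A4
    linarith
  have a5 : dSq 3 (ψ t) ≤ A5 ε φ ψ θ T := by
    have s := biSup_ge (g := fun s => (ε ^ 2)⁻¹ * dSq 3 (φ s) + (dSq 3 (ψ s) + dSq 1 (dt ψ s))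
        + (ε ^ 2)⁻¹ * (dSq 3 (θ s) + dSq 1 (dt θ s)))
      (fun s => add_nonneg (add_nonneg (mul_nonneg p2 (z 3 s)) (add_nonneg (zψ 3 s) (dSq_nonneg _ _)))
        (mul_nonneg p2 (add_nonneg (zθ 3 s) (dSq_nonneg _ _))))
      ((((hφ.lb 3).mul p2).add ((hψ.lb 3).add (hψ.dt.lb 1))).add
        (((hθ.lb 3).add (hθ.Dt.lb 1)).mul p2)) ht
    have i := ii_nonneg (g := fun s => L2Sq (dt (dt ψ) s) + (ε ^ 2)⁻¹ * L2Sq (dt (dt θ) s))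
      (fun s => add_nonneg (dSq_nonneg _ _) (mul_nonneg p2 (dSq_nonneg _ _))) hT
    have n1 := mul_nonneg p2 (z 3 t)
    have n2 := mul_nonneg p2 (add_nonneg (zθ 3 t) (dSq_nonneg (dt θ t) 1))
    have n3 := dSq_nonneg (dt ψ t) 1
    unfold A5
    linarith
  have b0 := mul_le_mul_of_nonneg_left a0 p2
  have b3 := mul_nonneg (sq_nonneg ε) a3
  have b4 := mul_le_mul_of_nonneg_left a4 (sq_nonneg ε)
  have b5 := mul_le_mul_of_nonneg_left a5 (by positivity : 0 ≤ ε ^ 4)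
  have z0 : 0 ≤ (ε ^ 2)⁻¹ * (dSq 0 (ψ t) + (ε ^ 2)⁻¹ * dSq 0 (φ t) + (ε ^ 2)⁻¹ * dSq 0 (θ t)) :=
    mul_nonneg p2 (add_nonneg (add_nonneg (zψ 0 t) (mul_nonneg p2 (z 0 t))) (mul_nonneg p2 (zθ 0 t)))
  have z1 : 0 ≤ dSq 1 (ψ t) + (ε ^ 2)⁻¹ * dSq 1 (θ t) := add_nonneg (zψ 1 t) (mul_nonneg p2 (zθ 1 t))
  have z2 : 0 ≤ (ε ^ 2)⁻¹ * dSq 1 (φ t) := mul_nonneg p2 (z 1 t)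
  have z4 : 0 ≤ ε ^ 2 * ((ε ^ 2)⁻¹ * dSq 2 (φ t) + dSq 2 (ψ t) + (ε ^ 2)⁻¹ * dSq 2 (θ t)) :=
    mul_nonneg (sq_nonneg ε)
      (add_nonneg (add_nonneg (mul_nonneg p2 (z 2 t)) (zψ 2 t)) (mul_nonneg p2 (zθ 2 t)))
  have z5 : 0 ≤ ε ^ 4 * dSq 3 (ψ t) := mul_nonneg (by positivity) (zψ 3 t)
  unfold Nfun at hN
  refine ⟨?_, ?_, ?_, ?_, ?_⟩
  · linarith only [hN, b0, a1, a2, b3, b4, b5, z0, z1, z2, z4, z5]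
  · linarith only [hN, b0, a1, a2, b3, b4, b5, z0, z1, z2, z4, z5]
  · linarith only [hN, b0, a1, a2, b3, b4, b5, z0, z1, z2, z4, z5]
  · linarith only [hN, b0, a1, a2, b3, b4, b5, z0, z1, z2, z4, z5]
  · linarith only [hN, b0, a1, a2, b3, b4, b5, z0, z1, z2, z4, z5]

theorem abs4 {y : ℝ} (h : y ^ 2 ≤ 16) : |y| ≤ 4 := abs_le_of_sq_le_sq (by linarith) (by norm_num)

/-- bound for a scalar field of size `ε` -/
theorem small_bd {f : Fld} (hf : Sm f) (h0 : 0 < ε) (h1 : ε ≤ 1) {t : ℝ}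
    (e0 : (ε ^ 2)⁻¹ * ((ε ^ 2)⁻¹ * dSq 0 (f t)) ≤ 1) (e1 : (ε ^ 2)⁻¹ * dSq 1 (f t) ≤ 1)
    (e2 : ε ^ 2 * ((ε ^ 2)⁻¹ * dSq 2 (f t)) ≤ 1) {x : ℝ × ℝ} (hx : x ∈ Ω) :
    |(ε⁻¹ • f) t x| ≤ 4 := by
  have p : 0 < ε ^ 2 := by positivity
  have c := mul_inv_cancel₀ p.ne'
  have q : ∀ y : ℝ, (ε ^ 2)⁻¹ * y ≤ 1 → y ≤ ε ^ 2 := fun y hy => by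
    rwa [inv_mul_le_iff₀ p, mul_one] at hy
  have h := pw hf t (K := ε ^ 2) h0 h1 (q _ e0) (q _ e1)
    (by rw [← mul_assoc, c, one_mul] at e2
        calc ε ^ 2 * dSq 2 (f t) ≤ ε ^ 2 * 1 := mul_le_mul_of_nonneg_left e2 p.le
          _ = ε ^ 2 := mul_one _) hx
  apply abs4
  show (ε⁻¹ * f t x) ^ 2 ≤ 16
  rw [mul_pow, inv_pow, inv_mul_le_iff₀ p]
  linarith

theorem grad_bd {f : Fld} (hf : Sm f) (h0 : 0 < ε) (h1 : ε ≤ 1) {t : ℝ}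
    (e1 : dSq 1 (f t) ≤ 1) (e2 : ε ^ 2 * dSq 2 (f t) ≤ 1)
    (e3 : ε ^ 4 * dSq 3 (f t) ≤ 1) {x : ℝ × ℝ} (hx : x ∈ Ω) :
    |ε * D1 f t x| ≤ 4 ∧ |ε * D2 f t x| ≤ 4 := by
  have p : 0 < ε ^ 2 := by positivity
  have e2' : dSq 2 (f t) ≤ (ε ^ 2)⁻¹ := by
    rw [← one_div, le_div_iff₀ p, mul_comm]; exact e2
  have e3' : ε ^ 2 * dSq 3 (f t) ≤ (ε ^ 2)⁻¹ := by
    rw [← one_div, le_div_iff₀ p]; nlinarith only [e3]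
  have e1' : (ε ^ 2)⁻¹ * dSq 1 (f t) ≤ (ε ^ 2)⁻¹ :=
    mul_le_of_le_one_right (by positivity) e1
  have key : ∀ g : Fld, Sm g → (∀ n, dSq n (g t) ≤ dSq (n + 1) (f t)) → |ε * g t x| ≤ 4 := by
    intro g hg hn
    have h := pw hg t (K := (ε ^ 2)⁻¹) h0 h1
      ((mul_le_mul_of_nonneg_left (hn 0) (by positivity)).trans e1') ((hn 1).trans e2')
      ((mul_le_mul_of_nonneg_left (hn 2) p.le).trans e3') hx
    apply abs4
    rw [mul_pow]
    calc ε ^ 2 * g t x ^ 2 ≤ ε ^ 2 * (16 * (ε ^ 2)⁻¹) := mul_le_mul_of_nonneg_left h p.le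
      _ = 16 := by field_simp
  exact ⟨key _ hf.D1 fun n => dSq_D1_le hf n t, key _ hf.D2 fun n => dSq_D2_le hf n t⟩
end

/-! ### From the perturbation system to the rescaled system -/

def cP (γ Pr : ℝ) : ℝ := Pr / (2 * (γ / (γ - 1)))
def MM (γ Pr K : ℝ) : ℝ := 4 + 16 * (K + cP γ Pr) ^ 2 + 8 * (K + cP γ Pr)

theorem cP_nonneg {γ Pr : ℝ} (hγ : 1 < γ) (hPr : 0 < Pr) : 0 ≤ cP γ Pr := by
  have : 0 < γ - 1 := by linarith
  unfold cP; positivity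

theorem tT_eq (γ Pr ε χ : ℝ) (t : ℝ) : tT γ Pr ε χ = Θf (cP γ Pr) ε χ t := by
  ext x; unfold tT Θf cP; ring

theorem tρ_on {γ Pr ε χ : ℝ} (hγ : 1 < γ) (hPr : 0 < Pr) (hχ : |1 - χ| ≤ 1 / 2) (t : ℝ)
    {x : ℝ × ℝ} (hx : x ∈ Ω) : tρ γ Pr ε χ x = Rf (cP γ Pr) ε χ t x := by
  have h := Θf_ge (ε := ε) (cP_nonneg hγ hPr) hχ t hx
  unfold tρ Rf
  rw [hcut_eq (by linarith), tT_eq γ Pr ε χ t]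

theorem tu_11 (x : ℝ × ℝ) : d1 (fun y => (tu y).1) x = 0 := by
  show fderiv ℝ (fun y : ℝ × ℝ => y.2) x (1, 0) = 0
  rw [fderiv_snd]; rfl
theorem tu_12 (x : ℝ × ℝ) : d2 (fun y => (tu y).1) x = 1 := by
  show fderiv ℝ (fun y : ℝ × ℝ => y.2) x (0, 1) = 1
  rw [fderiv_snd]; rfl
theorem tu_21 (x : ℝ × ℝ) : d1 (fun y => (tu y).2) x = 0 := by
  show fderiv ℝ (fun _ : ℝ × ℝ => (0 : ℝ)) x (1, 0) = 0
  simp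
theorem tu_22 (x : ℝ × ℝ) : d2 (fun y => (tu y).2) x = 0 := by
  show fderiv ℝ (fun _ : ℝ × ℝ => (0 : ℝ)) x (0, 1) = 0
  simp

section
variable {γ Pr r Re ε χ T K : ℝ} (S : PerturbSol γ Pr r Re ε χ T)

def toSys (hγ : 1 < γ) (hPr : 0 < Pr) (h0 : 0 < ε) (h1 : ε ≤ 1) (hK0 : 0 < K)
    (hK : |1 - χ| ≤ K * ε) (hχ : |1 - χ| ≤ 1 / 2) (hT : 0 ≤ T) (hS : SmoothSol S)
    (hH : StdHyp S) (hN : Nfun ε S.φ S.ψ S.θ T ≤ 1) :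
    Sys Re⁻¹ ((1 + r) * Re⁻¹) (γ / (γ - 1) / (Re * Pr)) (1 / (γ - 1)) r (MM γ Pr K) ε T :=
  have sφ : Sm S.φ := hS.1
  have sψ : VSm S.ψ := hS.2.1
  have sθ : Sm S.θ := hS.2.2
  have hc := cP_nonneg hγ hPr
  have hKc : 0 ≤ K + cP γ Pr := by linarith
  have iM4 : 4 ≤ MM γ Pr K := by unfold MM; nlinarith
  have iM1 : K + cP γ Pr ≤ MM γ Pr K := by unfold MM; nlinarith
  have iM2 : 2 * (K + cP γ Pr) ≤ MM γ Pr K := by unfold MM; nlinarith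
  have iM3 : 4 * (K + cP γ Pr) ≤ MM γ Pr K := by unfold MM; nlinarith
  have iM5 : 16 * (K + cP γ Pr) ^ 2 + 8 * cP γ Pr ≤ MM γ Pr K := by unfold MM; nlinarith
  have mε : ∀ {A : ℝ}, A ≤ MM γ Pr K → A * ε ≤ MM γ Pr K * ε := fun h =>
    mul_le_mul_of_nonneg_right h h0.le
  haveI i1 : SM S.φ := ⟨sφ⟩
  haveI i2 : SM (C1 S.ψ) := ⟨sψ.c1⟩
  haveI i3 : SM (C2 S.ψ) := ⟨sψ.c2⟩
  haveI i4 : SM S.θ := ⟨sθ⟩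
  haveI i5 : SM (Θf (cP γ Pr) ε χ) := ⟨Θf_sm _ _ _⟩
  haveI i6 : SM (Rf (cP γ Pr) ε χ) := ⟨Rf_sm _ _ _⟩
  haveI j1 : PER S.φ := ⟨S.periodic_φ⟩
  haveI j2 : PER (C1 S.ψ) := ⟨fun t x => congrArg Prod.fst (S.periodic_ψ t x)⟩
  haveI j3 : PER (C2 S.ψ) := ⟨fun t x => congrArg Prod.snd (S.periodic_ψ t x)⟩
  haveI j4 : PER S.θ := ⟨S.periodic_θ⟩
  have p2 : 0 < ε ^ 2 := by positivity
  have q2 : 0 ≤ (ε ^ 2)⁻¹ := by positivity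
  have NB := fun {t} (ht : t ∈ Set.Icc 0 T) => N_bounds sφ sψ sθ h0 hT hN ht
  have z : ∀ (n : ℕ) (s : ℝ), 0 ≤ dSq n (S.φ s) := fun n s => dSq_nonneg _ _
  have zψ : ∀ (n : ℕ) (s : ℝ), 0 ≤ dSq n (S.ψ s) := fun n s => dSq_nonneg _ _
  have zθ : ∀ (n : ℕ) (s : ℝ), 0 ≤ dSq n (S.θ s) := fun n s => dSq_nonneg _ _
  have ψ0 : ∀ t ∈ Set.Icc 0 T, (ε ^ 2)⁻¹ * dSq 0 (S.ψ t) ≤ 1 := fun t ht =>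
    (mul_le_mul_of_nonneg_left (by
      linarith only [mul_nonneg q2 (z 0 t), mul_nonneg q2 (zθ 0 t)]) q2).trans (NB ht).1
  have ψ1 : ∀ t ∈ Set.Icc 0 T, dSq 1 (S.ψ t) ≤ 1 := fun t ht => by
    linarith only [mul_nonneg q2 (zθ 1 t), (NB ht).2.1]
  have ψ2 : ∀ t ∈ Set.Icc 0 T, ε ^ 2 * dSq 2 (S.ψ t) ≤ 1 := fun t ht =>
    (mul_le_mul_of_nonneg_left (by
      linarith only [mul_nonneg q2 (z 2 t), mul_nonneg q2 (zθ 2 t)]) p2.le).trans (NB ht).2.2.2.1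
  have ψ3 : ∀ t ∈ Set.Icc 0 T, ε ^ 4 * dSq 3 (S.ψ t) ≤ 1 := fun t ht => (NB ht).2.2.2.2
  have c0 : ∀ f : Fld, Sm f → (∀ n s, dSq n (f s) ≤ dSq n (S.ψ s)) →
      ∀ t ∈ Set.Icc 0 T, ∀ x ∈ Ω, |f t x| ≤ MM γ Pr K := fun f hf hn t ht x hx =>
    (abs4 (by
      have := pw hf t (K := 1) h0 h1 ((mul_le_mul_of_nonneg_left (hn 0 t) q2).trans (ψ0 t ht))
        ((hn 1 t).trans (ψ1 t ht))
        ((mul_le_mul_of_nonneg_left (hn 2 t) p2.le).trans (ψ2 t ht)) hx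
      linarith)).trans iM4
  have c1 : ∀ f : Fld, Sm f → (∀ n s, dSq n (f s) ≤ dSq n (S.ψ s)) →
      ∀ t ∈ Set.Icc 0 T, ∀ x ∈ Ω, |ε * D1 f t x| ≤ MM γ Pr K ∧ |ε * D2 f t x| ≤ MM γ Pr K :=
    fun f hf hn t ht x hx => by
      have := grad_bd hf h0 h1 ((hn 1 t).trans (ψ1 t ht))
        ((mul_le_mul_of_nonneg_left (hn 2 t) p2.le).trans (ψ2 t ht))
        ((mul_le_mul_of_nonneg_left (hn 3 t) (by positivity)).trans (ψ3 t ht)) hx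
      exact ⟨this.1.trans iM4, this.2.trans iM4⟩
  have n1 := sψ.dSq_c1
  have n2 := sψ.dSq_c2
  have eu : ∀ t x, pu S.ψ t x = (x.2 + C1 S.ψ t x, C2 S.ψ t x) := fun t x => by
    ext <;> simp [pu, tu, C1, C2]
  have eρ : ∀ t, ∀ x ∈ Ω, pρ γ Pr ε χ S.φ t x = Rf (cP γ Pr) ε χ t x + S.φ t x := fun t x hx => by
    unfold pρ; rw [tρ_on hγ hPr hχ t hx]
  have eT : ∀ t x, pT γ Pr ε χ S.θ t x = Θf (cP γ Pr) ε χ t x + S.θ t x := fun t x => by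
    unfold pT; rw [tT_eq γ Pr ε χ t]
  have eρ' : ∀ t, ∀ x ∈ Ω, fderiv ℝ (tρ γ Pr ε χ) x = fderiv ℝ (Rf (cP γ Pr) ε χ t) x :=
    fun t x hx => loc_fderiv (fun y hy => tρ_on hγ hPr hχ t hy) hx
  have R1 : D1 (Rf (cP γ Pr) ε χ) = 0 := D1_of_const (Rf_sm _ _ _) fun t a b c => rfl
  have Θ1 : D1 (Θf (cP γ Pr) ε χ) = 0 := D1_of_const (Θf_sm _ _ _) fun t a b c => rfl
  have ediv : ∀ t, divv (S.ψ t) = (D1 (C1 S.ψ) + D2 (C2 S.ψ)) t := fun t => rfl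
  have edt : ∀ t x, dt S.ψ t x = (Dt (C1 S.ψ) t x, Dt (C2 S.ψ) t x) := sψ.dt_eq
  have ee : ε * ε⁻¹ = 1 := mul_inv_cancel₀ h0.ne'
  have e3 : (ε ^ 2)⁻¹ * ε = ε⁻¹ := by field_simp
  have e4 : ε⁻¹ * ε ^ 2 = ε := by field_simp
  have tu11 : ∀ x, d1 (fun y => (tu y).1) x = 0 := tu_11
  have tu12 : ∀ x, d2 (fun y => (tu y).1) x = 1 := tu_12
  have tu21 : ∀ x, d1 (fun y => (tu y).2) x = 0 := tu_21
  have tu22 : ∀ x, d2 (fun y => (tu y).2) x = 0 := tu_22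
  have dρ1 : ∀ t, ∀ x ∈ Ω, d1 (tρ γ Pr ε χ) x = 0 := fun t x hx => by
    unfold d1; rw [eρ' t x hx]; exact congrFun (congrFun R1 t) x
  have dρ2 : ∀ t, ∀ x ∈ Ω, d2 (tρ γ Pr ε χ) x = D2 (Rf (cP γ Pr) ε χ) t x := fun t x hx => by
    unfold d2; rw [eρ' t x hx]; rfl
  have dT1 : ∀ (t : ℝ) x, d1 (tT γ Pr ε χ) x = 0 := fun t x => by
    rw [tT_eq γ Pr ε χ t]; exact congrFun (congrFun Θ1 t) x
  have dT2 : ∀ t x, d2 (tT γ Pr ε χ) x = D2 (Θf (cP γ Pr) ε χ) t x := fun t x => by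
    rw [tT_eq γ Pr ε χ t]; rfl
  have eP : ∀ t, ∀ x ∈ Ω, fderiv ℝ (fun y => pρ γ Pr ε χ S.φ t y * pT γ Pr ε χ S.θ t y) x =
      ε • fderiv ℝ (((Rf (cP γ Pr) ε χ + ε • ε⁻¹ • S.φ) * (ε⁻¹ • S.θ)
        + Θf (cP γ Pr) ε χ * (ε⁻¹ • S.φ)) t) x := fun t x hx => by
    rw [loc_fderiv (g := fun y => 1 + ε * ((Rf (cP γ Pr) ε χ + ε • ε⁻¹ • S.φ) * (ε⁻¹ • S.θ)
        + Θf (cP γ Pr) ε χ * (ε⁻¹ • S.φ)) t y) (fun y hy => ?_) hx]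
    · rw [fderiv_const_add, fderiv_const_mul]
      exact (Sm.slice (SM.out : Sm ((Rf (cP γ Pr) ε χ + ε • ε⁻¹ • S.φ) * (ε⁻¹ • S.θ)
        + Θf (cP γ Pr) ε χ * (ε⁻¹ • S.φ))) t).differentiable (by simp) x
    · rw [eρ t y hy, eT t y]
      have h := RΘ_one (ε := ε) hc hχ t hy
      simp only [Pi.add_apply, Pi.mul_apply, Pi.smul_apply, smul_eq_mul,
        mul_inv_cancel_left₀ h0.ne']
      linear_combination h - (Rf (cP γ Pr) ε χ t y * S.θ t y + S.φ t y * S.θ t y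
        + Θf (cP γ Pr) ε χ t y * S.φ t y) * ee
  { a := ε⁻¹ • S.φ
    v := C1 S.ψ
    w := C2 S.ψ
    b := ε⁻¹ • S.θ
    Θ := Θf (cP γ Pr) ε χ
    R := Rf (cP γ Pr) ε χ
    sa := inferInstance
    sv := inferInstance
    sw := inferInstance
    sb := inferInstance
    sΘ := inferInstance
    sR := inferInstance
    pa := inferInstance
    pv := inferInstance
    pw := inferInstance
    pb := inferInstance
    pΘ := ⟨fun t x => rfl⟩
    pR := ⟨fun t x => rfl⟩
    Θt := Dt_of_const fun t s x => rfl
    Θ1 := Θ1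
    Rt := Dt_of_const fun t s x => rfl
    R1 := R1
    hRΘ := fun t x hx => RΘ_one hc hχ t hx
    hR2 := fun t x hx => Rf_D2 hc hχ t hx
    bR := fun t x hx => (Rf_bd1 hc h0 h1 hK hχ t hx).trans (mε iM2)
    bΘ := fun t x hx => (Θf_bd hc h0 h1 hK t hx).trans (mε iM1)
    bΘ2 := fun t x hx => (Θf2_bd hc h0 h1 hK t hx).trans (mε iM1)
    bR2 := fun t x hx => (Rf2_bd hc h0 h1 hK hχ t hx).trans (mε iM3)
    bR22 := fun t x hx => (Rf22_bd hc h0 h1 hK hχ t hx hK0.le).trans (mε iM5)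
    ba := fun t ht x hx => (small_bd sφ h0 h1
      ((mul_le_mul_of_nonneg_left (by
        linarith only [zψ 0 t, mul_nonneg q2 (zθ 0 t)]) q2).trans (NB ht).1) (NB ht).2.2.1
      ((mul_le_mul_of_nonneg_left (by
        linarith only [zψ 2 t, mul_nonneg q2 (zθ 2 t)]) p2.le).trans (NB ht).2.2.2.1) hx).trans iM4
    bv := c0 _ sψ.c1 n1
    bw := c0 _ sψ.c2 n2
    bb := fun t ht x hx => (small_bd sθ h0 h1
      ((mul_le_mul_of_nonneg_left (by
        linarith only [zψ 0 t, mul_nonneg q2 (z 0 t)]) q2).trans (NB ht).1)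
      (by linarith only [(NB ht).2.1, zψ 1 t])
      ((mul_le_mul_of_nonneg_left (by
        linarith only [zψ 2 t, mul_nonneg q2 (z 2 t)]) p2.le).trans (NB ht).2.2.2.1) hx).trans iM4
    bv1 := fun t ht x hx => (c1 _ sψ.c1 n1 t ht x hx).1
    bv2 := fun t ht x hx => (c1 _ sψ.c1 n1 t ht x hx).2
    bw1 := fun t ht x hx => (c1 _ sψ.c2 n2 t ht x hx).1
    bw2 := fun t ht x hx => (c1 _ sψ.c2 n2 t ht x hx).2
    cv := fun t ht x hx => congrArg Prod.fst (S.bc_ψ t ht x hx)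
    cw := fun t ht x hx => congrArg Prod.snd (S.bc_ψ t ht x hx)
    cb := fun t ht x hx => by
      show ε⁻¹ * S.θ t x = 0
      rw [S.bc_θ t ht x hx, mul_zero]
    mean := by
      rw [J_smul_eq]
      have : J S.φ 0 = 0 := hH.2.2.2.1
      rw [this, mul_zero]
    mass := fun t ht x hx => by
      have h : Dt S.φ t x + ((x.2 + C1 S.ψ t x) * D1 S.φ t x + C2 S.ψ t x * D2 S.φ t x)
          + (Rf (cP γ Pr) ε χ t x + S.φ t x) * (D1 (C1 S.ψ) t x + D2 (C2 S.ψ) t x)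
          + (C1 S.ψ t x * 0 + C2 S.ψ t x * D2 (Rf (cP γ Pr) ε χ) t x) = 0 := by
        have h := S.mass_eq t ht x hx
        rw [eu, eρ t x hx, ediv] at h
        simp only [dot, grad, dρ1 t x hx, dρ2 t x hx] at h
        exact h
      rw [dt_smul, d1_smul, d2_smul]
      simp only [Pi.add_apply, Pi.mul_apply, Pi.smul_apply, smul_eq_mul,
        mul_inv_cancel_left₀ h0.ne', Yf]
      linear_combination h + (Dt S.φ t x + (x.2 + C1 S.ψ t x) * D1 S.φ t x
        + C2 S.ψ t x * D2 S.φ t x) * ee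
    mom1 := fun t ht x hx => by
      set X : Fld := (Rf (cP γ Pr) ε χ + ε • ε⁻¹ • S.φ) * (ε⁻¹ • S.θ)
        + Θf (cP γ Pr) ε χ * (ε⁻¹ • S.φ) with hX
      have h : (Rf (cP γ Pr) ε χ t x + S.φ t x) * (Dt (C1 S.ψ) t x
          + ((x.2 + C1 S.ψ t x) * D1 (C1 S.ψ) t x + C2 S.ψ t x * D2 (C1 S.ψ) t x)
          + (C1 S.ψ t x * 0 + C2 S.ψ t x * 1))
          + (ε ^ 2)⁻¹ * (ε * D1 X t x)
          - Re⁻¹ * (D1 (D1 (C1 S.ψ)) t x + D2 (D2 (C1 S.ψ)) t x)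
          - (Re⁻¹ + r * Re⁻¹) * D1 (D1 (C1 S.ψ) + D2 (C2 S.ψ)) t x = 0 := by
        have h := S.mom_eq1 t ht x hx
        have hp : d1 (fun y => pρ γ Pr ε χ S.φ t y * pT γ Pr ε χ S.θ t y) x = ε * D1 X t x := by
          unfold d1; rw [eP t x hx]; rfl
        rw [hp, eu, eρ t x hx, ediv, edt] at h
        simp only [dot, grad, tu11, tu12] at h
        exact h
      simp only [Pi.add_apply, Pi.sub_apply, Pi.mul_apply, Pi.smul_apply, smul_eq_mul,
        mul_inv_cancel_left₀ h0.ne', Yf]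
      linear_combination h - D1 X t x * e3
    mom2 := fun t ht x hx => by
      set X : Fld := (Rf (cP γ Pr) ε χ + ε • ε⁻¹ • S.φ) * (ε⁻¹ • S.θ)
        + Θf (cP γ Pr) ε χ * (ε⁻¹ • S.φ) with hX
      have h : (Rf (cP γ Pr) ε χ t x + S.φ t x) * (Dt (C2 S.ψ) t x
          + ((x.2 + C1 S.ψ t x) * D1 (C2 S.ψ) t x + C2 S.ψ t x * D2 (C2 S.ψ) t x)
          + (C1 S.ψ t x * 0 + C2 S.ψ t x * 0))
          + (ε ^ 2)⁻¹ * (ε * D2 X t x)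
          - Re⁻¹ * (D1 (D1 (C2 S.ψ)) t x + D2 (D2 (C2 S.ψ)) t x)
          - (Re⁻¹ + r * Re⁻¹) * D2 (D1 (C1 S.ψ) + D2 (C2 S.ψ)) t x = 0 := by
        have h := S.mom_eq2 t ht x hx
        have hp : d2 (fun y => pρ γ Pr ε χ S.φ t y * pT γ Pr ε χ S.θ t y) x = ε * D2 X t x := by
          unfold d2; rw [eP t x hx]; rfl
        rw [hp, eu, eρ t x hx, ediv, edt] at h
        simp only [dot, grad, tu21, tu22] at h
        exact h
      simp only [Pi.add_apply, Pi.sub_apply, Pi.mul_apply, Pi.smul_apply, smul_eq_mul,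
        mul_inv_cancel_left₀ h0.ne', Yf]
      linear_combination h - D2 X t x * e3
    energy := fun t ht x hx => by
      have h : (Rf (cP γ Pr) ε χ t x + S.φ t x) / (γ - 1) * (Dt S.θ t x
          + ((x.2 + C1 S.ψ t x) * D1 S.θ t x + C2 S.ψ t x * D2 S.θ t x)
          + (C1 S.ψ t x * 0 + C2 S.ψ t x * D2 (Θf (cP γ Pr) ε χ) t x))
          + (Rf (cP γ Pr) ε χ t x + S.φ t x) * (Θf (cP γ Pr) ε χ t x + S.θ t x)
            * (D1 (C1 S.ψ) t x + D2 (C2 S.ψ) t x)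
          - γ / (γ - 1) / (Re * Pr) * (D1 (D1 S.θ) t x + D2 (D2 S.θ) t x)
          = ε ^ 2 * (2 * Re⁻¹ * (D1 (C1 S.ψ) t x * D1 (C1 S.ψ) t x
              + D2 (C2 S.ψ) t x * D2 (C2 S.ψ) t x
              + 2 * ((D1 (C2 S.ψ) t x + D2 (C1 S.ψ) t x) / 2)
                * ((D1 (C2 S.ψ) t x + D2 (C1 S.ψ) t x) / 2))
            + 4 * Re⁻¹ * (0 * D1 (C1 S.ψ) t x + 0 * D2 (C2 S.ψ) t x
              + 2 * ((0 + 1) / 2) * ((D1 (C2 S.ψ) t x + D2 (C1 S.ψ) t x) / 2))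
            + r * Re⁻¹ * (D1 (C1 S.ψ) t x + D2 (C2 S.ψ) t x) ^ 2) := by
        have h := S.energy_eq t ht x hx
        rw [eu, eρ t x hx, eT, ediv] at h
        simp only [dot, grad, defContract, tu11, tu12, tu21, tu22, dT1 t, dT2 t] at h
        exact h
      rw [dt_smul, d1_smul, d2_smul, d1_smul, d2_smul]
      simp only [Pi.add_apply, Pi.sub_apply, Pi.mul_apply, Pi.smul_apply, smul_eq_mul,
        mul_inv_cancel_left₀ h0.ne', Yf]
      linear_combination ε⁻¹ * h + (2 * Re⁻¹ * (D1 (C1 S.ψ) t x * D1 (C1 S.ψ) t x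
              + D2 (C2 S.ψ) t x * D2 (C2 S.ψ) t x
              + 2 * ((D1 (C2 S.ψ) t x + D2 (C1 S.ψ) t x) / 2)
                * ((D1 (C2 S.ψ) t x + D2 (C1 S.ψ) t x) / 2))
            + 2 * Re⁻¹ * (D1 (C2 S.ψ) t x + D2 (C1 S.ψ) t x)
            + r * Re⁻¹ * (D1 (C1 S.ψ) t x + D2 (C2 S.ψ) t x) ^ 2) * e4 }
end

/-! ### Comparison of the functionals -/

section fin
variable {μ lam κ g1 r M ε T : ℝ} (Y : Sys μ lam κ g1 r M ε T)
  {φ : Fld} {ψ : ℝ → ℝ × ℝ → ℝ × ℝ} {θ : Fld}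

theorem dSq0_smul (c : ℝ) (f : Fld) (s : ℝ) : dSq 0 ((c • f) s) = c ^ 2 * J (f * f) s := by
  rw [dSq_zero]
  have : (c • f) * (c • f) = (c ^ 2) • (f * f) := by
    ext t x; simp only [Pi.mul_apply, Pi.smul_apply, smul_eq_mul]; ring
  rw [this, J_smul_eq]

theorem dSq1_smul_le (c : ℝ) (f : Fld) [SM f] (s : ℝ) : dSq 1 ((c • f) s) ≤
    c ^ 2 * (2 * J (D1 f * D1 f) s + 2 * J (D2 f * D2 f) s) := by
  have h := dSq_succ_le (SM.out : Sm (c • f)) 0 s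
  rw [d1_smul, d2_smul, dSq0_smul, dSq0_smul] at h
  have hh : dSq 1 ((c • f) s) ≤ 2 * (c ^ 2 * J (D1 f * D1 f) s) + 2 * (c ^ 2 * J (D2 f * D2 f) s) := h
  linarith

theorem dSq1_le (f : Fld) [SM f] (s : ℝ) : dSq 1 (f s) ≤
    2 * J (D1 f * D1 f) s + 2 * J (D2 f * D2 f) s := by
  have h := dSq_succ_le (SM.out : Sm f) 0 s
  rw [dSq_zero, dSq_zero] at h
  exact h

theorem dSq2_smul_le (c : ℝ) (f : Fld) [SM f] (s : ℝ) : dSq 2 ((c • f) s) ≤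
    c ^ 2 * (4 * J (D1 (D1 f) * D1 (D1 f)) s + 8 * J (D1 (D2 f) * D1 (D2 f)) s
      + 4 * J (D2 (D2 f) * D2 (D2 f)) s) := by
  have h := dSq_succ_le (SM.out : Sm (c • f)) 1 s
  rw [d1_smul, d2_smul] at h
  have h1 := dSq1_smul_le c (D1 f) s
  have h2 := dSq1_smul_le c (D2 f) s
  rw [d21] at h1
  have hh : dSq 2 ((c • f) s) ≤ 2 * dSq 1 ((c • D1 f) s) + 2 * dSq 1 ((c • D2 f) s) := h
  linarith

theorem dSq2_le (f : Fld) [SM f] (s : ℝ) : dSq 2 (f s) ≤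
    4 * J (D1 (D1 f) * D1 (D1 f)) s + 8 * J (D1 (D2 f) * D1 (D2 f)) s
      + 4 * J (D2 (D2 f) * D2 (D2 f)) s := by
  have h := dSq_succ_le (SM.out : Sm f) 1 s
  have h1 := dSq1_le (D1 f) s
  have h2 := dSq1_le (D2 f) s
  rw [d21] at h1
  norm_num at h
  linarith

theorem Wt_exp (s : ℝ) : J Y.Wt s = (ε⁻¹ * ε⁻¹) * J (D2 Y.a * D2 Y.a) s
    + (J (D1 (D1 Y.v) * D1 (D1 Y.v)) s + J (D1 (D2 Y.v) * D1 (D2 Y.v)) s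
      + J (D1 (D1 Y.w) * D1 (D1 Y.w)) s + J (D1 (D2 Y.w) * D1 (D2 Y.w)) s)
    + (J (Dt Y.v * Dt Y.v) s + J (Dt Y.w * Dt Y.w) s + J (Dt Y.b * Dt Y.b) s)
    + ((ε⁻¹ * ε⁻¹) * (J Y.gψ s + J Y.gb s + J Y.so s) + J Y.ga s + J (Y.a * Y.a) s)
    + (J (Dt Y.a * Dt Y.a) s + (ε⁻¹ * ε⁻¹) * J (D1 Y.a * D1 Y.a) s
      + J (D2 (D2 Y.v) * D2 (D2 Y.v)) s + J (D2 (D2 Y.w) * D2 (D2 Y.w)) s)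
    + (J (D1 (D1 Y.b) * D1 (D1 Y.b)) s + J (D1 (D2 Y.b) * D1 (D2 Y.b)) s
      + J (D2 (D2 Y.b) * D2 (D2 Y.b)) s) := by
  unfold Sys.Wt Sys.W5 Sys.W6 Sys.Hb Sys.sF Sys.pt Sys.N
  simp only [J_add_eq, J_smul_eq]

theorem gψ_exp (s : ℝ) : J Y.gψ s = J (D1 Y.v * D1 Y.v) s + J (D2 Y.v * D2 Y.v) s
    + J (D1 Y.w * D1 Y.w) s + J (D2 Y.w * D2 Y.w) s := by
  unfold Sys.gψ; simp only [J_add_eq]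
theorem gb_exp (s : ℝ) : J Y.gb s = J (D1 Y.b * D1 Y.b) s + J (D2 Y.b * D2 Y.b) s := by
  unfold Sys.gb; simp only [J_add_eq]
theorem ga_exp (s : ℝ) : J Y.ga s = J (D1 Y.a * D1 Y.a) s + J (D2 Y.a * D2 Y.a) s := by
  unfold Sys.ga; simp only [J_add_eq]
theorem so_exp (s : ℝ) : J Y.so s = J (Y.v * Y.v) s + J (Y.w * Y.w) s + J (Y.b * Y.b) s := by
  unfold Sys.so; simp only [J_add_eq]

theorem U1 (hψ : VSm ψ) (h0 : 0 < ε) (eθ : θ = ε • Y.b) (ev : C1 ψ = Y.v) (ew : C2 ψ = Y.w)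
    (s : ℝ) : dSq 1 (ψ s) + (ε ^ 2)⁻¹ * dSq 1 (θ s) ≤ 4 * (J Y.gψ s + J Y.gb s) := by
  have a1 := hψ.dSq_le 1 s
  rw [ev, ew] at a1
  have a2 := dSq1_le Y.v s
  have a3 := dSq1_le Y.w s
  have a4 := dSq1_smul_le ε Y.b s
  rw [← eθ] at a4
  have a5 : (ε ^ 2)⁻¹ * dSq 1 (θ s) ≤ 2 * J (D1 Y.b * D1 Y.b) s + 2 * J (D2 Y.b * D2 Y.b) s := by
    rw [inv_mul_le_iff₀ (by positivity)]; exact a4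
  rw [gψ_exp, gb_exp]
  have b1 := J_sq_nonneg (D1 Y.b) s
  have b2 := J_sq_nonneg (D2 Y.b) s
  linarith

theorem U2 (hψ : VSm ψ) (h0 : 0 < ε) (eθ : θ = ε • Y.b) (ev : C1 ψ = Y.v) (ew : C2 ψ = Y.w)
    (s : ℝ) : L2Sq (dt ψ s) + (ε ^ 2)⁻¹ * L2Sq (dt θ s) ≤
    2 * (J (Dt Y.v * Dt Y.v) s + J (Dt Y.w * Dt Y.w) s + J (Dt Y.b * Dt Y.b) s) := by
  have a1 := hψ.dt.dSq_le 0 s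
  have c1 : C1 (dt ψ) = Dt Y.v := by
    ext t x; rw [← ev]; exact congrArg Prod.fst (hψ.dt_eq t x)
  have c2 : C2 (dt ψ) = Dt Y.w := by
    ext t x; rw [← ew]; exact congrArg Prod.snd (hψ.dt_eq t x)
  rw [c1, c2, dSq_zero, dSq_zero] at a1
  have a2 : L2Sq (dt θ s) = ε ^ 2 * J (Dt Y.b * Dt Y.b) s := by
    show dSq 0 (Dt θ s) = _
    rw [eθ, dt_smul, dSq0_smul]
  rw [a2, inv_mul_cancel_left₀ (by positivity)]
  have b1 := J_sq_nonneg (Dt Y.b) s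
  unfold L2Sq
  linarith

theorem U3 (h0 : 0 < ε) (eφ : φ = ε • Y.a)
    (s : ℝ) : (ε ^ 2)⁻¹ * dSq 1 (φ s) ≤ 2 * J Y.ga s := by
  have a4 := dSq1_smul_le ε Y.a s
  rw [← eφ] at a4
  rw [inv_mul_le_iff₀ (by positivity), ga_exp]
  linarith

theorem U4 (h0 : 0 < ε) (eφ : φ = ε • Y.a)
    {s : ℝ} (hs : s ∈ Set.Icc 0 T) (ha : J (Y.a * Y.a) s ≤ 200 * J Y.ga s) :
    (ε ^ 4)⁻¹ * HSq 1 (φ s) + (ε ^ 2)⁻¹ * L2Sq (dt φ s) ≤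
    202 * (ε⁻¹ * ε⁻¹ * J Y.ga s) + J (Dt Y.a * Dt Y.a) s := by
  have e : HSq 1 (φ s) = dSq 0 (φ s) + dSq 1 (φ s) := by
    simp [HSq, Finset.sum_range_succ]
  have a1 := U3 Y h0 eφ s
  have a2 : dSq 0 (φ s) = ε ^ 2 * J (Y.a * Y.a) s := by rw [eφ, dSq0_smul]
  have a3 : L2Sq (dt φ s) = ε ^ 2 * J (Dt Y.a * Dt Y.a) s := by
    show dSq 0 (Dt φ s) = _
    rw [eφ, dt_smul, dSq0_smul]
  rw [a3, inv_mul_cancel_left₀ (by positivity)]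
  have e4 : (ε ^ 4)⁻¹ = ε⁻¹ * ε⁻¹ * (ε ^ 2)⁻¹ := by field_simp
  have h : (ε ^ 2)⁻¹ * HSq 1 (φ s) ≤ 202 * J Y.ga s := by
    rw [e, a2, mul_add, inv_mul_cancel_left₀ (by positivity)]; linarith
  have := mul_le_mul_of_nonneg_left h (by positivity : 0 ≤ ε⁻¹ * ε⁻¹)
  rw [e4]
  linarith

theorem U5 (hψ : VSm ψ) (h0 : 0 < ε) (eθ : θ = ε • Y.b) (ev : C1 ψ = Y.v) (ew : C2 ψ = Y.w)
    (s : ℝ) : HSq 2 (ψ s) + (ε ^ 2)⁻¹ * HSq 2 (θ s) ≤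
    16 * ((J Y.gψ s + J Y.gb s + J Y.so s)
    + (J (D1 (D1 Y.v) * D1 (D1 Y.v)) s + J (D1 (D2 Y.v) * D1 (D2 Y.v)) s
      + J (D1 (D1 Y.w) * D1 (D1 Y.w)) s + J (D1 (D2 Y.w) * D1 (D2 Y.w)) s)
      + J (D2 (D2 Y.v) * D2 (D2 Y.v)) s + J (D2 (D2 Y.w) * D2 (D2 Y.w)) s
    + (J (D1 (D1 Y.b) * D1 (D1 Y.b)) s + J (D1 (D2 Y.b) * D1 (D2 Y.b)) s
      + J (D2 (D2 Y.b) * D2 (D2 Y.b)) s)) := by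
  have e : HSq 2 (ψ s) = dSq 0 (ψ s) + dSq 1 (ψ s) + dSq 2 (ψ s) := by
    simp [HSq, Finset.sum_range_succ]
  have e' : HSq 2 (θ s) = dSq 0 (θ s) + dSq 1 (θ s) + dSq 2 (θ s) := by
    simp [HSq, Finset.sum_range_succ]
  have a1 := U1 Y hψ h0 eθ ev ew s
  have a0 := hψ.dSq_le 0 s
  have a2 := hψ.dSq_le 2 s
  rw [ev, ew] at a0 a2
  rw [dSq_zero, dSq_zero] at a0
  have b1 := dSq2_le Y.v s
  have b2 := dSq2_le Y.w s
  have b3 := dSq2_smul_le ε Y.b s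
  rw [← eθ] at b3
  rw [← inv_mul_le_iff₀ (by positivity)] at b3
  have b4 : (ε ^ 2)⁻¹ * dSq 0 (θ s) = J (Y.b * Y.b) s := by
    rw [eθ, dSq0_smul, inv_mul_cancel_left₀ (by positivity)]
  have n1 := J_sq_nonneg (D1 (D1 Y.v)) s
  have n2 := J_sq_nonneg (D2 (D2 Y.v)) s
  have n3 := J_sq_nonneg (D1 (D1 Y.w)) s
  have n4 := J_sq_nonneg (D2 (D2 Y.w)) s
  have n5 := J_sq_nonneg (D1 (D1 Y.b)) s
  have n6 := J_sq_nonneg (D2 (D2 Y.b)) s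
  have n7 := J_sq_nonneg (D1 (D2 Y.b)) s
  have n8 := J_sq_nonneg Y.v s
  have n9 := J_sq_nonneg Y.w s
  have n10 := J_sq_nonneg Y.b s
  have n11 := Y.gψ0 s
  have n12 := Y.gb0 s
  rw [e, e', so_exp]
  rw [mul_add, mul_add, b4]
  linarith only [a0, a1, a2, b1, b2, b3, n1, n2, n3, n4, n5, n6, n7, n8, n9, n10, n11, n12]

theorem Wt_nonneg (s : ℝ) : 0 ≤ J Y.Wt s := by
  have p : 0 ≤ ε⁻¹ * ε⁻¹ := mul_self_nonneg _
  rw [Wt_exp]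
  have n0 := J_sq_nonneg (D1 (D2 Y.v)) s
  have n0' := J_sq_nonneg (D1 (D2 Y.w)) s
  have n1 := J_sq_nonneg (D1 (D1 Y.v)) s
  have n2 := J_sq_nonneg (D2 (D2 Y.v)) s
  have n3 := J_sq_nonneg (D1 (D1 Y.w)) s
  have n4 := J_sq_nonneg (D2 (D2 Y.w)) s
  have n5 := J_sq_nonneg (D1 (D1 Y.b)) s
  have n6 := J_sq_nonneg (D2 (D2 Y.b)) s
  have n7 := J_sq_nonneg (D1 (D2 Y.b)) s
  have n8 := J_sq_nonneg (Dt Y.v) s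
  have n9 := J_sq_nonneg (Dt Y.w) s
  have n10 := J_sq_nonneg (Dt Y.b) s
  have n11 := J_sq_nonneg (Dt Y.a) s
  have n12 := J_sq_nonneg Y.a s
  have n13 := Y.ga0 s
  have m1 := mul_nonneg p (J_sq_nonneg (D1 Y.a) s)
  have m2 := mul_nonneg p (J_sq_nonneg (D2 Y.a) s)
  have m3 := mul_nonneg p (add_nonneg (add_nonneg (Y.gψ0 s) (Y.gb0 s)) (Y.so0 s))
  linarith only [n0, n0', n1, n2, n3, n4, n5, n6, n7, n8, n9, n10, n11, n12, n13, m1, m2, m3]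

/-- the three time-integrands are controlled by the dissipation -/
theorem U6 (hψ : VSm ψ) (h0 : 0 < ε) (h1 : ε ≤ 1) (eφ : φ = ε • Y.a) (eθ : θ = ε • Y.b) (ev : C1 ψ = Y.v) (ew : C2 ψ = Y.w)
    {s : ℝ} (hs : s ∈ Set.Icc 0 T) (ha : J (Y.a * Y.a) s ≤ 200 * J Y.ga s) :
    (L2Sq (dt ψ s) + (ε ^ 2)⁻¹ * L2Sq (dt θ s) ≤ 202 * J Y.Wt s) ∧
    ((ε ^ 4)⁻¹ * HSq 1 (φ s) + (ε ^ 2)⁻¹ * L2Sq (dt φ s) ≤ 202 * J Y.Wt s) ∧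
    (HSq 2 (ψ s) + (ε ^ 2)⁻¹ * HSq 2 (θ s) ≤ 202 * J Y.Wt s) := by
  have u2 := U2 Y hψ h0 eθ ev ew s
  have u4 := U4 Y h0 eφ hs ha
  have u5 := U5 Y hψ h0 eθ ev ew s
  have p : 0 ≤ ε⁻¹ * ε⁻¹ := mul_self_nonneg _
  have p1 : 1 ≤ ε⁻¹ * ε⁻¹ := by
    have := (one_le_inv₀ h0).2 h1
    nlinarith
  rw [Wt_exp]
  rw [ga_exp, mul_add] at u4
  have n0 := J_sq_nonneg (D1 (D2 Y.v)) s
  have n0' := J_sq_nonneg (D1 (D2 Y.w)) s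
  have n1 := J_sq_nonneg (D1 (D1 Y.v)) s
  have n2 := J_sq_nonneg (D2 (D2 Y.v)) s
  have n3 := J_sq_nonneg (D1 (D1 Y.w)) s
  have n4 := J_sq_nonneg (D2 (D2 Y.w)) s
  have n5 := J_sq_nonneg (D1 (D1 Y.b)) s
  have n6 := J_sq_nonneg (D2 (D2 Y.b)) s
  have n7 := J_sq_nonneg (D1 (D2 Y.b)) s
  have n8 := J_sq_nonneg (Dt Y.v) s
  have n9 := J_sq_nonneg (Dt Y.w) s
  have n10 := J_sq_nonneg (Dt Y.b) s
  have n11 := J_sq_nonneg (Dt Y.a) s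
  have n12 := J_sq_nonneg Y.a s
  have n13 := Y.ga0 s
  have m1 := mul_nonneg p (J_sq_nonneg (D1 Y.a) s)
  have m2 := mul_nonneg p (J_sq_nonneg (D2 Y.a) s)
  have z := add_nonneg (add_nonneg (Y.gψ0 s) (Y.gb0 s)) (Y.so0 s)
  have m3 := mul_nonneg p z
  have m4 := le_mul_of_one_le_left z p1
  refine ⟨?_, ?_, ?_⟩
  · linarith only [u2, n0, n0', n1, n2, n3, n4, n5, n6, n7, n8, n9, n10, n11, n12, n13, m1, m2, m3]
  · linarith only [u4, n0, n0', n1, n2, n3, n4, n5, n6, n7, n8, n9, n10, n11, n12, n13, m1, m2, m3]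
  · linarith only [u5, n0, n0', n1, n2, n3, n4, n5, n6, n7, n8, n9, n10, n11, n12, n13, m1, m2, z, m4]

theorem upper (hψ : VSm ψ) (h0 : 0 < ε) (h1 : ε ≤ 1) (eφ : φ = ε • Y.a) (eθ : θ = ε • Y.b) (ev : C1 ψ = Y.v) (ew : C2 ψ = Y.w)
    {t Bd : ℝ} (ht : t ∈ Set.Icc 0 T)
    (ha : ∀ s ∈ Set.Icc 0 T, J (Y.a * Y.a) s ≤ 200 * J Y.ga s)
    (hB : ∀ s ∈ Set.Icc 0 t, (J Y.gψ s + J Y.gb s + J Y.ga s) + (∫ u in (0 : ℝ)..s, J Y.Wt u) ≤ Bd) :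
    A1 ε φ ψ θ t + A2 ε φ ψ θ t ≤ 612 * Bd := by
  have q2 : 0 ≤ (ε ^ 2)⁻¹ := by positivity
  have q4 : 0 ≤ (ε ^ 4)⁻¹ := by positivity
  have p2 : 0 < ε ^ 2 := by positivity
  have In : ∀ s ∈ Set.Icc 0 t, 0 ≤ ∫ u in (0 : ℝ)..s, J Y.Wt u := fun s hs =>
    ii_nonneg (Wt_nonneg Y) hs.1
  have E0 : ∀ s, 0 ≤ J Y.gψ s + J Y.gb s + J Y.ga s := fun s =>
    add_nonneg (add_nonneg (Y.gψ0 s) (Y.gb0 s)) (Y.ga0 s)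
  have tt : t ∈ Set.Icc 0 t := ⟨ht.1, le_rfl⟩
  have B0 : 0 ≤ Bd := by linarith [hB t tt, In t tt, E0 t]
  have Ib : ∫ u in (0 : ℝ)..t, J Y.Wt u ≤ Bd := by linarith [hB t tt, E0 t]
  have cW : Continuous fun s => 202 * J Y.Wt s := (J_cont SM.out).const_mul 202
  have IW : ∫ u in (0 : ℝ)..t, 202 * J Y.Wt u ≤ 202 * Bd := by
    rw [intervalIntegral.integral_const_mul]
    exact mul_le_mul_of_nonneg_left Ib (by norm_num)
  have sT : ∀ s ∈ Set.Icc 0 t, s ∈ Set.Icc 0 T := fun s hs => ⟨hs.1, hs.2.trans ht.2⟩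
  have U := fun s (hs : s ∈ Set.Icc 0 t) =>
    U6 Y hψ h0 h1 eφ eθ ev ew (sT s hs) (ha s (sT s hs))
  have s1 : ⨆ s ∈ Set.Icc (0 : ℝ) t, (dSq 1 (ψ s) + (ε ^ 2)⁻¹ * dSq 1 (θ s)) ≤ 4 * Bd :=
    biSup_le (by linarith) fun s hs => by
      have := U1 Y hψ h0 eθ ev ew s
      linarith [hB s hs, In s hs, Y.ga0 s]
  have s2 : (ε ^ 2)⁻¹ * (⨆ s ∈ Set.Icc (0 : ℝ) t, dSq 1 (φ s)) ≤ 2 * Bd := by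
    rw [inv_mul_le_iff₀ p2]
    refine biSup_le (by positivity) fun s hs => ?_
    rw [← inv_mul_le_iff₀ p2]
    have := U3 Y h0 eφ s
    linarith [hB s hs, In s hs, Y.gψ0 s, Y.gb0 s]
  have i1 := iint_le (g := fun s => L2Sq (dt ψ s) + (ε ^ 2)⁻¹ * L2Sq (dt θ s))
    (fun s => add_nonneg (dSq_nonneg _ _) (mul_nonneg q2 (dSq_nonneg _ _))) cW ht.1
    (fun s hs => (U s hs).1)
  have i2 := iint_le (g := fun s => (ε ^ 4)⁻¹ * HSq 1 (φ s) + (ε ^ 2)⁻¹ * L2Sq (dt φ s))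
    (fun s => add_nonneg (mul_nonneg q4 (HSq_nonneg _ _)) (mul_nonneg q2 (dSq_nonneg _ _))) cW ht.1
    (fun s hs => (U s hs).2.1)
  have i3 := iint_le (g := fun s => HSq 2 (ψ s) + (ε ^ 2)⁻¹ * HSq 2 (θ s))
    (fun s => add_nonneg (HSq_nonneg _ _) (mul_nonneg q2 (HSq_nonneg _ _))) cW ht.1
    (fun s hs => (U s hs).2.2)
  unfold A1 A2
  linarith only [s1, s2, i1, i2, i3, IW]

theorem lower (hψ : VSm ψ) (h0 : 0 < ε) (eφ : φ = ε • Y.a) (eθ : θ = ε • Y.b) (ev : C1 ψ = Y.v) (ew : C2 ψ = Y.w)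
    : J Y.gψ 0 + J Y.gb 0 + J Y.ga 0 + ε⁻¹ * ε⁻¹ * (J Y.so 0 + J (Y.a * Y.a) 0) ≤
    4 * (A1 ε φ ψ θ 0 + A2 ε φ ψ θ 0 + (ε ^ 2)⁻¹ * A0 ε φ ψ θ 0) := by
  have q2 : 0 ≤ (ε ^ 2)⁻¹ := by positivity
  have p2 : 0 < ε ^ 2 := by positivity
  have sφ : Sm φ := by rw [eφ]; exact SM.out
  have sθ : Sm θ := by rw [eθ]; exact SM.out
  have z : ∀ (n : ℕ) (s : ℝ), 0 ≤ dSq n (φ s) := fun n s => dSq_nonneg _ _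
  have zψ : ∀ (n : ℕ) (s : ℝ), 0 ≤ dSq n (ψ s) := fun n s => dSq_nonneg _ _
  have zθ : ∀ (n : ℕ) (s : ℝ), 0 ≤ dSq n (θ s) := fun n s => dSq_nonneg _ _
  have t0 : (0 : ℝ) ∈ Set.Icc (0 : ℝ) 0 := ⟨le_rfl, le_rfl⟩
  have a0 : dSq 0 (ψ 0) + (ε ^ 2)⁻¹ * dSq 0 (φ 0) + (ε ^ 2)⁻¹ * dSq 0 (θ 0) ≤ A0 ε φ ψ θ 0 := by
    have s := biSup_ge (g := fun s => dSq 0 (ψ s) + (ε ^ 2)⁻¹ * dSq 0 (φ s) + (ε ^ 2)⁻¹ * dSq 0 (θ s))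
      (fun s => add_nonneg (add_nonneg (zψ 0 s) (mul_nonneg q2 (z 0 s))) (mul_nonneg q2 (zθ 0 s)))
      (((hψ.lb 0).add ((sφ.lb 0).mul q2)).add ((sθ.lb 0).mul q2)) t0
    unfold A0 L2Sq
    rw [intervalIntegral.integral_same, add_zero]
    exact s
  have a1 : dSq 1 (ψ 0) + (ε ^ 2)⁻¹ * dSq 1 (θ 0) ≤ A1 ε φ ψ θ 0 := by
    have s := biSup_ge (g := fun s => dSq 1 (ψ s) + (ε ^ 2)⁻¹ * dSq 1 (θ s))
      (fun s => add_nonneg (zψ 1 s) (mul_nonneg q2 (zθ 1 s)))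
      ((hψ.lb 1).add ((sθ.lb 1).mul q2)) t0
    unfold A1
    rw [intervalIntegral.integral_same, add_zero]
    exact s
  have a2 : (ε ^ 2)⁻¹ * dSq 1 (φ 0) ≤ A2 ε φ ψ θ 0 := by
    have s := mul_le_mul_of_nonneg_left (biSup_ge (g := fun s => dSq 1 (φ s))
      (fun s => z 1 s) (sφ.lb 1) t0) q2
    unfold A2
    rw [intervalIntegral.integral_same, intervalIntegral.integral_same, add_zero, add_zero]
    exact s
  have v1 := (dSq_D1_le hψ.c1 0 0).trans (hψ.dSq_c1 1 0)
  have v2 := (dSq_D2_le hψ.c1 0 0).trans (hψ.dSq_c1 1 0)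
  have w1 := (dSq_D1_le hψ.c2 0 0).trans (hψ.dSq_c2 1 0)
  have w2 := (dSq_D2_le hψ.c2 0 0).trans (hψ.dSq_c2 1 0)
  have v0 := hψ.dSq_c1 0 0
  have w0 := hψ.dSq_c2 0 0
  rw [ev, dSq_zero] at v1 v2 v0
  rw [ew, dSq_zero] at w1 w2 w0
  have c1 := dSq_D1_le sθ 0 0
  have c2 := dSq_D2_le sθ 0 0
  have f1 := dSq_D1_le sφ 0 0
  have f2 := dSq_D2_le sφ 0 0
  have ci : ∀ {A B : ℝ}, ε ^ 2 * A ≤ B → A ≤ (ε ^ 2)⁻¹ * B := fun h => by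
    rw [le_inv_mul_iff₀ p2]; exact h
  have c1' : J (D1 Y.b * D1 Y.b) 0 ≤ (ε ^ 2)⁻¹ * dSq 1 (θ 0) := by
    apply ci; rw [← dSq0_smul, ← d1_smul, ← eθ]; exact c1
  have c2' : J (D2 Y.b * D2 Y.b) 0 ≤ (ε ^ 2)⁻¹ * dSq 1 (θ 0) := by
    apply ci; rw [← dSq0_smul, ← d2_smul, ← eθ]; exact c2
  have f1' : J (D1 Y.a * D1 Y.a) 0 ≤ (ε ^ 2)⁻¹ * dSq 1 (φ 0) := by
    apply ci; rw [← dSq0_smul, ← d1_smul, ← eφ]; exact f1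
  have f2' : J (D2 Y.a * D2 Y.a) 0 ≤ (ε ^ 2)⁻¹ * dSq 1 (φ 0) := by
    apply ci; rw [← dSq0_smul, ← d2_smul, ← eφ]; exact f2
  have c0' : J (Y.b * Y.b) 0 ≤ (ε ^ 2)⁻¹ * dSq 0 (θ 0) := by
    apply ci; rw [← dSq0_smul, ← eθ]
  have f0' : J (Y.a * Y.a) 0 ≤ (ε ^ 2)⁻¹ * dSq 0 (φ 0) := by
    apply ci; rw [← dSq0_smul, ← eφ]
  have hs : J Y.so 0 + J (Y.a * Y.a) 0 ≤ 4 * A0 ε φ ψ θ 0 := by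
    rw [so_exp]
    have := mul_nonneg q2 (z 0 0)
    have := mul_nonneg q2 (zθ 0 0)
    have := zψ 0 0
    linarith
  have hs' := mul_le_mul_of_nonneg_left hs q2
  have ei : ε⁻¹ * ε⁻¹ = (ε ^ 2)⁻¹ := by rw [sq, mul_inv]
  rw [ei, gψ_exp, gb_exp, ga_exp]
  have g1 := mul_nonneg q2 (z 1 0)
  have g2 := mul_nonneg q2 (zθ 1 0)
  have g3 := zψ 1 0
  linarith only [hs', v1, v2, w1, w2, c1', c2', f1', f2', a1, a2, g1, g2, g3]
end fin

/-- full `H¹`-type estimate: `A₁ + A₂`. -/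
theorem first_order_full_estimate (γ Pr r Kχ : ℝ)
    (hγ : 1 < γ) (hPr : 0 < Pr) (hr : 0 < 1 + r) (hK : 0 < Kχ) :
    ∃ Re₀ ε₁ : ℝ, 0 < Re₀ ∧ 0 < ε₁ ∧
      ∀ Re : ℝ, 0 < Re → Re < Re₀ →
        ∃ ε₂ C : ℝ, 0 < ε₂ ∧ 0 < C ∧
          ∀ (ε χ T : ℝ) (S : PerturbSol γ Pr r Re ε χ T),
            0 < ε → ε ≤ 1 → ε < ε₁ → ε ≤ ε₂ → 0 < χ → |1 - χ| ≤ Kχ * ε →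
            |1 - χ| ≤ 1 / 2 → 0 ≤ T → SmoothSol S → StdHyp S →
            Nfun ε S.φ S.ψ S.θ T ≤ 1 →
            ∀ t ∈ Set.Icc (0 : ℝ) T,
              A1 ε S.φ S.ψ S.θ t + A2 ε S.φ S.ψ S.θ t
                ≤ C * (A1 ε S.φ S.ψ S.θ 0 + A2 ε S.φ S.ψ S.θ 0
                    + (ε ^ 2)⁻¹ * A0 ε S.φ S.ψ S.θ 0) := by
  have hg1 : 0 < γ - 1 := by linarith
  have hc := cP_nonneg hγ hPr
  have hM4 : 4 ≤ MM γ Pr Kχ := by unfold MM; nlinarith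
  have hg : 0 < 1 / (γ - 1) := by positivity
  have hq : 0 < γ / ((γ - 1) * Pr) := by
    have : 0 < γ := by linarith
    positivity
  obtain ⟨k, hk, hk1, hkq⟩ : ∃ k : ℝ, 0 < k ∧ k ≤ 1 ∧ k ≤ γ / ((γ - 1) * Pr) :=
    ⟨min 1 (γ / ((γ - 1) * Pr)), lt_min one_pos hq, min_le_left _ _, min_le_right _ _⟩
  have hD : 0 < 16 * ((20 + 2 * (1 / (γ - 1))) * MM γ Pr Kχ) := by
    have : 0 < MM γ Pr Kχ := by linarith
    positivity
  refine ⟨k / (16 * ((20 + 2 * (1 / (γ - 1))) * MM γ Pr Kχ)), 2, div_pos hk hD, two_pos, ?_⟩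
  intro Re hRe hRe0
  have hμ : 0 < Re⁻¹ := inv_pos.mpr hRe
  have hκ : k * Re⁻¹ ≤ γ / (γ - 1) / (Re * Pr) := by
    have e : γ / (γ - 1) / (Re * Pr) = γ / ((γ - 1) * Pr) * Re⁻¹ := by
      field_simp
    rw [e]
    exact mul_le_mul_of_nonneg_right hkq hμ.le
  have hC : 2 * ((20 + 2 * (1 / (γ - 1))) * MM γ Pr Kχ) ≤ k * Re⁻¹ / 8 := by
    rw [lt_div_iff₀ hD] at hRe0
    have h1 : 16 * ((20 + 2 * (1 / (γ - 1))) * MM γ Pr Kχ) ≤ k * Re⁻¹ := by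
      rw [← div_eq_mul_inv, le_div_iff₀ hRe]
      linarith
    linarith
  obtain ⟨ε2, C, hε2, hC0, H⟩ := Sys.main (Re⁻¹) ((1 + r) * Re⁻¹) (γ / (γ - 1) / (Re * Pr))
    (1 / (γ - 1)) r (MM γ Pr Kχ) k (by linarith) hμ hr rfl hg hk hk1 hκ hC
  refine ⟨ε2, 612 * C * 4, hε2, by positivity, ?_⟩
  intro ε χ T S h0 h1 _ hle _ hKχ hχ hT hS hH hN t ht
  have hne : ε ≠ 0 := h0.ne'
  let Y := toSys S hγ hPr h0 h1 hK hKχ hχ hT hS hH hN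
  have eφ : S.φ = ε • Y.a := by
    have : Y.a = ε⁻¹ • S.φ := rfl
    rw [this, smul_inv_smul₀ hne]
  have eθ : S.θ = ε • Y.b := by
    have : Y.b = ε⁻¹ • S.θ := rfl
    rw [this, smul_inv_smul₀ hne]
  have ev : C1 S.ψ = Y.v := rfl
  have ew : C2 S.ψ = Y.w := rfl
  have hψ : VSm S.ψ := hS.2.1
  have hlow := lower Y hψ h0 eφ eθ ev ew
  have hup := upper Y hψ h0 h1 eφ eθ ev ew ht (fun s hs => Sys.a_le Y h0 hs)
    (fun s hs => H Y h0 hle s ⟨hs.1, hs.2.trans ht.2⟩)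
  refine hup.trans ?_
  have := mul_le_mul_of_nonneg_left hlow (by positivity : 0 ≤ 612 * C)
  linarith
end Couette
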